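/- Let r = r(n) be a sequence of integers with 1 ≤ r(n) ≤ n and, for each n, let X_1, …, X_{r+1} be independent random points chosen according to the Gaussian model, the Beta model with parameter ν > 0, or the spherical model in ℝ^n, and let 𝒱_{n,r} be the r-dimensional Hausdorff volume of their convex hull. (1) If r(n)/n → 0, then there exist real sequences a_{n,r} and b_{n,r} > 0 such that (𝒱_{n,r} − a_{n,r})/b_{n,r} converges in distribution to a standard Gaussian random variable Z. (2) If r(n)/n → α for some α ∈ (0,1), then there exists a sequence b_{n,r} > 0 such that 𝒱_{n,r}/b_{n,r} converges in distribution to e^{σZ}, where Z is standard Gaussian and σ = √((1/2) log(1/(1−α))) in the Gaussian model and σ = √((1/2) log(1/(1−α)) − α/2) in the Beta and spherical models. -/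

import Mathlib

open MeasureTheory ProbabilityTheory Real Filter Finset

/-- The standard Gaussian measure on `ℝ^n`. -/
noncomputable def stdGaussian (n : ℕ) : Measure (EuclideanSpace ℝ (Fin n)) :=
  volume.withDensity fun x =>
    ENNReal.ofReal ((2 * π) ^ (-(n : ℝ) / 2) * Real.exp (-‖x‖ ^ 2 / 2))

/-- The Beta model with parameter `ν` on `ℝ^n`. -/
noncomputable def betaModel (n : ℕ) (ν : ℝ) : Measure (EuclideanSpace ℝ (Fin n)) :=
  volume.withDensity fun x =>
    if ‖x‖ < 1 then
      ENNReal.ofReal (π ^ (-(n : ℝ) / 2) * Real.Gamma (((n : ℝ) + ν) / 2)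
        / Real.Gamma (ν / 2) * (1 - ‖x‖ ^ 2) ^ ((ν - 2) / 2))
    else 0

/-- The uniform probability measure on the unit sphere `S^{n-1} ⊂ ℝ^n`. -/
noncomputable def sphereUniform (n : ℕ) : Measure (EuclideanSpace ℝ (Fin n)) :=
  (μH[(n : ℝ) - 1] (Metric.sphere (0 : EuclideanSpace ℝ (Fin n)) 1))⁻¹ •
    (μH[(n : ℝ) - 1]).restrict (Metric.sphere (0 : EuclideanSpace ℝ (Fin n)) 1)

/-- The `r`-dimensional volume (Hausdorff measure) of the convex hull of the points
`X 0, …, X r` in `ℝ^n`. -/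
noncomputable def simplexVol (n r : ℕ) (X : Fin (r + 1) → EuclideanSpace ℝ (Fin n)) : ℝ :=
  (μH[(r : ℝ)] (convexHull ℝ (Set.range X))).toReal


section
open MeasureTheory ProbabilityTheory Real Filter Finset

set_option linter.all false

section GramAlgebra
open Matrix

variable {E : Type*} [NormedAddCommGroup E] [InnerProductSpace ℝ E]

/-- Gram determinant. -/
noncomputable def gdet {j : ℕ} (Y : Fin j → E) : ℝ := (gram ℝ Y).det

/-- The quantity `1ᵀ G⁻¹ 1` for the Gram matrix `G`. -/
noncomputable def gq {j : ℕ} (Y : Fin j → E) : ℝ :=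
  (1 : Fin j → ℝ) ⬝ᵥ ((gram ℝ Y)⁻¹ *ᵥ 1)

lemma gram_mulVec_inner {j : ℕ} (Y : Fin j → E) (β : Fin j → ℝ) (i : Fin j) :
    (gram ℝ Y *ᵥ β) i = inner ℝ (Y i) (∑ k, β k • Y k) := by
  simp [mulVec, dotProduct, inner_sum, inner_smul_right, mul_comm]

lemma gdet_ne_zero_iff {j : ℕ} {Y : Fin j → E} : gdet Y ≠ 0 ↔ LinearIndependent ℝ Y :=
  Matrix.det_gram_ne_zero_iff_linearIndependent

lemma gq_eq {j : ℕ} {Y : Fin j → E} (hY : LinearIndependent ℝ Y) {h : E}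
    (hs : h ∈ Submodule.span ℝ (Set.range Y)) (h1 : ∀ i, inner ℝ (Y i) h = 1) :
    gq Y = ‖h‖ ^ 2 := by
  obtain ⟨β, rfl⟩ := (Submodule.mem_span_range_iff_exists_fun ℝ).1 hs
  have hG : gram ℝ Y *ᵥ β = 1 := by
    ext i; rw [gram_mulVec_inner, h1]; rfl
  have hu : IsUnit (gram ℝ Y).det := (gdet_ne_zero_iff.2 hY).isUnit
  have hb : (gram ℝ Y)⁻¹ *ᵥ 1 = β := by
    rw [← hG, mulVec_mulVec, Matrix.nonsing_inv_mul _ hu, one_mulVec]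
  rw [gq, hb, ← real_inner_self_eq_norm_sq, sum_inner]
  simp only [real_inner_smul_left, h1]
  simp [dotProduct]

lemma exists_dual {j : ℕ} {Y : Fin j → E} (hY : LinearIndependent ℝ Y) :
    ∃ h ∈ Submodule.span ℝ (Set.range Y), ∀ i, inner ℝ (Y i) h = 1 := by
  have hu : IsUnit (gram ℝ Y).det := (gdet_ne_zero_iff.2 hY).isUnit
  refine ⟨∑ k, ((gram ℝ Y)⁻¹ *ᵥ 1) k • Y k,
    (Submodule.mem_span_range_iff_exists_fun ℝ).2 ⟨_, rfl⟩, fun i => ?_⟩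
  rw [← gram_mulVec_inner, mulVec_mulVec, Matrix.mul_nonsing_inv _ hu, one_mulVec]; rfl

lemma gdet_snoc {j : ℕ} {Y : Fin j → E} (hY : LinearIndependent ℝ Y) {y z : E}
    (hy : y ∈ Submodule.span ℝ (Set.range Y)) (hz : ∀ i, inner ℝ (Y i) z = 0) :
    gdet (Fin.snoc (α := fun _ => E) Y (y + z)) = gdet Y * ‖z‖ ^ 2 := by
  obtain ⟨β, rfl⟩ := (Submodule.mem_span_range_iff_exists_fun ℝ).1 hy
  set y := ∑ i, β i • Y i with hydef
  have hyz : inner ℝ y z = 0 := by simp [hydef, sum_inner, real_inner_smul_left, hz]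
  have hu : IsUnit (gram ℝ Y).det := (gdet_ne_zero_iff.2 hY).isUnit
  letI := Matrix.invertibleOfIsUnitDet _ hu
  set B : Matrix (Fin j) (Fin 1) ℝ := of fun i _ => inner ℝ (Y i) y with hB
  have hBc : B = gram ℝ Y * (of fun i (_ : Fin 1) => β i) := by
    ext i k
    simp [hB, hydef, Matrix.mul_apply, inner_sum, inner_smul_right, mul_comm]
  have key : (gram ℝ (Fin.snoc (α := fun _ => E) Y (y + z))).submatrix finSumFinEquiv
      finSumFinEquiv = fromBlocks (gram ℝ Y) B Bᵀ (of fun _ _ => ‖y‖ ^ 2 + ‖z‖ ^ 2) := by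
    ext a b
    rcases a with a | a <;> rcases b with b | b
    · have ha : Fin.castAdd 1 a = a.castSucc := rfl
      have hb : Fin.castAdd 1 b = b.castSucc := rfl
      simp [ha, hb]
    · have ha : Fin.castAdd 1 a = a.castSucc := rfl
      have hb : Fin.natAdd j b = Fin.last j := by ext; simp
      simp [ha, hb, hB, inner_add_right, hz]
    · have ha : Fin.castAdd 1 b = b.castSucc := rfl
      have hb : Fin.natAdd j a = Fin.last j := by ext; simp
      have hz' : inner ℝ z (Y b) = 0 := by rw [real_inner_comm]; exact hz b
      simp [ha, hb, hB, inner_add_left, real_inner_comm, hz']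
    · have ha : Fin.natAdd j a = Fin.last j := by ext; simp
      have hb : Fin.natAdd j b = Fin.last j := by ext; simp
      simp only [submatrix_apply, finSumFinEquiv_apply_right, ha, hb, gram_apply, Fin.snoc_last,
        fromBlocks_apply₂₂, of_apply]
      rw [real_inner_self_eq_norm_sq, norm_add_sq_real, hyz]; ring
  have : gdet (Fin.snoc (α := fun _ => E) Y (y + z)) = (fromBlocks (gram ℝ Y) B Bᵀ
      (of fun _ _ => ‖y‖ ^ 2 + ‖z‖ ^ 2)).det := by
    rw [← key, det_submatrix_equiv_self]; rfl
  rw [this, det_fromBlocks₁₁, gdet]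
  congr 1
  have h2 : Bᵀ * ⅟(gram ℝ Y) * B = of fun (_ _ : Fin 1) => ‖y‖ ^ 2 := by
    have h3 : ⅟(gram ℝ Y) * B = of fun i (_ : Fin 1) => β i := by
      rw [hBc, ← Matrix.mul_assoc, invOf_mul_self, Matrix.one_mul]
    rw [Matrix.mul_assoc, h3]
    ext a b
    simp only [Matrix.mul_apply, transpose_apply, hB, of_apply]
    rw [← real_inner_self_eq_norm_sq, hydef, sum_inner]
    simp [real_inner_smul_left, mul_comm]
  rw [h2, det_fin_one]
  simp

lemma gq_snoc {j : ℕ} {Y : Fin j → E} (hY : LinearIndependent ℝ Y) {y z h : E}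
    (hy : y ∈ Submodule.span ℝ (Set.range Y)) (hz : ∀ i, inner ℝ (Y i) z = 0) (hz0 : z ≠ 0)
    (hs : h ∈ Submodule.span ℝ (Set.range Y)) (h1 : ∀ i, inner ℝ (Y i) h = 1) :
    gq (Fin.snoc (α := fun _ => E) Y (y + z)) = gq Y + (1 - inner ℝ (y + z) h) ^ 2 / ‖z‖ ^ 2 := by
  have hperp : ∀ v ∈ Submodule.span ℝ (Set.range Y), inner ℝ v z = 0 := by
    intro v hv
    obtain ⟨β, rfl⟩ := (Submodule.mem_span_range_iff_exists_fun ℝ).1 hv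
    simp [sum_inner, real_inner_smul_left, hz]
  have hzn : ‖z‖ ^ 2 ≠ 0 := by positivity
  have hli : LinearIndependent ℝ (Fin.snoc (α := fun _ => E) Y (y + z)) := by
    rw [← gdet_ne_zero_iff, gdet_snoc hY hy hz]
    exact mul_ne_zero (gdet_ne_zero_iff.2 hY) hzn
  have hsub : Submodule.span ℝ (Set.range Y) ≤
      Submodule.span ℝ (Set.range (Fin.snoc (α := fun _ => E) Y (y + z))) := by
    apply Submodule.span_mono
    rintro _ ⟨i, rfl⟩
    exact ⟨i.castSucc, by simp⟩
  have hx : y + z ∈ Submodule.span ℝ (Set.range (Fin.snoc (α := fun _ => E) Y (y + z))) :=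
    Submodule.subset_span ⟨Fin.last j, by simp⟩
  have hzs : z ∈ Submodule.span ℝ (Set.range (Fin.snoc (α := fun _ => E) Y (y + z))) := by
    have := Submodule.sub_mem _ hx (hsub hy)
    simpa using this
  set t := (1 - inner ℝ (y + z) h) / ‖z‖ ^ 2 with ht
  rw [gq_eq hli (h := h + t • z)
    (Submodule.add_mem _ (hsub hs) (Submodule.smul_mem _ _ hzs)), gq_eq hY hs h1]
  · rw [norm_add_sq_real, inner_smul_right, hperp h hs, norm_smul, mul_pow, ht]
    simp only [norm_div, norm_pow, norm_norm, Real.norm_eq_abs, div_pow, sq_abs]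
    field_simp
    ring
  · intro i
    refine Fin.lastCases ?_ (fun i => ?_) i
    · rw [Fin.snoc_last, inner_add_right, inner_smul_right, inner_add_left (x := y) (y := z)
        (z := z), hperp y hy, zero_add, real_inner_self_eq_norm_sq, ht]
      field_simp
      ring
    · rw [Fin.snoc_castSucc, inner_add_right, inner_smul_right, hz, h1]; ring

lemma gdet_diff {r : ℕ} {Y : Fin (r + 1) → E} (hY : LinearIndependent ℝ Y) :
    (gram ℝ fun i : Fin r => Y i.succ - Y 0).det = gdet Y * gq Y := by
  obtain ⟨h, hs, h1⟩ := exists_dual hY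
  have hq := gq_eq hY hs h1
  obtain ⟨β, rfl⟩ := (Submodule.mem_span_range_iff_exists_fun ℝ).1 hs
  set h := ∑ i, β i • Y i with hh
  have hq0 : gq Y ≠ 0 := by
    rw [hq]
    have : h ≠ 0 := by
      intro h0; have := h1 0; rw [h0] at this; simp at this
    positivity
  have hsum : ∑ i, β i = gq Y := by
    rw [hq, ← real_inner_self_eq_norm_sq]
    have : inner ℝ h h = ∑ i, β i * inner ℝ (Y i) h := by
      nth_rewrite 1 [hh]
      rw [sum_inner]
      simp only [real_inner_smul_left]
    rw [this]; simp [h1]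
  let B : Matrix (Fin (r + 1)) (Fin (r + 1)) ℝ :=
    of (Fin.cons β fun i : Fin r => Pi.single i.succ 1 - Pi.single 0 1)
  have hcomb : ∀ i, ∑ k, B i k • Y k =
      (Fin.cons h (fun i : Fin r => Y i.succ - Y 0) : Fin (r + 1) → E) i := by
    intro i
    refine Fin.cases ?_ (fun i => ?_) i
    · simp [B, hh]
    · simp [B, sub_smul, Finset.sum_sub_distrib, Pi.single_apply]
  have hprod : B * gram ℝ Y * Bᵀ =
      gram ℝ (Fin.cons h (fun i : Fin r => Y i.succ - Y 0) : Fin (r + 1) → E) := by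
    ext i k
    rw [gram_apply, ← hcomb, ← hcomb, ← star_dotProduct_gram_mulVec]
    rw [Matrix.mul_assoc, Matrix.mul_apply]
    simp only [dotProduct, star_trivial]
    rfl
  have hdetR : (gram ℝ (Fin.cons h (fun i : Fin r => Y i.succ - Y 0) : Fin (r + 1) → E)).det
      = gq Y * (gram ℝ fun i : Fin r => Y i.succ - Y 0).det := by
    rw [det_succ_row_zero, Fin.sum_univ_succ]
    have : ∀ i : Fin r, inner ℝ h (Y i.succ - Y 0) = 0 := by
      intro i; rw [real_inner_comm, inner_sub_left, h1, h1, sub_self]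
    simp only [gram_apply, Fin.cons_zero, Fin.cons_succ, this]
    simp only [Fin.val_zero, pow_zero, one_mul, mul_zero, zero_mul, Finset.sum_const_zero, add_zero,
      real_inner_self_eq_norm_sq, ← hq]
    rfl
  have hdetB : B.det = gq Y := by
    let U : Matrix (Fin (r + 1)) (Fin (r + 1)) ℝ :=
      of fun i k => if k = 0 then 1 else if i = k then 1 else 0
    have hU : U.det = 1 := by
      rw [Matrix.det_of_isLowerTriangular U]
      · apply Finset.prod_eq_one; intro i _; simp [U]
      · intro i k hik
        have hik' : i < k := hik
        have : k ≠ 0 := by rintro rfl; exact absurd hik' (by simp)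
        simp [U, this, hik'.ne]
    have hBU : (B * U).det = gq Y := by
      rw [Matrix.det_of_isUpperTriangular (M := B * U), Fin.prod_univ_succ]
      · have h0 : (B * U) 0 0 = gq Y := by
          rw [← hsum]; simp [Matrix.mul_apply, B, U]
        have h2 : ∀ i : Fin r, (B * U) i.succ i.succ = 1 := by
          intro i
          simp [Matrix.mul_apply, B, U]
        simp [h0, h2]
      · intro i k hik
        have hik' : k < i := hik
        obtain ⟨i, rfl⟩ := Fin.exists_succ_eq.2 (show i ≠ 0 by rintro rfl; exact absurd hik' (by simp))
        rcases Fin.eq_zero_or_eq_succ k with rfl | ⟨k, rfl⟩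
        · simp [Matrix.mul_apply, B, U, Finset.sum_sub_distrib, Pi.single_apply]
        · have hk : i ≠ k := by rintro rfl; exact lt_irrefl _ hik'
          simp [Matrix.mul_apply, B, U, Pi.single_apply, hk, Ne.symm hk]
          try exact Fin.succ_ne_zero _
    rw [← hBU, det_mul, hU, mul_one]
  have := congrArg Matrix.det hprod
  rw [det_mul, det_mul, det_transpose, hdetB, hdetR] at this
  apply mul_left_cancel₀ hq0
  rw [← this, gdet]; ring

end GramAlgebra

end

section
open MeasureTheory ProbabilityTheory Real Filter Finset
set_option linter.all false

section Volume
open Module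
open scoped Pointwise

/-- vertices of the reference simplex -/
noncomputable def refVert (r : ℕ) : Fin (r + 1) → EuclideanSpace ℝ (Fin r) :=
  Fin.cons 0 (fun i => EuclideanSpace.basisFun (Fin r) ℝ i)

noncomputable def refVol (r : ℕ) : ℝ := simplexVol r r (refVert r)

lemma refVol_pos (r : ℕ) : 0 < refVol r := by
  have hH : (μH[(r : ℝ)] : Measure (EuclideanSpace ℝ (Fin r))).IsAddHaarMeasure := by
    simpa using MeasureTheory.isAddHaarMeasure_hausdorffMeasure (E := EuclideanSpace ℝ (Fin r))
  have hIntg : (interior (convexHull ℝ (Set.range (refVert r)))).Nonempty := by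
    rw [interior_convexHull_nonempty_iff_affineSpan_eq_top]
    have h0 : (0 : EuclideanSpace ℝ (Fin r)) ∈ Set.range (refVert r) := ⟨0, by simp [refVert]⟩
    rw [AffineSubspace.affineSpan_eq_top_iff_vectorSpan_eq_top_of_nonempty ℝ _ _ ⟨_, h0⟩,
      vectorSpan_eq_span_vsub_set_right ℝ h0, eq_top_iff, ← (EuclideanSpace.basisFun (Fin r) ℝ).toBasis.span_eq]
    apply Submodule.span_mono
    rintro _ ⟨i, rfl⟩
    exact ⟨refVert r i.succ, ⟨_, rfl⟩, by simp [refVert]⟩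
  have hpos : 0 < μH[(r : ℝ)] (convexHull ℝ (Set.range (refVert r))) :=
    Measure.measure_pos_of_nonempty_interior _ hIntg
  have hfin : μH[(r : ℝ)] (convexHull ℝ (Set.range (refVert r))) < ⊤ :=
    ((Set.finite_range _).isCompact_convexHull (𝕜 := ℝ)).measure_lt_top
  exact ENNReal.toReal_pos hpos.ne' hfin.ne

lemma simplexVol_eq (n r : ℕ) (X : Fin (r + 1) → EuclideanSpace ℝ (Fin n)) :
    simplexVol n r X =
      refVol r * √((Matrix.gram ℝ fun i : Fin r => X i.succ - X 0).det) := by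
  let b := EuclideanSpace.basisFun (Fin r) ℝ
  let f : EuclideanSpace ℝ (Fin r) →ₗ[ℝ] EuclideanSpace ℝ (Fin n) :=
    b.toBasis.constr ℝ (fun i => X i.succ - X 0)
  have hf : ∀ i, f (b i) = X i.succ - X 0 := by
    intro i
    have := b.toBasis.constr_basis ℝ (fun i : Fin r => X i.succ - X 0) i
    simpa [f] using this
  have hr : Set.range X = X 0 +ᵥ (f '' Set.range (refVert r)) := by
    rw [← Set.range_comp]
    have : X = fun i => X 0 +ᵥ (f ∘ refVert r) i := by
      funext i
      refine Fin.cases ?_ (fun i => ?_) i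
      · simp [refVert]
      · have := hf i
        simp only [b] at this
        simp only [refVert, Function.comp, Fin.cons_succ, this]; simp
    conv_lhs => rw [this]
    rw [← Set.image_vadd, ← Set.range_comp]; rfl
  rw [simplexVol, hr, convexHull_vadd, ← LinearMap.image_convexHull, hausdorffMeasure_vadd]
  · have := LinearMap.hausdorffMeasure_image f (convexHull ℝ (Set.range (refVert r)))
    simp only [finrank_euclideanSpace, Fintype.card_fin] at this
    rw [this, ENNReal.toReal_mul, ENNReal.toReal_ofReal (LinearMap.normDet_nonneg f), mul_comm]
    congr 1
    have h2 := LinearMap.normDet_sq_eq_det_gram f b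
    simp only [hf] at h2
    rw [← h2]
    simp [Real.sqrt_sq (LinearMap.normDet_nonneg f)]
  · left; positivity

lemma simplexVol_eq' (n r : ℕ) (X : Fin (r + 1) → EuclideanSpace ℝ (Fin n))
    (h : LinearIndependent ℝ X) :
    simplexVol n r X = refVol r * √(gdet X * gq X) := by
  rw [simplexVol_eq, gdet_diff h]

end Volume

end

section
open MeasureTheory ProbabilityTheory Real Filter Finset
set_option linter.all false

section Past
variable {S T : Type*} [MeasurableSpace S] [MeasurableSpace T] [Inhabited S]

/-- `u` depends measurably on the coordinates `< j` only. -/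
def Past (j : ℕ) (u : (ℕ → S) → T) : Prop :=
  Measurable u ∧ ∀ ω ω' : ℕ → S, (∀ i < j, ω i = ω' i) → u ω = u ω'

lemma Past.indep {j : ℕ} {u : (ℕ → S) → T} (hu : Past j u) (κ : Measure S)
    [IsProbabilityMeasure κ] :
    IndepFun u (fun ω => ω j) (Measure.infinitePi fun _ : ℕ => κ) := by
  have h := iIndepFun_infinitePi (P := fun _ : ℕ => κ) (X := fun _ => (id : S → S))
    (fun _ => measurable_id)
  have h2 := h.indepFun_finset (Finset.range j) {j} (by simp) (fun i => by simpa using measurable_pi_apply i)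
  classical
  let ext : ((i : Finset.range j) → S) → (ℕ → S) := fun x i =>
    if hi : i ∈ Finset.range j then x ⟨i, hi⟩ else default
  have hext : Measurable ext := by
    rw [measurable_pi_iff]; intro i
    by_cases hi : i ∈ Finset.range j
    · simp only [ext, hi, dite_true]; exact measurable_pi_apply _
    · simp only [ext, hi, dite_false]; exact measurable_const
  have h3 := h2.comp (φ := u ∘ ext) (ψ := fun x => x ⟨j, by simp⟩) (hu.1.comp hext)
    (measurable_pi_apply (X := fun _ : ({j} : Finset ℕ) => S) ⟨j, by simp⟩)
  convert h3 using 1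
  · ext ω
    simp only [Function.comp]
    apply hu.2
    intro i hi
    simp [ext, hi]
  · rfl

lemma Past.map_prod {j : ℕ} {u : (ℕ → S) → T} (hu : Past j u) (κ : Measure S)
    [IsProbabilityMeasure κ] :
    (Measure.infinitePi fun _ : ℕ => κ).map (fun ω => (u ω, ω j)) =
      ((Measure.infinitePi fun _ : ℕ => κ).map u).prod κ := by
  have h := (indepFun_iff_map_prod_eq_prod_map_map hu.1.aemeasurable
    (measurable_pi_apply j).aemeasurable).1 (hu.indep κ)
  rw [h, (measurePreserving_eval_infinitePi (fun _ : ℕ => κ) j).map_eq]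

end Past

section Basis

/-- An orthonormal basis adapted to `Y`. -/
lemma exists_adapted {n j : ℕ} [NeZero n] (hj : j ≤ n) {Y : Fin j → EuclideanSpace ℝ (Fin n)}
    (hY : LinearIndependent ℝ Y) {h : EuclideanSpace ℝ (Fin n)}
    (hs : h ∈ Submodule.span ℝ (Set.range Y)) (h1 : ∀ i, inner ℝ (Y i) h = 1) :
    ∃ b : OrthonormalBasis (Fin n) ℝ (EuclideanSpace ℝ (Fin n)),
      (∀ k : Fin n, (k : ℕ) < j → b k ∈ Submodule.span ℝ (Set.range Y)) ∧
      (∀ k : Fin n, j ≤ (k : ℕ) → ∀ i, inner ℝ (Y i) (b k) = 0) ∧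
      h = ‖h‖ • b 0 := by
  set V := Submodule.span ℝ (Set.range Y) with hV
  have hfr : Module.finrank ℝ V = Fintype.card (Fin j) := by
    rw [hV, finrank_span_eq_card hY]
  obtain ⟨c, hc⟩ : ∃ c : OrthonormalBasis (Fin j) ℝ V, ∀ i : Fin j, (i : ℕ) = 0 →
      h = ‖h‖ • (c i : EuclideanSpace ℝ (Fin n)) := by
    rcases Nat.eq_zero_or_pos j with rfl | hj0
    · refine ⟨(stdOrthonormalBasis ℝ V).reindex (finCongr (by rw [hfr]; simp)), fun i => i.elim0⟩
    · have hh : h ≠ 0 := by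
        intro h0; have := h1 ⟨0, hj0⟩; rw [h0] at this; simp at this
      have hhn : ‖h‖ ≠ 0 := by simpa using hh
      let h' : V := ⟨h, hs⟩
      obtain ⟨c, hc⟩ := Orthonormal.exists_orthonormalBasis_extension_of_card_eq (𝕜 := ℝ) (E := V)
        hfr (v := fun _ => (‖h‖⁻¹ : ℝ) • h') (s := {⟨0, hj0⟩}) (by
          constructor
          · rintro ⟨i, hi⟩
            have : ‖h'‖ = ‖h‖ := rfl
            simp [Set.domRestrict, norm_smul, this, hhn]
          · rintro ⟨i, hi⟩ ⟨k, hk⟩ hik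
            exact absurd (Subtype.ext ((Set.mem_singleton_iff.1 hi).trans (Set.mem_singleton_iff.1 hk).symm)) hik)
      refine ⟨c, fun i hi => ?_⟩
      have : i = ⟨0, hj0⟩ := Fin.ext hi
      rw [this, hc _ rfl]
      simp [h', smul_smul, hhn]
  obtain ⟨b, hb⟩ := Orthonormal.exists_orthonormalBasis_extension_of_card_eq (𝕜 := ℝ)
    (E := EuclideanSpace ℝ (Fin n)) (ι := Fin n) (by simp)
    (v := fun k => if hk : (k : ℕ) < j then (c ⟨k, hk⟩ : EuclideanSpace ℝ (Fin n)) else 0)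
    (s := {k | (k : ℕ) < j}) (by
      constructor
      · rintro ⟨i, hi⟩
        have hi' : (i : ℕ) < j := hi
        have := c.orthonormal.1 ⟨i, hi'⟩
        simp only [Set.domRestrict, hi', dite_true]
        exact this
      · rintro ⟨i, hi⟩ ⟨k, hk⟩ hik
        have hi' : (i : ℕ) < j := hi
        have hk' : (k : ℕ) < j := hk
        have := c.orthonormal.2 (i := ⟨i, hi'⟩) (j := ⟨k, hk'⟩) (by
          intro h; apply hik; ext; simpa using h)
        simpa [Set.domRestrict, hi', hk'] using this)
  have hb' : ∀ k : Fin n, ∀ hk : (k : ℕ) < j, b k = (c ⟨k, hk⟩ : EuclideanSpace ℝ (Fin n)) := by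
    intro k hk; rw [hb k hk]; simp [hk]
  refine ⟨b, fun k hk => ?_, fun k hk i => ?_, ?_⟩
  · rw [hb' k hk]; exact (c ⟨k, hk⟩).2
  · have hYi : Y i ∈ V := Submodule.subset_span ⟨i, rfl⟩
    have := c.sum_repr ⟨Y i, hYi⟩
    have h2 := congrArg (fun v : V => (v : EuclideanSpace ℝ (Fin n))) this
    simp only [AddSubmonoidClass.coe_finsetSum, Submodule.coe_smul] at h2
    rw [← h2, sum_inner]
    apply Finset.sum_eq_zero
    intro l _
    have : (c l : EuclideanSpace ℝ (Fin n)) = b ⟨l, l.2.trans_le hj⟩ := (hb' ⟨l, l.2.trans_le hj⟩ l.2).symm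
    rw [real_inner_smul_left, this, b.orthonormal.2, mul_zero]
    intro h; have := congrArg Fin.val h; simp at this; omega
  · rcases Nat.eq_zero_or_pos j with rfl | hj0
    · have : h = 0 := by
        have : Set.range Y = ∅ := Set.range_eq_empty Y
        simpa [hV, this] using hs
      simp [this]
    · rw [hb' 0 (by simpa using hj0)]; exact hc _ (by simp)

end Basis

end

section
open MeasureTheory ProbabilityTheory Real Filter Finset
set_option linter.all false

/-- basic sample space for one point -/
abbrev Smp (n : ℕ) := (Fin n → ℝ) × ℝ

noncomputable def Ac {n : ℕ} (j : ℕ) (s : Smp n) : ℝ :=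
  ∑ k : Fin n, if j ≤ (k : ℕ) then s.1 k ^ 2 else 0

@[fun_prop]
lemma measurable_Ac {n : ℕ} (j : ℕ) : Measurable (Ac (n := n) j) := by
  unfold Ac
  apply Finset.measurable_sum; intro k _
  split_ifs <;> fun_prop

/-- gaussian vector times an independent variable -/
noncomputable def kap (n : ℕ) (lam : Measure ℝ) : Measure (Smp n) :=
  (Measure.pi fun _ : Fin n => gaussianReal 0 1).prod lam

instance (n : ℕ) (lam : Measure ℝ) [IsProbabilityMeasure lam] : IsProbabilityMeasure (kap n lam) := by
  unfold kap; infer_instance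

noncomputable def stepF {n : ℕ} [NeZero n] (W : Smp n → ℝ) (j : ℕ) (p : (ℝ × ℝ) × Smp n) : ℝ × ℝ :=
  (p.1.1 * (Ac j p.2 / W p.2 ^ 2), p.1.2 + (W p.2 - √p.1.2 * p.2.1 0) ^ 2 / Ac j p.2)

noncomputable def dq {n : ℕ} [NeZero n] (W : Smp n → ℝ) : ℕ → (ℕ → Smp n) → ℝ × ℝ
  | 0, _ => (1, 0)
  | j + 1, ω => stepF W j (dq W j ω, ω j)

lemma measurable_stepF {n : ℕ} [NeZero n] {W : Smp n → ℝ} (hW : Measurable W) (j : ℕ) :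
    Measurable (stepF W j) := by
  unfold stepF; fun_prop

lemma dq_past {n : ℕ} [NeZero n] {W : Smp n → ℝ} (hW : Measurable W) (j : ℕ) :
    Past j (dq W j) := by
  induction j with
  | zero => exact ⟨(measurable_const : Measurable fun _ : ℕ → Smp n => ((1 : ℝ), (0 : ℝ))), fun _ _ _ => rfl⟩
  | succ j ih =>
    refine ⟨?_, fun ω ω' h => ?_⟩
    · have := ih.1
      exact (measurable_stepF hW j).comp (f := fun ω : ℕ → Smp n => (dq W j ω, ω j)) (by fun_prop)
    · simp only [dq]
      rw [ih.2 ω ω' (fun i hi => h i (by omega)), h j (by omega)]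

lemma measurable_gdet {n j : ℕ} : Measurable (gdet (j := j) (E := EuclideanSpace ℝ (Fin n))) := by
  apply Continuous.measurable
  unfold gdet Matrix.gram
  fun_prop

lemma measurable_gq {n j : ℕ} : Measurable (gq (j := j) (E := EuclideanSpace ℝ (Fin n))) := by
  have h1 : Continuous (fun Y : Fin j → EuclideanSpace ℝ (Fin n) =>
      (1 : Fin j → ℝ) ⬝ᵥ (Matrix.mulVec (Matrix.adjugate (Matrix.gram ℝ Y)) 1)) := by
    unfold Matrix.gram
    fun_prop
  have h2 : (gq (j := j) (E := EuclideanSpace ℝ (Fin n))) = fun Y => (gdet Y)⁻¹ *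
     ((1 : Fin j → ℝ) ⬝ᵥ (Matrix.mulVec (Matrix.adjugate (Matrix.gram ℝ Y)) 1)) := by
    ext Y
    rw [gq, Matrix.inv_def, Matrix.smul_mulVec, dotProduct_smul, gdet, Ring.inverse_eq_inv, smul_eq_mul]
  rw [h2]
  exact measurable_gdet.inv.mul h1.measurable

lemma step_pointwise {n j : ℕ} [NeZero n] {Y : Fin j → EuclideanSpace ℝ (Fin n)}
    (hY : LinearIndependent ℝ Y) {h : EuclideanSpace ℝ (Fin n)}
    (hs : h ∈ Submodule.span ℝ (Set.range Y)) (h1 : ∀ i, inner ℝ (Y i) h = 1)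
    (b : OrthonormalBasis (Fin n) ℝ (EuclideanSpace ℝ (Fin n)))
    (hb1 : ∀ k : Fin n, (k : ℕ) < j → b k ∈ Submodule.span ℝ (Set.range Y))
    (hb2 : ∀ k : Fin n, j ≤ (k : ℕ) → ∀ i, inner ℝ (Y i) (b k) = 0)
    (hb3 : h = ‖h‖ • b 0) (W : Smp n → ℝ) (s : Smp n) (hW : 0 < W s) (hA : 0 < Ac j s) :
    (gdet (Fin.snoc (α := fun _ => EuclideanSpace ℝ (Fin n)) Y ((W s)⁻¹ • ∑ k, s.1 k • b k)),
     gq (Fin.snoc (α := fun _ => EuclideanSpace ℝ (Fin n)) Y ((W s)⁻¹ • ∑ k, s.1 k • b k)))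
     = stepF W j ((gdet Y, gq Y), s) := by
  set y : EuclideanSpace ℝ (Fin n) := (W s)⁻¹ • ∑ k : Fin n, (if (k : ℕ) < j then s.1 k else 0) • b k with hy
  set z : EuclideanSpace ℝ (Fin n) := (W s)⁻¹ • ∑ k : Fin n, (if j ≤ (k : ℕ) then s.1 k else 0) • b k with hz
  have hxyz : (W s)⁻¹ • ∑ k, s.1 k • b k = y + z := by
    rw [hy, hz, ← smul_add, ← Finset.sum_add_distrib]
    congr 1
    apply Finset.sum_congr rfl
    intro k _
    rw [← add_smul]
    congr 1
    by_cases hk : j ≤ (k : ℕ)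
    · simp [hk, not_lt.2 hk]
    · simp [hk, not_le.1 hk]
  have hys : y ∈ Submodule.span ℝ (Set.range Y) := by
    apply Submodule.smul_mem
    apply Submodule.sum_mem
    intro k _
    by_cases hk : (k : ℕ) < j
    · exact Submodule.smul_mem _ _ (hb1 k hk)
    · simp [hk]
  have hzo : ∀ i, inner ℝ (Y i) z = 0 := by
    intro i
    rw [hz, inner_smul_right, inner_sum, Finset.sum_eq_zero, mul_zero]
    intro k _
    by_cases hk : j ≤ (k : ℕ)
    · rw [inner_smul_right, hb2 k hk, mul_zero]
    · simp [hk]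
  have hzn : ‖z‖ ^ 2 = Ac j s / W s ^ 2 := by
    rw [hz, norm_smul, mul_pow, ← real_inner_self_eq_norm_sq (∑ k : Fin n, _ • b k),
      b.orthonormal.inner_sum]
    have : Ac j s = ∑ k : Fin n, (starRingEnd ℝ) (if j ≤ (k : ℕ) then s.1 k else 0) *
        (if j ≤ (k : ℕ) then s.1 k else 0) := by
      unfold Ac; apply Finset.sum_congr rfl; intro k _
      split_ifs <;> simp [pow_two]
    rw [← this]
    simp [div_eq_mul_inv, mul_comm]
  have hz0 : z ≠ 0 := by
    intro h0
    rw [h0] at hzn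
    have : 0 < Ac j s / W s ^ 2 := by positivity
    simp at hzn; simp [← hzn] at this
  have hin : inner ℝ (y + z) h = (W s)⁻¹ * (‖h‖ * s.1 0) := by
    have : ∀ v : EuclideanSpace ℝ (Fin n), inner ℝ v h = ‖h‖ * inner ℝ v (b 0) := by
      intro v
      nth_rewrite 1 [hb3]
      rw [inner_smul_right]
    rw [← hxyz, real_inner_smul_left, this, sum_inner]
    congr 2
    simp [real_inner_smul_left, orthonormal_iff_ite.1 b.orthonormal]
  have hq := gq_eq hY hs h1
  have hsq : √(gq Y) = ‖h‖ := by rw [hq, Real.sqrt_sq (norm_nonneg _)]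
  rw [hxyz, gdet_snoc hY hys hzo, gq_snoc hY hys hzo hz0 hs h1, stepF, hzn, hin]
  simp only [hsq]
  congr 2
  field_simp


/-- `μ` is represented as a rescaled Gaussian vector. -/
structure GRep (n : ℕ) (μ : Measure (EuclideanSpace ℝ (Fin n))) (lam : Measure ℝ)
    (W : Smp n → ℝ) : Prop where
  prob : IsProbabilityMeasure lam
  radial : ∃ W0 : ℝ × ℝ → ℝ, Measurable W0 ∧ ∀ s, W s = W0 (∑ k, s.1 k ^ 2, s.2)
  pos : ∀ᵐ s ∂kap n lam, 0 < W s
  eq : μ = (kap n lam).map fun s => (W s)⁻¹ • WithLp.toLp 2 s.1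

lemma GRep.meas {n : ℕ} {μ : Measure (EuclideanSpace ℝ (Fin n))} {lam : Measure ℝ}
    {W : Smp n → ℝ} (h : GRep n μ lam W) : Measurable W := by
  obtain ⟨W0, hW0, hW⟩ := h.radial
  have : W = fun s => W0 (∑ k, s.1 k ^ 2, s.2) := funext hW
  rw [this]
  fun_prop

lemma kap_map_vec {n : ℕ} (lam : Measure ℝ) [IsProbabilityMeasure lam]
    (b : OrthonormalBasis (Fin n) ℝ (EuclideanSpace ℝ (Fin n))) :
    (kap n lam).map (fun s => (∑ k, s.1 k • b k, s.2)) =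
      (ProbabilityTheory.stdGaussian (EuclideanSpace ℝ (Fin n))).prod lam := by
  rw [kap, stdGaussian_eq_map_pi_orthonormalBasis b]
  conv_rhs => rw [← Measure.map_id (μ := lam)]
  rw [Measure.map_prod_map _ _ (by fun_prop) measurable_id]
  rfl

lemma GRep.eq_basis {n : ℕ} {μ : Measure (EuclideanSpace ℝ (Fin n))} {lam : Measure ℝ}
    {W : Smp n → ℝ} (h : GRep n μ lam W)
    (b : OrthonormalBasis (Fin n) ℝ (EuclideanSpace ℝ (Fin n))) :
    μ = (kap n lam).map fun s => (W s)⁻¹ • ∑ k, s.1 k • b k := by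
  haveI := h.prob
  obtain ⟨W0, hW0, hW⟩ := h.radial
  have key : ∀ b : OrthonormalBasis (Fin n) ℝ (EuclideanSpace ℝ (Fin n)),
      ((kap n lam).map fun s => (W s)⁻¹ • ∑ k, s.1 k • b k) =
      ((ProbabilityTheory.stdGaussian (EuclideanSpace ℝ (Fin n))).prod lam).map
        (fun p => (W0 (‖p.1‖ ^ 2, p.2))⁻¹ • p.1) := by
    intro b
    rw [← kap_map_vec lam b, Measure.map_map (by fun_prop) (by fun_prop)]
    congr 1
    ext1 s
    simp only [Function.comp]
    rw [hW, ← real_inner_self_eq_norm_sq (∑ k : Fin n, _ • b k), b.orthonormal.inner_sum]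
    simp [pow_two]
  rw [key b, ← key (EuclideanSpace.basisFun (Fin n) ℝ), h.eq]
  congr 1
  ext1 s
  congr 1
  ext i
  simp [Pi.single_apply]

lemma Ac_pos {n : ℕ} (lam : Measure ℝ) [IsProbabilityMeasure lam] {j : ℕ} (hj : j < n) :
    ∀ᵐ s ∂kap n lam, 0 < Ac j s := by
  have h1 : MeasurePreserving (fun s : Smp n => s.1 ⟨j, hj⟩) (kap n lam) (gaussianReal 0 1) := by
    have := (measurePreserving_eval (fun _ : Fin n => gaussianReal 0 1) ⟨j, hj⟩).comp
      (measurePreserving_fst (μ := Measure.pi fun _ : Fin n => gaussianReal 0 1) (ν := lam))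
    exact this
  have h2 : ∀ᵐ x ∂gaussianReal 0 1, x ≠ 0 := by
    have := nullSingletonClass_gaussianReal (μ := 0) (v := 1) (by simp)
    exact ae_iff.2 (by simpa using measure_singleton (0 : ℝ))
  have h3 := h1.quasiMeasurePreserving.ae h2
  filter_upwards [h3] with s hs
  unfold Ac
  apply Finset.sum_pos' (fun k _ => by split_ifs <;> positivity)
  exact ⟨⟨j, hj⟩, Finset.mem_univ _, by simp; positivity⟩

lemma dq_pos {n : ℕ} [NeZero n] {μ : Measure (EuclideanSpace ℝ (Fin n))} {lam : Measure ℝ}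
    {W : Smp n → ℝ} (h : GRep n μ lam W) {j : ℕ} (hj : j ≤ n) :
    ∀ᵐ ω ∂(Measure.infinitePi fun _ : ℕ => kap n lam), 0 < (dq W j ω).1 := by
  haveI := h.prob
  induction j with
  | zero => exact ae_of_all _ fun ω => by simp [dq]
  | succ j ih =>
    have h1 := (measurePreserving_eval_infinitePi (fun _ : ℕ => kap n lam) j).quasiMeasurePreserving.ae
      ((Ac_pos lam (show j < n by omega)).and h.pos)
    filter_upwards [ih (by omega), h1] with ω h2 h3
    simp only [dq, stepF]
    have := h3.1
    have := h3.2
    positivity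

lemma law_eq {n : ℕ} [NeZero n] {μ : Measure (EuclideanSpace ℝ (Fin n))} {lam : Measure ℝ}
    {W : Smp n → ℝ} (h : GRep n μ lam W) {j : ℕ} (hj : j ≤ n) :
    ((Measure.pi fun _ : Fin j => μ).map fun Y => (gdet Y, gq Y)) =
      (Measure.infinitePi fun _ : ℕ => kap n lam).map (dq W j) := by
  haveI := h.prob
  have hμp : IsProbabilityMeasure μ := by
    rw [h.eq]
    apply Measure.isProbabilityMeasure_map
    have := h.meas
    fun_prop
  induction j with
  | zero =>
    have h1 : (fun Y : Fin 0 → EuclideanSpace ℝ (Fin n) => (gdet Y, gq Y)) = fun _ => (1, 0) := by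
      ext Y <;> simp [gdet, gq]
    have h2 : dq W 0 = fun _ => (1, 0) := by ext ω <;> simp [dq]
    rw [h1, h2, Measure.map_const, Measure.map_const]
    simp
  | succ j ih =>
    have ih := ih (by omega)
    have hme := (dq_past h.meas j).1
    have hmg : ∀ i, Measurable (fun Y : Fin i → EuclideanSpace ℝ (Fin n) => (gdet Y, gq Y)) :=
      fun i => measurable_gdet.prodMk measurable_gq
    have hli : ∀ᵐ Y ∂(Measure.pi fun _ : Fin j => μ), LinearIndependent ℝ Y := by
      have h1 : ∀ᵐ p ∂((Measure.pi fun _ : Fin j => μ).map fun Y => (gdet Y, gq Y)), 0 < p.1 := by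
        rw [ih]
        rw [ae_map_iff hme.aemeasurable (measurableSet_lt measurable_const measurable_fst)]
        exact dq_pos h (by omega)
      have h2 := ae_of_ae_map (hmg j).aemeasurable h1
      filter_upwards [h2] with Y hY
      exact gdet_ne_zero_iff.1 hY.ne'
    apply Measure.ext_of_lintegral
    intro F hF
    rw [lintegral_map hF (hmg _), lintegral_map hF (dq_past h.meas (j + 1)).1]
    have hR : ∫⁻ ω, F (dq W (j + 1) ω) ∂(Measure.infinitePi fun _ : ℕ => kap n lam) =
        ∫⁻ Y, ∫⁻ s, F (stepF W j ((gdet Y, gq Y), s)) ∂(kap n lam) ∂(Measure.pi fun _ : Fin j => μ) := by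
      have hFs : Measurable fun p => F (stepF W j p) := hF.comp (measurable_stepF h.meas j)
      have e1 : ∫⁻ ω, F (dq W (j + 1) ω) ∂(Measure.infinitePi fun _ : ℕ => kap n lam) =
         ∫⁻ p, F (stepF W j p) ∂((Measure.infinitePi fun _ : ℕ => kap n lam).map
           (fun ω => (dq W j ω, ω j))) := by
        rw [lintegral_map hFs (by fun_prop)]; rfl
      rw [e1, (dq_past h.meas j).map_prod, ← ih, lintegral_prod _ hFs.aemeasurable,
        lintegral_map _ (hmg j)]
      exact hFs.lintegral_prod_right'
    rw [hR]
    have hL := (measurePreserving_piFinSuccAbove (fun _ : Fin (j + 1) => μ) (Fin.last j)).symm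
    have e3 : ∫⁻ a, F (gdet a, gq a) ∂(Measure.pi fun _ : Fin (j + 1) => μ) =
        ∫⁻ a, (F ∘ fun Y => (gdet Y, gq Y)) a ∂(Measure.pi fun _ : Fin (j + 1) => μ) := rfl
    rw [e3, ← hL.lintegral_comp (hF.comp (hmg _))]
    have hmm := (hF.comp (hmg (j + 1))).comp (MeasurableEquiv.measurable (MeasurableEquiv.piFinSuccAbove
        (fun _ : Fin (j + 1) => EuclideanSpace ℝ (Fin n)) (Fin.last j)).symm)
    refine (lintegral_prod_symm _ hmm.aemeasurable).trans ?_
    apply lintegral_congr_ae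
    filter_upwards [hli] with Y hY
    obtain ⟨v, hs, h1⟩ := exists_dual hY
    obtain ⟨b, hb1, hb2, hb3⟩ := exists_adapted (show j ≤ n by omega) hY hs h1
    have hW := h.meas
    have e2 : ∀ x : EuclideanSpace ℝ (Fin n), (MeasurableEquiv.piFinSuccAbove
        (fun _ : Fin (j + 1) => EuclideanSpace ℝ (Fin n)) (Fin.last j)).symm (x, Y) =
        Fin.snoc (α := fun _ => EuclideanSpace ℝ (Fin n)) Y x := by
      intro x
      simp [MeasurableEquiv.piFinSuccAbove_symm_apply, Fin.insertNthEquiv]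
    have hsn : Measurable fun x : EuclideanSpace ℝ (Fin n) =>
        Fin.snoc (α := fun _ => EuclideanSpace ℝ (Fin n)) Y x := by
      simp_rw [← e2]
      exact (MeasurableEquiv.measurable _).comp (by fun_prop)
    simp only [Function.comp]
    simp_rw [e2]
    conv_lhs => rw [h.eq_basis b]
    refine (lintegral_map (hF.comp ((hmg _).comp hsn)) (by fun_prop)).trans ?_
    apply lintegral_congr_ae
    filter_upwards [h.pos, Ac_pos lam (show j < n by omega)] with s hs1 hs2
    simp only [Function.comp]
    rw [← step_pointwise hY hs h1 b hb1 hb2 hb3 W s hs1 hs2]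

lemma law_simplexVol {n r : ℕ} [NeZero n] {μ : Measure (EuclideanSpace ℝ (Fin n))} {lam : Measure ℝ}
    {W : Smp n → ℝ} (h : GRep n μ lam W) (hr : r + 1 ≤ n) (F : ℝ → ℝ) (hF : Continuous F) :
    ∫ X, F (simplexVol n r X) ∂(Measure.pi fun _ : Fin (r + 1) => μ) =
      ∫ ω, F (refVol r * √((dq W (r + 1) ω).1 * (dq W (r + 1) ω).2))
        ∂(Measure.infinitePi fun _ : ℕ => kap n lam) := by
  haveI := h.prob
  have hmg : ∀ i, Measurable (fun Y : Fin i → EuclideanSpace ℝ (Fin n) => (gdet Y, gq Y)) :=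
      fun i => measurable_gdet.prodMk measurable_gq
  have hme := (dq_past h.meas (r + 1)).1
  have hlaw := law_eq h hr
  have hG : Measurable fun p : ℝ × ℝ => F (refVol r * √(p.1 * p.2)) := by
    have := hF.measurable
    fun_prop
  have e1 : ∫ ω, F (refVol r * √((dq W (r + 1) ω).1 * (dq W (r + 1) ω).2))
        ∂(Measure.infinitePi fun _ : ℕ => kap n lam) = ∫ p, F (refVol r * √(p.1 * p.2))
        ∂((Measure.infinitePi fun _ : ℕ => kap n lam).map (dq W (r + 1))) := by
    rw [integral_map hme.aemeasurable hG.aestronglyMeasurable]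
  rw [e1, ← hlaw, integral_map (hmg _).aemeasurable hG.aestronglyMeasurable]
  apply integral_congr_ae
  have h1 : ∀ᵐ p ∂((Measure.pi fun _ : Fin (r + 1) => μ).map fun Y => (gdet Y, gq Y)), 0 < p.1 := by
    rw [hlaw]
    rw [ae_map_iff hme.aemeasurable (measurableSet_lt measurable_const measurable_fst)]
    exact dq_pos h hr
  have h2 := ae_of_ae_map (hmg _).aemeasurable h1
  filter_upwards [h2] with Y hY
  rw [simplexVol_eq' _ _ _ (gdet_ne_zero_iff.1 hY.ne')]

end

section
open MeasureTheory ProbabilityTheory Real Filter Finset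
set_option linter.all false

section LL
variable {Ω Ω' : Type*} [MeasurableSpace Ω] [MeasurableSpace Ω']

/-- first moment bound -/
def L1 (P : Measure Ω) (X : Ω → ℝ) (c : ℝ) : Prop := Integrable X P ∧ ∫ ω, |X ω| ∂P ≤ c

/-- second moment bound -/
def L2 (P : Measure Ω) (X : Ω → ℝ) (c : ℝ) : Prop := MemLp X 2 P ∧ ∫ ω, X ω ^ 2 ∂P ≤ c

variable {P : Measure Ω} {X Y : Ω → ℝ} {a b c : ℝ}

lemma L1.mono (h : L1 P X a) (hab : a ≤ b) : L1 P X b := ⟨h.1, h.2.trans hab⟩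
lemma L2.mono (h : L2 P X a) (hab : a ≤ b) : L2 P X b := ⟨h.1, h.2.trans hab⟩
lemma L1.nonneg (h : L1 P X a) : 0 ≤ a := (integral_nonneg fun _ => abs_nonneg _).trans h.2
lemma L2.nonneg (h : L2 P X a) : 0 ≤ a := (integral_nonneg fun _ => sq_nonneg _).trans h.2

lemma L1.add (h : L1 P X a) (h' : L1 P Y b) : L1 P (fun ω => X ω + Y ω) (a + b) := by
  refine ⟨h.1.add h'.1, ?_⟩
  calc ∫ ω, |X ω + Y ω| ∂P ≤ ∫ ω, (|X ω| + |Y ω|) ∂P :=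
        integral_mono (h.1.add h'.1).abs (h.1.abs.add h'.1.abs) (fun ω => abs_add_le _ _)
    _ = _ := integral_add h.1.abs h'.1.abs
    _ ≤ _ := add_le_add h.2 h'.2

lemma L1.neg (h : L1 P X a) : L1 P (fun ω => - X ω) a := by
  refine ⟨h.1.neg, ?_⟩; simpa using h.2

lemma L1.sub (h : L1 P X a) (h' : L1 P Y b) : L1 P (fun ω => X ω - Y ω) (a + b) := by
  simpa [sub_eq_add_neg] using h.add h'.neg

lemma L1.const_mul (k : ℝ) (h : L1 P X a) : L1 P (fun ω => k * X ω) (|k| * a) := by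
  refine ⟨h.1.const_mul k, ?_⟩
  simp only [abs_mul, integral_const_mul]
  exact mul_le_mul_of_nonneg_left h.2 (abs_nonneg k)

lemma L1.zero : L1 P (fun _ => 0) 0 := by simp [L1]

lemma L1.sum {ι : Type*} {s : Finset ι} {X : ι → Ω → ℝ} {a : ι → ℝ} (h : ∀ i ∈ s, L1 P (X i) (a i)) :
    L1 P (fun ω => ∑ i ∈ s, X i ω) (∑ i ∈ s, a i) := by
  classical
  induction s using Finset.induction_on with
  | empty => simpa using L1.zero
  | insert i s hi ih =>
    simp only [Finset.sum_insert hi]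
    exact (h i (by simp)).add (ih fun j hj => h j (by simp [hj]))

lemma L1.of_le (h : L1 P Y a) (hX : AEStronglyMeasurable X P) (hle : ∀ᵐ ω ∂P, |X ω| ≤ |Y ω|) : L1 P X a := by
  have hi : Integrable X P := Integrable.mono h.1 hX (by simpa using hle)
  exact ⟨hi, (integral_mono_ae hi.abs h.1.abs hle).trans h.2⟩

lemma L2.of_le (h : L2 P Y a) (hX : AEStronglyMeasurable X P) (hle : ∀ᵐ ω ∂P, |X ω| ≤ |Y ω|) : L2 P X a := by
  have hi : MemLp X 2 P := MemLp.mono h.1 hX (by simpa using hle)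
  refine ⟨hi, (integral_mono_ae hi.integrable_sq h.1.integrable_sq ?_).trans h.2⟩
  filter_upwards [hle] with ω hω
  exact sq_le_sq.2 hω

lemma L1.congr (h : L1 P X a) (hle : X =ᵐ[P] Y) : L1 P Y a := by
  refine ⟨h.1.congr hle, ?_⟩
  refine le_trans (le_of_eq (integral_congr_ae ?_)) h.2
  filter_upwards [hle] with ω hω; rw [hω]

lemma L2.congr (h : L2 P X a) (hle : X =ᵐ[P] Y) : L2 P Y a := by
  refine ⟨h.1.ae_eq hle, ?_⟩
  refine le_trans (le_of_eq (integral_congr_ae ?_)) h.2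
  filter_upwards [hle] with ω hω; rw [hω]

lemma L2.const_mul (k : ℝ) (h : L2 P X a) : L2 P (fun ω => k * X ω) (k ^ 2 * a) := by
  refine ⟨h.1.const_mul k, ?_⟩
  simp only [mul_pow, integral_const_mul]
  exact mul_le_mul_of_nonneg_left h.2 (sq_nonneg k)

lemma L2.add (h : L2 P X a) (h' : L2 P Y b) : L2 P (fun ω => X ω + Y ω) (2 * (a + b)) := by
  refine ⟨h.1.add h'.1, ?_⟩
  have e1 := h.1.integrable_sq
  have e2 := h'.1.integrable_sq
  calc ∫ ω, (X ω + Y ω) ^ 2 ∂P ≤ ∫ ω, 2 * (X ω ^ 2 + Y ω ^ 2) ∂P :=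
        integral_mono (h.1.add h'.1).integrable_sq ((e1.add e2).const_mul 2)
          (fun ω => by show (X ω + Y ω) ^ 2 ≤ 2 * (X ω ^ 2 + Y ω ^ 2); nlinarith [sq_nonneg (X ω - Y ω)])
    _ = 2 * (∫ ω, X ω ^ 2 ∂P + ∫ ω, Y ω ^ 2 ∂P) := by rw [integral_const_mul, integral_add e1 e2]
    _ ≤ _ := by linarith [h.2, h'.2]

lemma L2.neg (h : L2 P X a) : L2 P (fun ω => - X ω) a := by
  refine ⟨h.1.neg, ?_⟩; simpa using h.2

lemma L2.sub (h : L2 P X a) (h' : L2 P Y b) : L2 P (fun ω => X ω - Y ω) (2 * (a + b)) := by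
  simpa [sub_eq_add_neg] using h.add h'.neg

lemma L2.mul (h : L2 P X a) (h' : L2 P Y b) : L1 P (fun ω => X ω * Y ω) (√(a * b)) := by
  have hi : Integrable (fun ω => X ω * Y ω) P := h.1.integrable_mul h'.1
  refine ⟨hi, ?_⟩
  have e1 := h.1.integrable_sq
  have e2 := h'.1.integrable_sq
  have ha := h.nonneg
  have hb := h'.nonneg
  have key : ∀ t : ℝ, 0 < t → 2 * ∫ ω, |X ω * Y ω| ∂P ≤ t * a + t⁻¹ * b := by
    intro t ht
    calc 2 * ∫ ω, |X ω * Y ω| ∂P = ∫ ω, 2 * |X ω * Y ω| ∂P := by rw [integral_const_mul]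
      _ ≤ ∫ ω, (t * X ω ^ 2 + t⁻¹ * Y ω ^ 2) ∂P := by
          refine integral_mono (hi.abs.const_mul 2) ((e1.const_mul t).add (e2.const_mul t⁻¹)) fun ω => ?_
          show 2 * |X ω * Y ω| ≤ t * X ω ^ 2 + t⁻¹ * Y ω ^ 2
          rw [abs_mul]
          have h2 : t * X ω ^ 2 + t⁻¹ * Y ω ^ 2 - 2 * (|X ω| * |Y ω|) = t⁻¹ * (t * |X ω| - |Y ω|) ^ 2 := by
            rw [← sq_abs (X ω), ← sq_abs (Y ω)]; field_simp; ring
          have h3 : 0 ≤ t⁻¹ * (t * |X ω| - |Y ω|) ^ 2 := by positivity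
          linarith
      _ = t * ∫ ω, X ω ^ 2 ∂P + t⁻¹ * ∫ ω, Y ω ^ 2 ∂P := by
          rw [integral_add (e1.const_mul t) (e2.const_mul t⁻¹), integral_const_mul, integral_const_mul]
      _ ≤ _ := by gcongr; exacts [h.2, h'.2]
  set I := ∫ ω, |X ω * Y ω| ∂P
  have hI : 0 ≤ I := integral_nonneg fun _ => abs_nonneg _
  apply Real.le_sqrt_of_sq_le
  by_contra! hlt
  -- a b < I^2
  have hIpos : 0 < I := by
    rcases hI.lt_or_eq with h | h
    · exact h
    · rw [← h] at hlt; nlinarith [mul_nonneg ha hb]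
  rcases ha.lt_or_eq with ha' | ha'
  · have := key (I / a) (by positivity)
    rw [div_mul_cancel₀ _ ha'.ne', inv_div, div_mul_eq_mul_div] at this
    have h5 : a * b / I < I := by rw [div_lt_iff₀ hIpos]; nlinarith
    linarith
  · have := key ((b + 1) / I) (by positivity)
    rw [← ha', mul_zero, zero_add, inv_div, div_mul_eq_mul_div] at this
    have h5 : I * b / (b + 1) ≤ I := by rw [div_le_iff₀ (by positivity)]; nlinarith
    linarith

lemma L1.const [IsProbabilityMeasure P] (k : ℝ) : L1 P (fun _ => k) |k| := by
  refine ⟨integrable_const k, by simp⟩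
lemma L2.const [IsProbabilityMeasure P] (k : ℝ) : L2 P (fun _ => k) (k ^ 2) := by
  refine ⟨memLp_const k, by simp⟩

lemma L2.l1 [IsProbabilityMeasure P] (h : L2 P X a) : L1 P X (√a) := by
  simpa using h.mul (L2.const (P := P) 1)

lemma L1.abs (h : L1 P X a) : L1 P (fun ω => |X ω|) a := by
  refine ⟨h.1.abs, by simpa using h.2⟩

lemma L1.map {P : Measure Ω'} {φ : Ω' → Ω} (hφ : AEMeasurable φ P) (h : L1 (P.map φ) X a) :
    L1 P (fun ω => X (φ ω)) a := by
  refine ⟨h.1.comp_aemeasurable hφ, ?_⟩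
  rw [← integral_map hφ h.1.abs.aestronglyMeasurable]
  exact h.2

lemma L2.map {P : Measure Ω'} {φ : Ω' → Ω} (hφ : AEMeasurable φ P) (h : L2 (P.map φ) X a) :
    L2 P (fun ω => X (φ ω)) a := by
  refine ⟨h.1.comp_of_map hφ, ?_⟩
  rw [← integral_map (f := fun x => X x ^ 2) hφ h.1.integrable_sq.aestronglyMeasurable]
  exact h.2

lemma L1.indep_mul (h : L1 P X a) (h' : L1 P Y b) (hi : IndepFun X Y P) :
    L1 P (fun ω => X ω * Y ω) (a * b) := by
  refine ⟨hi.integrable_mul h.1 h'.1, ?_⟩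
  simp only [abs_mul]
  have : IndepFun (fun ω => |X ω|) (fun ω => |Y ω|) P := hi.comp (φ := fun x : ℝ => |x|) (ψ := fun x : ℝ => |x|) (by fun_prop) (by fun_prop)
  rw [this.integral_fun_mul_eq_mul_integral h.1.abs.aestronglyMeasurable h'.1.abs.aestronglyMeasurable]
  exact mul_le_mul h.2 h'.2 (integral_nonneg fun _ => abs_nonneg _) h.nonneg

lemma L2.of_sq (hX : AEStronglyMeasurable X P) (h : L1 P (fun ω => X ω ^ 2) a) : L2 P X a := by
  refine ⟨(memLp_two_iff_integrable_sq hX).2 h.1, ?_⟩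
  have := h.2
  simpa using this

lemma L2.sq (h : L2 P X a) : L1 P (fun ω => X ω ^ 2) a := by
  refine ⟨h.1.integrable_sq, ?_⟩
  simpa using h.2

lemma L2.indep_mul (h : L2 P X a) (h' : L2 P Y b) (hi : IndepFun X Y P) :
    L2 P (fun ω => X ω * Y ω) (a * b) := by
  apply L2.of_sq (h.1.1.mul h'.1.1)
  have : (fun ω => (X * Y) ω ^ 2) = fun ω => X ω ^ 2 * Y ω ^ 2 := by
    ext ω; simp [mul_pow]
  rw [this]
  exact h.sq.indep_mul h'.sq (hi.comp (φ := fun x : ℝ => x^2) (ψ := fun x : ℝ => x^2) (by fun_prop) (by fun_prop))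

lemma L1.markov (h : L1 P X a) {ε : ℝ} (hε : 0 < ε) : P.real {ω | ε ≤ |X ω|} ≤ a / ε := by
  have := mul_meas_ge_le_integral_of_nonneg (μ := P) (f := fun ω => |X ω|) (ae_of_all _ fun _ => abs_nonneg _) h.1.abs ε
  rw [le_div_iff₀ hε]
  linarith [h.2]

lemma L2.center [IsProbabilityMeasure P] (h : L2 P X a) : L2 P (fun ω => X ω - ∫ ω, X ω ∂P) a := by
  refine ⟨h.1.sub (memLp_const _), ?_⟩
  have h1 := variance_eq_sub h.1
  rw [variance_eq_integral h.1.1.aemeasurable] at h1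
  rw [h1]
  have := h.2
  simp only [Pi.pow_apply]
  nlinarith [sq_nonneg (∫ ω, X ω ∂P)]

/-- sum of independent centered variables -/
lemma L2.indep_sum [IsProbabilityMeasure P] {ι : Type*} {s : Finset ι} {X : ι → Ω → ℝ} {v : ι → ℝ}
    (h : ∀ i ∈ s, L2 P (X i) (v i)) (h0 : ∀ i ∈ s, ∫ ω, X i ω ∂P = 0)
    (hi : Set.Pairwise (s : Set ι) fun i j => IndepFun (X i) (X j) P) :
    L2 P (fun ω => ∑ i ∈ s, X i ω) (∑ i ∈ s, v i) := by
  have hm : MemLp (fun ω => ∑ i ∈ s, X i ω) 2 P := memLp_finset_sum s fun i hi => (h i hi).1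
  refine ⟨hm, ?_⟩
  have hz : ∫ ω, ∑ i ∈ s, X i ω ∂P = 0 := by
    rw [integral_finset_sum s fun i hi => (h i hi).1.integrable one_le_two]
    exact Finset.sum_eq_zero h0
  have e : Var[fun ω => ∑ i ∈ s, X i ω; P] = ∫ ω, (∑ i ∈ s, X i ω) ^ 2 ∂P :=
    variance_of_integral_eq_zero hm.1.aemeasurable hz
  have e2 := IndepFun.variance_sum (fun i hi => (h i hi).1) hi
  have e3 : (∑ i ∈ s, X i) = fun ω => ∑ i ∈ s, X i ω := by ext; simp
  rw [e3] at e2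
  rw [← e, e2]
  apply Finset.sum_le_sum
  intro i hi
  rw [variance_of_integral_eq_zero (h i hi).1.1.aemeasurable (h0 i hi)]
  exact (h i hi).2

end LL

end

section
open MeasureTheory ProbabilityTheory Real Filter Finset
set_option linter.all false

lemma g_int (f : ℝ → ℝ) : ∫ x, f x ∂gaussianReal 0 1 = (√(2 * π))⁻¹ * ∫ x, f x * rexp (- (1/2) * x ^ 2) := by
  rw [integral_gaussianReal_eq_integral_smul one_ne_zero, ← integral_const_mul]
  congr 1; ext x
  simp [gaussianPDFReal_def]
  ring_nf

lemma g_two : ∫ x, x ^ 2 ∂gaussianReal 0 1 = 1 := by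
  have h := variance_fun_id_gaussianReal (μ := 0) (v := 1)
  rw [variance_of_integral_eq_zero (by fun_prop) (by simp [integral_id_gaussianReal])] at h
  simpa using h

lemma g_four : ∫ x, x ^ 4 ∂gaussianReal 0 1 = 3 := by
  rw [g_int]
  have h1 : ∫ x : ℝ, x ^ 4 * rexp (-(1/2) * x ^ 2) = 2 * ∫ x in Set.Ioi (0:ℝ), x ^ 4 * rexp (-(1/2) * x ^ 2) := by
    rw [← integral_comp_abs (f := fun x => x ^ 4 * rexp (-(1/2) * x ^ 2))]
    congr 1; ext x
    simp [show |x| ^ 4 = x ^ 4 from by rw [show 4 = 2 * 2 from rfl, pow_mul, pow_mul, sq_abs]]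
  have h2 := integral_rpow_mul_exp_neg_mul_rpow (p := 2) (q := 4) (b := 1/2) (by norm_num) (by norm_num) (by norm_num)
  have h3 : ∫ x in Set.Ioi (0:ℝ), x ^ 4 * rexp (-(1/2) * x ^ 2) = ∫ x in Set.Ioi (0:ℝ), x ^ (4:ℝ) * rexp (-(1/2) * x ^ (2:ℝ)) := by
    congr 1; ext x; norm_cast
  rw [h1, h3, h2]
  have h4 : Real.Gamma ((4 + 1) / 2) = 3 / 4 * √π := by
    rw [show ((4:ℝ) + 1) / 2 = (1/2 + 1) + 1 by norm_num, Real.Gamma_add_one (by norm_num), Real.Gamma_add_one (by norm_num), Real.Gamma_one_half_eq]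
    ring
  rw [h4, show (-(4 + 1) / 2 : ℝ) = -(1/2) - 2 by norm_num, Real.rpow_sub (by norm_num), Real.rpow_neg (by norm_num), ← Real.sqrt_eq_rpow]
  have e5 : ((1:ℝ)/2) ^ (2:ℝ) = 1/4 := by norm_num
  rw [e5, Real.sqrt_mul (by norm_num), show (1/2 : ℝ) = 2⁻¹ by norm_num, Real.sqrt_inv]
  have : 0 < √π := Real.sqrt_pos.2 Real.pi_pos
  have h2 : √2 ^ 2 = (2:ℝ) := Real.sq_sqrt (by norm_num)
  have : 0 < √(2:ℝ) := by positivity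
  field_simp

lemma g_sq_memLp : MemLp (fun x : ℝ => x ^ 2 - 1) 2 (gaussianReal 0 1) := by
  refine MemLp.sub ?_ (memLp_const _)
  have h4 : MemLp (fun x : ℝ => x) 4 (gaussianReal 0 1) := by
    exact memLp_id_gaussianReal' 4 (by norm_num)
  rw [memLp_two_iff_integrable_sq (by fun_prop)]
  have := h4.integrable_norm_pow (by norm_num)
  refine this.congr (ae_of_all _ fun x => ?_)
  simp only [Real.norm_eq_abs, ENNReal.toReal_ofNat]
  rw [show (x ^ 2) ^ 2 = (x^2)^2 from rfl, ← sq_abs x]; ring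

lemma g_memLp : MemLp (fun x : ℝ => x) 2 (gaussianReal 0 1) := memLp_id_gaussianReal' 2 (by norm_num)

lemma g_sq_mean : ∫ x, (x ^ 2 - 1) ∂gaussianReal 0 1 = 0 := by
  have := g_memLp.integrable_sq
  rw [integral_sub this (integrable_const _), g_two]; simp

lemma g_four_int : Integrable (fun x : ℝ => x ^ 4) (gaussianReal 0 1) := by
  have h := g_sq_memLp.add (memLp_const (1:ℝ))
  have := h.integrable_sq
  refine this.congr (ae_of_all _ fun x => ?_)
  simp; ring

lemma g_sq_var : ∫ x, (x ^ 2 - 1) ^ 2 ∂gaussianReal 0 1 = 2 := by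
  have e : ∀ x : ℝ, (x ^ 2 - 1) ^ 2 = x ^ 4 - (2 * x ^ 2 - 1) := fun x => by ring
  simp only [e]
  have i2 := g_memLp.integrable_sq
  have i3 : Integrable (fun x : ℝ => 2 * x ^ 2 - 1) (gaussianReal 0 1) := (i2.const_mul 2).sub (integrable_const _)
  rw [integral_sub g_four_int i3,
    integral_sub (i2.const_mul 2) (integrable_const _), integral_const_mul, g_two, g_four]
  simp; norm_num

lemma g_laplace {t : ℝ} (ht : 0 ≤ t) : ∫ x, rexp (-(t * x ^ 2)) ∂gaussianReal 0 1 = (1 + 2 * t) ^ (-(1/2) : ℝ) := by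
  rw [g_int]
  have : ∀ x : ℝ, rexp (-(t * x ^ 2)) * rexp (-(1/2) * x ^ 2) = rexp (-(t + 1/2) * x ^ 2) := by
    intro x; rw [← Real.exp_add]; congr 1; ring
  simp only [this]
  rw [integral_gaussian, Real.rpow_neg (by positivity), ← Real.sqrt_eq_rpow, ← Real.sqrt_inv, ← Real.sqrt_inv, ← Real.sqrt_mul (by positivity)]
  congr 1
  have := Real.pi_pos
  field_simp
  ring

/-- gaussian measure on `Fin n → ℝ` -/
noncomputable abbrev Gm (n : ℕ) : Measure (Fin n → ℝ) := Measure.pi fun _ : Fin n => gaussianReal 0 1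

/-- tail sum of squares -/
noncomputable def gA {n : ℕ} (j : ℕ) (g : Fin n → ℝ) : ℝ := ∑ k : Fin n, if j ≤ (k : ℕ) then g k ^ 2 else 0

lemma Ac_eq {n : ℕ} (j : ℕ) (s : Smp n) : Ac j s = gA j s.1 := rfl

@[fun_prop]
lemma measurable_gA {n : ℕ} (j : ℕ) : Measurable (gA (n := n) j) := by
  unfold gA
  apply Finset.measurable_sum; intro k _
  split_ifs <;> fun_prop

lemma card_tail {n j : ℕ} : (Finset.univ.filter fun k : Fin n => j ≤ (k:ℕ)).card = n - j := by
  have := Fin.card_filter_val_lt (n := n) (m := j) 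
  have h := Finset.card_filter_add_card_filter_not (s := (Finset.univ : Finset (Fin n))) (fun k : Fin n => (k:ℕ) < j)
  simp only [not_lt, Finset.card_univ, Fintype.card_fin] at h
  omega

lemma gA_nonneg {n j : ℕ} (g : Fin n → ℝ) : 0 ≤ gA j g := by
  unfold gA; apply Finset.sum_nonneg; intro k _; split_ifs <;> positivity

lemma gA_laplace {n j : ℕ} {t : ℝ} (ht : 0 ≤ t) :
    ∫ g, rexp (-(t * gA j g)) ∂Gm n = (1 + 2 * t) ^ (-(((n - j : ℕ) : ℝ)/2) : ℝ) := by
  have : ∀ g : Fin n → ℝ, rexp (-(t * gA j g)) = ∏ k : Fin n, (fun x : ℝ => if j ≤ (k:ℕ) then rexp (-(t * x ^ 2)) else 1) (g k) := by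
    intro g
    unfold gA
    rw [Finset.mul_sum, ← Finset.sum_neg_distrib, Real.exp_sum]
    apply Finset.prod_congr rfl; intro k _
    split_ifs <;> simp
  simp only [this]
  rw [Gm, integral_fintype_prod_eq_prod (f := fun (k : Fin n) x => if j ≤ (k:ℕ) then rexp (-(t * x ^ 2)) else 1)]
  have : ∀ k : Fin n, ∫ x, (if j ≤ (k:ℕ) then rexp (-(t * x ^ 2)) else 1) ∂gaussianReal 0 1 = if j ≤ (k:ℕ) then (1 + 2 * t) ^ (-(1/2) : ℝ) else 1 := by
    intro k; split_ifs
    · exact g_laplace ht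
    · simp
  simp only [this]
  rw [Finset.prod_ite, Finset.prod_const, Finset.prod_const_one, mul_one, card_tail, ← Real.rpow_natCast, ← Real.rpow_mul (by positivity)]
  congr 1; ring

lemma J_int {k : ℝ} (hk : 1 < k) : IntegrableOn (fun t : ℝ => (1 + 2 * t) ^ (-k)) (Set.Ioi 0) ∧
    ∫ t in Set.Ioi (0:ℝ), (1 + 2 * t) ^ (-k) = 1 / (2 * (k - 1)) := by
  have hd : ∀ t ∈ Set.Ici (0:ℝ), HasDerivAt (fun t : ℝ => -(1 / (2 * (k - 1))) * (1 + 2 * t) ^ (1 - k)) ((1 + 2 * t) ^ (-k)) t := by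
    intro t ht
    have ht : (0:ℝ) ≤ t := ht
    have h1 : HasDerivAt (fun t : ℝ => 1 + 2 * t) 2 t := by
      simpa using ((hasDerivAt_id t).const_mul 2).const_add 1
    have h2 := (h1.rpow_const (p := 1 - k) (Or.inl (by positivity))).const_mul (-(1 / (2 * (k - 1))))
    refine h2.congr_deriv ?_
    rw [show 1 - k - 1 = -k by ring]
    have : k - 1 ≠ 0 := by linarith
    field_simp
    ring
  have hlim : Tendsto (fun t : ℝ => -(1 / (2 * (k - 1))) * (1 + 2 * t) ^ (1 - k)) atTop (nhds 0) := by
    have h3 : Tendsto (fun t : ℝ => (1 + 2 * t)) atTop atTop :=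
      tendsto_atTop_add_const_left _ _ (tendsto_id.const_mul_atTop (by norm_num))
    have h4 := (tendsto_rpow_neg_atTop (y := k - 1) (by linarith)).comp h3
    have h5 := h4.const_mul (-(1 / (2 * (k - 1))))
    simpa [Function.comp_def] using h5
  refine ⟨integrableOn_Ioi_deriv_of_nonneg' hd (fun t ht => ?_) hlim, ?_⟩
  · have ht : (0:ℝ) < t := ht
    positivity
  · rw [integral_Ioi_of_hasDerivAt_of_nonneg' hd (fun t ht => ?_) hlim]
    · simp
    · have ht : (0:ℝ) < t := ht
      positivity

lemma J_int2 {k : ℝ} (hk : 2 < k) : IntegrableOn (fun t : ℝ => t * (1 + 2 * t) ^ (-k)) (Set.Ioi 0) ∧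
    ∫ t in Set.Ioi (0:ℝ), t * (1 + 2 * t) ^ (-k) = 1 / (4 * (k - 1) * (k - 2)) := by
  have e : ∀ t ∈ Set.Ioi (0:ℝ), t * (1 + 2 * t) ^ (-k) = (1/2) * ((1 + 2 * t) ^ (-(k-1)) - (1 + 2 * t) ^ (-k)) := by
    intro t ht
    have ht : (0:ℝ) < t := ht
    rw [show -(k - 1) = -k + 1 by ring, Real.rpow_add_one (by positivity)]
    ring
  obtain ⟨a1, a2⟩ := J_int (k := k) (by linarith)
  obtain ⟨b1, b2⟩ := J_int (k := k - 1) (by linarith)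
  refine ⟨IntegrableOn.congr_fun ((b1.sub a1).const_mul (1/2)) (fun t ht => (e t ht).symm) measurableSet_Ioi, ?_⟩
  rw [setIntegral_congr_fun measurableSet_Ioi e, integral_const_mul, integral_sub b1 a1, a2, b2]
  have : k - 1 ≠ 0 := by linarith
  have : k - 2 ≠ 0 := by linarith
  have : k - 1 - 1 ≠ 0 := by linarith
  field_simp
  ring

lemma int_of_lint {Ω : Type*} [MeasurableSpace Ω] {P : Measure Ω} {Y : Ω → ℝ} {c : ℝ} (hY : Measurable Y) (h0 : ∀ ω, 0 ≤ Y ω)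
    (hc : 0 ≤ c) (h : ∫⁻ ω, ENNReal.ofReal (Y ω) ∂P = ENNReal.ofReal c) : Integrable Y P ∧ ∫ ω, Y ω ∂P = c := by
  have hi : Integrable Y P := by
    refine ⟨hY.aestronglyMeasurable, ?_⟩
    rw [hasFiniteIntegral_iff_ofReal (ae_of_all _ h0), h]; exact ENNReal.ofReal_lt_top
  refine ⟨hi, ?_⟩
  rw [integral_eq_lintegral_of_nonneg_ae (ae_of_all _ h0) hY.aestronglyMeasurable, h, ENNReal.toReal_ofReal hc]

lemma gA_pos {n j : ℕ} (hj : j < n) : ∀ᵐ g ∂Gm n, 0 < gA j g := by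
  have h := Ac_pos (n := n) (j := j) (Measure.dirac 0) hj
  have hm : (kap n (Measure.dirac 0)).map Prod.fst = Gm n := by
    unfold kap; simp
  rw [← hm, ae_map_iff (by fun_prop) (measurableSet_lt measurable_const (measurable_gA j))]
  exact h

/-- general Laplace-type identity -/
lemma gA_lap_gen {n j : ℕ} (w : ℝ → ℝ) (hw : Measurable w) (hw0 : ∀ t ∈ Set.Ioi (0:ℝ), 0 ≤ w t) (Y : ℝ → ℝ)
    (hY : ∀ A : ℝ, 0 < A → IntegrableOn (fun t => w t * rexp (-(t * A))) (Set.Ioi 0) ∧ ∫ t in Set.Ioi (0:ℝ), w t * rexp (-(t * A)) = Y A)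
    (hj : j < n) (c : ℝ)
    (hc : IntegrableOn (fun t => w t * (1 + 2 * t) ^ (-(((n - j : ℕ) : ℝ)/2) : ℝ)) (Set.Ioi 0) ∧ ∫ t in Set.Ioi (0:ℝ), w t * (1 + 2 * t) ^ (-(((n - j : ℕ) : ℝ)/2) : ℝ) = c) :
    ∫⁻ g, ENNReal.ofReal (Y (gA j g)) ∂Gm n = ENNReal.ofReal c := by
  have h1 : ∫⁻ g, ENNReal.ofReal (Y (gA j g)) ∂Gm n = ∫⁻ g, (∫⁻ t in Set.Ioi (0:ℝ), ENNReal.ofReal (w t * rexp (-(t * gA j g)))) ∂Gm n := by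
    apply lintegral_congr_ae
    filter_upwards [gA_pos hj] with g hg
    rw [← (hY _ hg).2, ofReal_integral_eq_lintegral_ofReal (hY _ hg).1]
    filter_upwards [ae_restrict_mem measurableSet_Ioi] with t ht
    exact mul_nonneg (hw0 t ht) (exp_pos _).le
  rw [h1, lintegral_lintegral_swap (by apply Measurable.aemeasurable; simp only [Function.uncurry_def]; fun_prop), ← hc.2, ofReal_integral_eq_lintegral_ofReal hc.1]
  · apply setLIntegral_congr_fun measurableSet_Ioi
    intro t ht
    have ht' : (0:ℝ) < t := ht
    have hi : Integrable (fun g : Fin n → ℝ => rexp (-(t * gA j g))) (Gm n) := by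
      refine Integrable.of_bound (by fun_prop) 1 (ae_of_all _ fun g => ?_)
      rw [Real.norm_eq_abs, abs_of_pos (exp_pos _)]
      exact Real.exp_le_one_iff.2 (neg_nonpos.2 (mul_nonneg ht'.le (gA_nonneg g)))
    show ∫⁻ g, ENNReal.ofReal (w t * rexp (-(t * gA j g))) ∂Gm n = _
    rw [← ofReal_integral_eq_lintegral_ofReal (hi.const_mul _) (ae_of_all _ fun g => mul_nonneg (hw0 t ht) (exp_pos _).le),
      integral_const_mul, gA_laplace ht'.le]
  · filter_upwards [ae_restrict_mem measurableSet_Ioi] with t ht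
    have ht' : (0:ℝ) < t := ht
    exact mul_nonneg (hw0 t ht) (by positivity)

lemma exp_int1 {A : ℝ} (hA : 0 < A) : IntegrableOn (fun t => (1:ℝ) * rexp (-(t * A))) (Set.Ioi 0) ∧ ∫ t in Set.Ioi (0:ℝ), (1:ℝ) * rexp (-(t * A)) = A⁻¹ := by
  have h1 := integral_rpow_mul_exp_neg_mul_Ioi (a := 1) (r := A) (by norm_num) hA
  simp at h1
  have h2 : ∫ t in Set.Ioi (0:ℝ), (1:ℝ) * rexp (-(t * A)) = A⁻¹ := by
    rw [← h1]; congr 1; ext t; simp [mul_comm]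
  refine ⟨?_, h2⟩
  by_contra h
  rw [integral_undef h] at h2
  exact (inv_pos.2 hA).ne h2

lemma exp_int2 {A : ℝ} (hA : 0 < A) : IntegrableOn (fun t => t * rexp (-(t * A))) (Set.Ioi 0) ∧ ∫ t in Set.Ioi (0:ℝ), t * rexp (-(t * A)) = A⁻¹ ^ 2 := by
  have h1 := integral_rpow_mul_exp_neg_mul_Ioi (a := 2) (r := A) (by norm_num) hA
  norm_num at h1
  have h2 : ∫ t in Set.Ioi (0:ℝ), t * rexp (-(t * A)) = A⁻¹ ^ 2 := by
    rw [inv_pow, ← h1]; congr 1; ext t; simp [mul_comm]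
  refine ⟨?_, h2⟩
  by_contra h
  rw [integral_undef h] at h2
  exact (pow_pos (inv_pos.2 hA) 2).ne h2

lemma gA_inv {n j : ℕ} (hj : j + 5 ≤ n) : Integrable (fun g : Fin n → ℝ => (gA j g)⁻¹) (Gm n) ∧
    ∫ g, (gA j g)⁻¹ ∂Gm n = 1 / ((n - j : ℝ) - 2) := by
  have hm : ((n - j : ℕ) : ℝ) = (n:ℝ) - j := by push_cast [show j ≤ n by omega]; ring
  have h5 : (j:ℝ) + 5 ≤ n := by exact_mod_cast hj
  apply int_of_lint (by fun_prop) (fun g => inv_nonneg.2 (gA_nonneg g)) (by apply one_div_nonneg.2; linarith)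
  apply gA_lap_gen (fun _ => 1) (by fun_prop) (by simp) (fun A => A⁻¹) (fun A hA => exp_int1 hA) (by omega)
  have := J_int (k := ((n - j : ℕ) : ℝ)/2) (by rw [hm]; linarith)
  simp only [one_mul]
  refine ⟨this.1, this.2.trans ?_⟩
  rw [hm]; congr 1; ring

lemma gA_inv_sq {n j : ℕ} (hj : j + 5 ≤ n) : Integrable (fun g : Fin n → ℝ => (gA j g)⁻¹ ^ 2) (Gm n) ∧
    ∫ g, (gA j g)⁻¹ ^ 2 ∂Gm n = 1 / (((n - j : ℝ) - 2) * ((n - j : ℝ) - 4)) := by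
  have hm : ((n - j : ℕ) : ℝ) = (n:ℝ) - j := by push_cast [show j ≤ n by omega]; ring
  have h5 : (j:ℝ) + 5 ≤ n := by exact_mod_cast hj
  apply int_of_lint (by fun_prop) (fun g => by positivity) (by apply one_div_nonneg.2; apply mul_nonneg <;> linarith)
  apply gA_lap_gen (fun t => t) (by fun_prop) (fun t ht => le_of_lt ht) (fun A => A⁻¹ ^ 2) (fun A hA => exp_int2 hA) (by omega)
  have := J_int2 (k := ((n - j : ℕ) : ℝ)/2) (by rw [hm]; linarith)
  refine ⟨this.1, this.2.trans ?_⟩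
  rw [hm]; congr 1; ring

end

section
open MeasureTheory ProbabilityTheory Real Filter Finset
set_option linter.all false

lemma Gm_indep (n : ℕ) : iIndepFun (fun (k : Fin n) (g : Fin n → ℝ) => g k) (Gm n) := by
  have := iIndepFun_pi (μ := fun _ : Fin n => gaussianReal 0 1) (X := fun _ x => x) (fun _ => by fun_prop)
  exact this

lemma Gm_map (n : ℕ) (k : Fin n) : (Gm n).map (fun g => g k) = gaussianReal 0 1 :=
  (measurePreserving_eval (fun _ : Fin n => gaussianReal 0 1) k).map_eq

lemma Gm_L2 {n : ℕ} (k : Fin n) {h : ℝ → ℝ} {c : ℝ} (hh : L2 (gaussianReal 0 1) h c) : L2 (Gm n) (fun g => h (g k)) c := by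
  apply L2.map (φ := fun g : Fin n → ℝ => g k) (measurable_pi_apply k).aemeasurable
  rw [Gm_map]; exact hh

lemma Gm_integral {n : ℕ} (k : Fin n) {h : ℝ → ℝ} (hh : AEStronglyMeasurable h (gaussianReal 0 1)) :
    ∫ g, h (g k) ∂Gm n = ∫ x, h x ∂gaussianReal 0 1 := by
  rw [← Gm_map n k, integral_map (measurable_pi_apply k).aemeasurable]
  rw [Gm_map]; exact hh

lemma g_L2 : L2 (gaussianReal 0 1) (fun x => x) 1 := ⟨g_memLp, g_two.le⟩
lemma gsq_L2 : L2 (gaussianReal 0 1) (fun x => x ^ 2 - 1) 2 := ⟨g_sq_memLp, g_sq_var.le⟩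
lemma gsq_L2' : L2 (gaussianReal 0 1) (fun x => x ^ 2) 3 := by
  apply L2.of_sq (by fun_prop)
  have e : ∀ x : ℝ, (x ^ 2) ^ 2 = x ^ 4 := fun x => by ring
  simp only [e]
  refine ⟨g_four_int, ?_⟩
  have : ∀ x : ℝ, |x ^ 4| = x ^ 4 := fun x => abs_of_nonneg (by positivity)
  simp only [this]
  exact g_four.le

/-- centered quadratic form -/
noncomputable def Qf {n : ℕ} (c : Fin n → ℝ) (g : Fin n → ℝ) : ℝ := ∑ k, c k * (g k ^ 2 - 1)

lemma Qf_L2 {n : ℕ} (c : Fin n → ℝ) : L2 (Gm n) (Qf c) (2 * ∑ k, c k ^ 2) := by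
  have h := L2.indep_sum (P := Gm n) (s := Finset.univ) (X := fun k g => c k * (g k ^ 2 - 1)) (v := fun k => c k ^ 2 * 2)
    (fun k _ => (Gm_L2 k gsq_L2).const_mul (c k)) (fun k _ => by
      rw [integral_const_mul, Gm_integral (h := fun x => x ^ 2 - 1) k (by fun_prop), g_sq_mean, mul_zero])
    (fun i _ j _ hij => ((Gm_indep n).indepFun hij).comp (φ := fun x => c i * (x ^ 2 - 1)) (ψ := fun x => c j * (x ^ 2 - 1)) (by fun_prop) (by fun_prop))
  rw [Finset.mul_sum]
  simp only [mul_comm (2:ℝ)]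
  exact h

lemma Qf_mean {n : ℕ} (c : Fin n → ℝ) : ∫ g, Qf c g ∂Gm n = 0 := by
  unfold Qf
  rw [integral_finset_sum _ fun k _ => ((Gm_L2 k gsq_L2).const_mul (c k)).1.integrable one_le_two]
  apply Finset.sum_eq_zero; intro k _
  rw [integral_const_mul, Gm_integral (h := fun x => x ^ 2 - 1) k (by fun_prop), g_sq_mean, mul_zero]

/-- head sum of squares -/
noncomputable def gB {n : ℕ} (j : ℕ) (g : Fin n → ℝ) : ℝ := ∑ k : Fin n, if (k : ℕ) < j then g k ^ 2 else 0

@[fun_prop]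
lemma measurable_gB {n : ℕ} (j : ℕ) : Measurable (gB (n := n) j) := by
  unfold gB
  apply Finset.measurable_sum; intro k _
  split_ifs <;> fun_prop

lemma gA_add_gB {n j : ℕ} (g : Fin n → ℝ) : gA j g + gB j g = gA 0 g := by
  unfold gA gB
  rw [← Finset.sum_add_distrib]
  apply Finset.sum_congr rfl; intro k _
  by_cases h : j ≤ (k:ℕ)
  · simp [h, not_lt.2 h]
  · simp [h, not_le.1 h]

lemma gB_nonneg {n j : ℕ} (g : Fin n → ℝ) : 0 ≤ gB j g := by
  unfold gB; apply Finset.sum_nonneg; intro k _; split_ifs <;> positivity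

lemma gAB_indep {n j : ℕ} : IndepFun (gA (n := n) j) (gB (n := n) j) (Gm n) := by
  classical
  have h := (Gm_indep n).indepFun_finset (Finset.univ.filter fun k : Fin n => j ≤ (k:ℕ)) (Finset.univ.filter fun k : Fin n => (k:ℕ) < j)
    (by rw [Finset.disjoint_filter]; intro k _ hk; omega) (fun k => by fun_prop)
  have e1 : gA (n := n) j = (fun y : (Finset.univ.filter fun k : Fin n => j ≤ (k:ℕ)) → ℝ => ∑ k, y k ^ 2) ∘ fun g k => g k.1 := by
    ext g
    simp only [gA, Function.comp]
    rw [← Finset.sum_filter, ← Finset.sum_coe_sort]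
  have e2 : gB (n := n) j = (fun y : (Finset.univ.filter fun k : Fin n => (k:ℕ) < j) → ℝ => ∑ k, y k ^ 2) ∘ fun g k => g k.1 := by
    ext g
    simp only [gB, Function.comp]
    rw [← Finset.sum_filter, ← Finset.sum_coe_sort]
  rw [e1, e2]
  exact h.comp (by fun_prop) (by fun_prop)

lemma gA_L2 {n j : ℕ} (hj : j < n) : L2 (Gm n) (fun g => gA j g - (n - j)) (2 * (n - j)) := by
  have h := Qf_L2 (n := n) (fun k => if j ≤ (k:ℕ) then 1 else 0)
  have hc : (((Finset.univ.filter fun k : Fin n => j ≤ (k:ℕ)).card : ℕ) : ℝ) = n - j := by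
    rw [card_tail]; push_cast [hj.le]; ring
  have e1 : Qf (n := n) (fun k => if j ≤ (k:ℕ) then 1 else 0) = fun g => gA j g - (n - j) := by
    ext g
    rw [← hc, Finset.card_eq_sum_ones, Finset.sum_filter]
    push_cast
    unfold Qf gA
    rw [← Finset.sum_sub_distrib]
    apply Finset.sum_congr rfl; intro k _
    split_ifs <;> simp_all <;> omega
  rw [e1] at h
  refine h.mono (le_of_eq ?_)
  rw [← hc, Finset.card_eq_sum_ones, Finset.sum_filter]
  push_cast
  congr 1
  apply Finset.sum_congr rfl; intro k _
  split_ifs <;> simp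

lemma card_head {n j : ℕ} (hj : j ≤ n): (Finset.univ.filter fun k : Fin n => (k:ℕ) < j).card = j := by
  have := Fin.card_filter_val_lt (n := n) (m := j) 
  omega

lemma gB_L2 {n j : ℕ} (hj : j ≤ n) : L2 (Gm n) (fun g => gB j g - j) (2 * j) := by
  have h := Qf_L2 (n := n) (fun k => if (k:ℕ) < j then 1 else 0)
  have hc : (((Finset.univ.filter fun k : Fin n => (k:ℕ) < j).card : ℕ) : ℝ) = j := by
    rw [card_head hj]
  have e1 : Qf (n := n) (fun k => if (k:ℕ) < j then 1 else 0) = fun g => gB j g - j := by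
    ext g
    rw [← hc, Finset.card_eq_sum_ones, Finset.sum_filter]
    push_cast
    unfold Qf gB
    rw [← Finset.sum_sub_distrib]
    apply Finset.sum_congr rfl; intro k _
    split_ifs <;> simp_all <;> omega
  rw [e1] at h
  refine h.mono (le_of_eq ?_)
  rw [← hc, Finset.card_eq_sum_ones, Finset.sum_filter]
  push_cast
  congr 1
  apply Finset.sum_congr rfl; intro k _
  split_ifs <;> simp

lemma gB_L2' {n j : ℕ} (hj : j ≤ n) : L2 (Gm n) (fun g => gB j g) (6 * j ^ 2) := by
  have h := (gB_L2 (n := n) hj).add (L2.const (P := Gm n) (j:ℝ))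
  have e : (fun g : Fin n → ℝ => gB j g - j + j) = fun g => gB j g := by ext; ring
  simp only [e] at h
  refine h.mono ?_
  rcases Nat.eq_zero_or_pos j with h0 | h0
  · simp [h0]
  · have : (1:ℝ) ≤ j := by exact_mod_cast h0
    nlinarith

lemma gx_L2 {n j : ℕ} (hj : j < n) : L2 (Gm n) (fun g => gA j g / (n - j) - 1) (2 / (n - j)) := by
  have hm : (0:ℝ) < n - j := by have : (j:ℝ) < n := by exact_mod_cast hj
                                linarith
  have h := (gA_L2 hj).const_mul ((n - j : ℝ)⁻¹)
  refine (h.mono (le_of_eq ?_)).congr (ae_of_all _ fun g => ?_)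
  · field_simp
  · show (n - j : ℝ)⁻¹ * (gA j g - (n - j)) = gA j g / (n - j) - 1
    field_simp


lemma hm8 {n j : ℕ} (hj : j + 8 ≤ n) : (8:ℝ) ≤ (n:ℝ) - j := by
  have : (j:ℝ) + 8 ≤ n := by exact_mod_cast hj
  linarith

lemma ga_L2 {n j : ℕ} (hj : j + 8 ≤ n) : L2 (Gm n) (fun g => (n - j) / gA j g) 3 := by
  have hm := hm8 hj
  obtain ⟨h1, h2⟩ := gA_inv_sq (n := n) (j := j) (by omega)
  apply L2.of_sq (by apply Measurable.aestronglyMeasurable; fun_prop)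
  have e : (fun g : Fin n → ℝ => ((n - j : ℝ) / gA j g) ^ 2) = fun g => (n - j : ℝ) ^ 2 * (gA j g)⁻¹ ^ 2 := by
    ext g; rw [div_eq_mul_inv, mul_pow]
  rw [e]
  refine ⟨h1.const_mul _, ?_⟩
  have : ∀ g : Fin n → ℝ, |(n - j : ℝ) ^ 2 * (gA j g)⁻¹ ^ 2| = (n - j : ℝ) ^ 2 * (gA j g)⁻¹ ^ 2 := fun g => abs_of_nonneg (by positivity)
  simp only [this]
  rw [integral_const_mul, h2, mul_one_div, div_le_iff₀ (by nlinarith)]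
  nlinarith

lemma ga1_L2 {n j : ℕ} (hj : j + 8 ≤ n) : L2 (Gm n) (fun g => (n - j) / gA j g - 1) (8 / (n - j)) := by
  have hm := hm8 hj
  obtain ⟨h1, h2⟩ := gA_inv_sq (n := n) (j := j) (by omega)
  obtain ⟨h3, h4⟩ := gA_inv (n := n) (j := j) (by omega)
  refine ⟨(ga_L2 hj).1.sub (memLp_const 1), ?_⟩
  have e : (fun g : Fin n → ℝ => ((n - j : ℝ) / gA j g - 1) ^ 2) = fun g => (n - j : ℝ) ^ 2 * (gA j g)⁻¹ ^ 2 + (1 - 2 * (n - j : ℝ) * (gA j g)⁻¹) := by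
    ext g; rw [div_eq_mul_inv]; ring
  rw [e]
  have i2 : Integrable (fun g : Fin n → ℝ => 1 - 2 * (n - j : ℝ) * (gA j g)⁻¹) (Gm n) := (integrable_const 1).sub (h3.const_mul _)
  rw [integral_add (h1.const_mul _) i2, integral_sub (integrable_const 1) (h3.const_mul _), integral_const_mul, integral_const_mul, h2, h4]
  simp only [integral_const, probReal_univ, smul_eq_mul, mul_one]
  set m : ℝ := (n:ℝ) - j
  have e3 : m ^ 2 * (1 / ((m - 2) * (m - 4))) + (1 - 2 * m * (1 / (m - 2))) = (2 * m + 8) / ((m - 2) * (m - 4)) := by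
    have : m - 2 ≠ 0 := by linarith
    have : m - 4 ≠ 0 := by linarith
    field_simp; ring
  rw [e3, div_le_div_iff₀ (by nlinarith) (by linarith)]
  nlinarith

lemma gx2a_L2 {n j : ℕ} (hj : j + 8 ≤ n) : L2 (Gm n) (fun g => gA j g / (n - j) - 2 + (n - j) / gA j g) (40 / (n - j) ^ 2) := by
  have hm := hm8 hj
  obtain ⟨h1, h2⟩ := gA_inv_sq (n := n) (j := j) (by omega)
  obtain ⟨h3, h4⟩ := gA_inv (n := n) (j := j) (by omega)
  have hx := gx_L2 (n := n) (j := j) (by omega)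
  have hxm : ∫ g, (gA j g / ((n:ℝ) - j) - 1) ^ 2 ∂Gm n ≤ 2 / ((n:ℝ) - j) := hx.2
  have hx0 := hx.1
  have ha0 := (ga_L2 hj).1
  set m : ℝ := (n:ℝ) - j
  have hA : MemLp (fun g : Fin n → ℝ => gA j g / m) 2 (Gm n) := by
    have := hx0.add (memLp_const (1:ℝ))
    refine this.ae_eq (ae_of_all _ fun g => ?_); simp
  refine ⟨(hA.sub (memLp_const 2)).add ha0, ?_⟩
  have e : ∀ᵐ g ∂Gm n, (gA j g / m - 2 + m / gA j g) ^ 2 =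
     ((gA j g / m - 1) ^ 2 - 2 * (gA j g / m - 1)) + (m ^ 2 * (gA j g)⁻¹ ^ 2 + (3 - 4 * m * (gA j g)⁻¹)) := by
    filter_upwards [gA_pos (n := n) (j := j) (by omega)] with g hg
    have : m ≠ 0 := by linarith
    field_simp; ring
  have hmean : ∫ g, (gA j g / m - 1) ∂Gm n = 0 := by
    have hc : (((Finset.univ.filter fun k : Fin n => j ≤ (k:ℕ)).card : ℕ) : ℝ) = n - j := by
      rw [card_tail]; push_cast [show j ≤ n by omega]; ring
    have e1 : (fun g : Fin n → ℝ => gA j g / m - 1) = fun g => m⁻¹ * Qf (n := n) (fun k => if j ≤ (k:ℕ) then 1 else 0) g := by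
      ext g
      have : Qf (n := n) (fun k => if j ≤ (k:ℕ) then 1 else 0) g = gA j g - m := by
        show _ = gA j g - ((n:ℝ) - j)
        rw [← hc, Finset.card_eq_sum_ones, Finset.sum_filter]
        push_cast
        unfold Qf gA
        rw [← Finset.sum_sub_distrib]
        apply Finset.sum_congr rfl; intro k _
        split_ifs <;> simp_all <;> omega
      rw [this]
      have : m ≠ 0 := by linarith
      field_simp
    rw [e1, integral_const_mul, Qf_mean, mul_zero]
  rw [integral_congr_ae e]
  have ix := hx0.integrable one_le_two
  have i1 : Integrable (fun g : Fin n → ℝ => (gA j g / m - 1) ^ 2 - 2 * (gA j g / m - 1)) (Gm n) := hx0.integrable_sq.sub (ix.const_mul 2)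
  have i3 : Integrable (fun g : Fin n → ℝ => 3 - 4 * m * (gA j g)⁻¹) (Gm n) := (integrable_const 3).sub (h3.const_mul _)
  have i2 : Integrable (fun g : Fin n → ℝ => m ^ 2 * (gA j g)⁻¹ ^ 2 + (3 - 4 * m * (gA j g)⁻¹)) (Gm n) := (h1.const_mul _).add i3
  rw [integral_add i1 i2, integral_sub hx0.integrable_sq (ix.const_mul 2), integral_add (h1.const_mul _) i3, integral_sub (integrable_const 3) (h3.const_mul _), integral_const_mul, integral_const_mul, integral_const_mul, h2, h4, hmean]
  simp only [integral_const, probReal_univ, smul_eq_mul, one_mul]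
  have e3 : 2 / m - 2 * 0 + (m ^ 2 * (1 / ((m - 2) * (m - 4))) + (3 - 4 * m * (1 / (m - 2)))) = (12 * m + 16) / (m * ((m - 2) * (m - 4))) := by
    have : m - 2 ≠ 0 := by linarith
    have : m - 4 ≠ 0 := by linarith
    have : m ≠ 0 := by linarith
    field_simp; ring
  refine le_trans (by gcongr) (e3.le.trans ?_)
  have h24 : 0 < (m - 2) * (m - 4) := by nlinarith
  rw [div_le_div_iff₀ (mul_pos (by linarith) h24) (by nlinarith)]
  have : (12 * m + 16) * m ≤ 40 * ((m - 2) * (m - 4)) := by nlinarith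
  nlinarith

lemma glog_L2 {n j : ℕ} (hj : j + 8 ≤ n) : L2 (Gm n) (fun g => Real.log (gA j g / (n - j)) - (gA j g / (n - j) - 1)) (40 / (n - j) ^ 2) := by
  have hm := hm8 hj
  refine (gx2a_L2 hj).of_le (by apply Measurable.aestronglyMeasurable; fun_prop) ?_
  filter_upwards [gA_pos (n := n) (j := j) (by omega)] with g hg
  set m : ℝ := (n:ℝ) - j
  have hy : 0 < gA j g / m := by apply div_pos hg; linarith
  have e : m / gA j g = (gA j g / m)⁻¹ := by rw [inv_div]
  rw [e]
  set y := gA j g / m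
  have h1 := Real.log_le_sub_one_of_pos hy
  have h2 := Real.one_sub_inv_le_log_of_pos hy
  rw [abs_of_nonpos (by linarith), abs_of_nonneg (by linarith)]
  linarith

end

section
open MeasureTheory ProbabilityTheory Real Filter Finset
set_option linter.all false

/-- inverse normalised tail -/
noncomputable def av {n : ℕ} (j : ℕ) (s : Smp n) : ℝ := ((n:ℝ) - j) / Ac j s
/-- centered normalised tail -/
noncomputable def xv {n : ℕ} (j : ℕ) (s : Smp n) : ℝ := Ac j s / ((n:ℝ) - j) - 1

@[fun_prop]
lemma measurable_av {n : ℕ} (j : ℕ) : Measurable (av (n := n) j) := by unfold av; fun_prop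
@[fun_prop]
lemma measurable_xv {n : ℕ} (j : ℕ) : Measurable (xv (n := n) j) := by unfold xv; fun_prop

/-- moment estimates for the scaling function -/
structure GoodW (n : ℕ) (θ β C : ℝ) (lam : Measure ℝ) (W : Smp n → ℝ) : Prop where
  h1 : ∀ j : ℕ, j + 8 ≤ n → β * n ≤ n - j →
    L1 (kap n lam) (fun s => av j s * W s ^ 2 - n + (1 - θ) * n * xv j s) (C * √(j + 1))
  h2 : ∀ j : ℕ, j + 8 ≤ n → β * n ≤ n - j → L2 (kap n lam) (fun s => av j s * W s - √n) C
  h3 : L2 (kap n lam) (fun s => Real.log (W s ^ 2) - Real.log n - θ * xv 0 s) (C / n ^ 2)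

lemma kap_map_fst (n : ℕ) (lam : Measure ℝ) [IsProbabilityMeasure lam] : (kap n lam).map Prod.fst = Gm n := by
  unfold kap; simp

lemma kap_map_snd (n : ℕ) (lam : Measure ℝ) [IsProbabilityMeasure lam] : (kap n lam).map Prod.snd = lam := by
  unfold kap; simp

lemma kap_L2 {n : ℕ} {lam : Measure ℝ} [IsProbabilityMeasure lam] {X : (Fin n → ℝ) → ℝ} {c : ℝ} (h : L2 (Gm n) X c) :
    L2 (kap n lam) (fun s => X s.1) c := by
  apply L2.map (φ := Prod.fst) (by fun_prop)
  rw [kap_map_fst]; exact h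

lemma kap_L2' {n : ℕ} {lam : Measure ℝ} [IsProbabilityMeasure lam] {X : ℝ → ℝ} {c : ℝ} (h : L2 lam X c) :
    L2 (kap n lam) (fun s => X s.2) c := by
  apply L2.map (φ := Prod.snd) (by fun_prop)
  rw [kap_map_snd]; exact h

lemma kap_indep {n : ℕ} {lam : Measure ℝ} [IsProbabilityMeasure lam] {X : (Fin n → ℝ) → ℝ} {Y : ℝ → ℝ} (hX : Measurable X) (hY : Measurable Y) :
    IndepFun (fun s : Smp n => X s.1) (fun s => Y s.2) (kap n lam) := by
  unfold kap
  exact indepFun_prod hX hY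

lemma goodW_gauss {n : ℕ} (hn : 8 ≤ n) {β : ℝ} (hβ : 0 < β) (hβ1 : β ≤ 1) : GoodW n 0 β (8 / β) (Measure.dirac 0) (fun _ => √n) := by
  have hn0 : (0:ℝ) < n := by positivity
  have hb1 : 1 ≤ β⁻¹ := (one_le_inv₀ hβ).2 hβ1
  refine ⟨fun j hj hb => ?_, fun j hj hb => ?_, ?_⟩
  · have hm := hm8 hj
    have h := ((kap_L2 (lam := Measure.dirac 0) (gx2a_L2 hj)).const_mul n).l1
    refine (h.mono ?_).congr ?_
    · have : (n:ℝ) ^ 2 * (40 / (n - j) ^ 2) ≤ (8 / β) ^ 2 := by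
        rw [div_pow, ← mul_div_assoc, div_le_div_iff₀ (by positivity) (by positivity)]
        have : (β * n) ^ 2 ≤ (n - j : ℝ) ^ 2 := by gcongr
        nlinarith
      calc √((n:ℝ) ^ 2 * (40 / (n - j) ^ 2)) ≤ √((8 / β) ^ 2) := Real.sqrt_le_sqrt this
        _ = 8 / β := Real.sqrt_sq (by positivity)
        _ ≤ 8 / β * √(j + 1) := by
            apply le_mul_of_one_le_right (by positivity)
            rw [Real.one_le_sqrt]; linarith [(Nat.cast_nonneg j : (0:ℝ) ≤ j)]
    · filter_upwards with s
      simp only [av, xv, Ac_eq]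
      rw [Real.sq_sqrt hn0.le]
      ring
  · have hm := hm8 hj
    have h := ((kap_L2 (lam := Measure.dirac 0) (ga1_L2 hj)).const_mul (√n))
    refine (h.mono ?_).congr ?_
    · rw [Real.sq_sqrt hn0.le, ← mul_div_assoc, div_le_div_iff₀ (by linarith) hβ]
      nlinarith
    · filter_upwards with s
      simp only [av, Ac_eq]; ring
  · have : ∀ s : Smp n, Real.log (√n ^ 2) - Real.log n - 0 * xv 0 s = 0 := by
      intro s; rw [Real.sq_sqrt hn0.le]; simp
    simp only [this]
    refine (L2.const (P := kap n (Measure.dirac 0)) 0).mono ?_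
    simp; positivity

/-- hypotheses on the independent radius -/
structure GoodR (n : ℕ) (C : ℝ) (lam : Measure ℝ) : Prop where
  prob : IsProbabilityMeasure lam
  mem : ∀ᵐ R ∂lam, 0 < R ∧ R ≤ 1
  l2 : L2 lam (fun R => (R ^ 2)⁻¹ - 1) (C / n ^ 2)

lemma goodW_sphere {n : ℕ} (hn : 8 ≤ n) {β C : ℝ} (hβ : 0 < β) (hβ1 : β ≤ 1) (hC : 0 ≤ C) {lam : Measure ℝ} (hR : GoodR n C lam) :
    GoodW n 1 β (100 * (1 + C) / β) lam (fun s => √(Ac 0 s) / s.2) := by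
  have hn0 : (0:ℝ) < n := by positivity
  have hb1 : 1 ≤ β⁻¹ := (one_le_inv₀ hβ).2 hβ1
  haveI := hR.prob
  have hRa : ∀ᵐ s ∂kap n lam, 0 < s.2 ∧ s.2 ≤ 1 := by
    have h := hR.mem
    rw [← kap_map_snd n lam] at h
    exact ae_of_ae_map (by fun_prop) h
  have hApos : ∀ j : ℕ, j < n → ∀ᵐ s ∂kap n lam, 0 < Ac j s := fun j hj => Ac_pos lam hj
  have hbC : 0 ≤ C / β := by positivity
  have hRL := kap_L2' (n := n) hR.l2
  have hβ80 : 100 * (1 + C) / β = 100 * β⁻¹ + 100 * (C * β⁻¹) := by field_simp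
  have hCβ : C ≤ C * β⁻¹ := le_mul_of_one_le_right hC hb1
  refine ⟨fun j hj hb => ?_, fun j hj hb => ?_, ?_⟩
  · have hm := hm8 hj
    have hjn : j ≤ n := by omega
    have hj0 : (0:ℝ) ≤ j := Nat.cast_nonneg j
    have hB := kap_L2 (lam := lam) (gB_L2 hjn)
    have hB' := kap_L2 (lam := lam) (gB_L2' hjn)
    have ha1 := kap_L2 (lam := lam) (ga1_L2 hj)
    have ha := kap_L2 (lam := lam) (ga_L2 hj)
    have t1 := hB.l1
    have t2 := ha1.mul hB'
    have t3 := (L1.const (P := kap n lam) (n - j : ℝ)).add (ha.mul hB')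
    have t4 := t3.indep_mul hRL.l1 (kap_indep (X := fun g => (n - j : ℝ) + (n - j) / gA j g * gB j g) (Y := fun R => (R ^ 2)⁻¹ - 1) (by fun_prop) (by fun_prop))
    refine (((t1.add t2).add t4).mono ?_).congr ?_
    · have e1 : √(2 * j) ≤ 2 * √(j + 1) := by
        rw [show (2:ℝ) * √(j + 1) = √(4 * (j + 1)) by rw [Real.sqrt_mul (by norm_num), show (4:ℝ) = 2 ^ 2 by norm_num, Real.sqrt_sq (by norm_num)]]
        apply Real.sqrt_le_sqrt; linarith
      have e2 : √(8 / (n - j) * (6 * j ^ 2)) ≤ 7 * β⁻¹ * √(j + 1) := by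
        rw [show (7:ℝ) * β⁻¹ * √(j + 1) = √(49 * β⁻¹ ^ 2 * (j + 1)) by
          rw [Real.sqrt_mul (by positivity), show 49 * β⁻¹ ^ 2 = (7 * β⁻¹) ^ 2 by ring, Real.sqrt_sq (by positivity)]]
        apply Real.sqrt_le_sqrt
        have q1 : 8 / (n - j : ℝ) ≤ 8 * (β⁻¹ * (n:ℝ)⁻¹) := by
          rw [← mul_inv, ← div_eq_mul_inv]
          apply div_le_div_of_nonneg_left (by norm_num) (by positivity) hb
        have q2 : (n:ℝ)⁻¹ * j ≤ 1 := by
          rw [inv_mul_le_iff₀ hn0]; simpa using (by exact_mod_cast hjn : (j:ℝ) ≤ n)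
        calc 8 / (n - j : ℝ) * (6 * j ^ 2) ≤ 8 * (β⁻¹ * (n:ℝ)⁻¹) * (6 * j ^ 2) := by gcongr
          _ = 48 * β⁻¹ * ((n:ℝ)⁻¹ * j) * j := by ring
          _ ≤ 48 * β⁻¹ * 1 * j := by gcongr
          _ ≤ 49 * (β⁻¹ ^ 2) * (j + 1) := by
              have : β⁻¹ ≤ β⁻¹ ^ 2 := by nlinarith
              nlinarith [mul_le_mul_of_nonneg_right this hj0, mul_nonneg (sq_nonneg β⁻¹) hj0, sq_nonneg β⁻¹]
      have e3 : (|(n - j : ℝ)| + √(3 * (6 * j ^ 2))) * √(C / n ^ 2) ≤ 5 * (1 + C) * √(j + 1) := by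
        have q1 : √(3 * (6 * (j:ℝ) ^ 2)) ≤ 5 * j := by
          apply Real.sqrt_le_iff.2; constructor; positivity; nlinarith [sq_nonneg (j:ℝ)]
        have q2 : √(C / n ^ 2) = √C / n := by rw [Real.sqrt_div hC, Real.sqrt_sq hn0.le]
        have q3 : √C ≤ 1 + C := by apply Real.sqrt_le_iff.2; constructor; positivity; nlinarith
        have q4 : (1:ℝ) ≤ √(j + 1) := by rw [Real.one_le_sqrt]; linarith
        have q5 : |(n - j : ℝ)| + √(3 * (6 * (j:ℝ) ^ 2)) ≤ 5 * n := by
          rw [abs_of_nonneg (by linarith)]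
          have : (j:ℝ) ≤ n := by exact_mod_cast hjn
          linarith
        calc (|(n - j : ℝ)| + √(3 * (6 * j ^ 2))) * √(C / n ^ 2) ≤ (5 * n) * (√C / n) := by rw [q2]; gcongr
          _ = 5 * √C * 1 := by field_simp
          _ ≤ 5 * (1 + C) * √(j + 1) := by gcongr
      rw [hβ80]
      have hs : 0 ≤ √((j:ℝ) + 1) := by positivity
      have : (2 + 7 * β⁻¹ + 5 * (1 + C)) * √((j:ℝ) + 1) ≤ (100 * β⁻¹ + 100 * (C * β⁻¹)) * √(j + 1) := by
        apply mul_le_mul_of_nonneg_right _ hs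
        linarith
      linarith
    · filter_upwards [hRa, hApos j (by omega), hApos 0 (by omega)] with s hs hA hN
      have e := gA_add_gB (j := j) s.1
      simp only [av, xv, Ac_eq] at *
      rw [div_pow, Real.sq_sqrt hN.le, ← e]
      field_simp
      ring
  · have hm := hm8 hj
    have hjn : j ≤ n := by omega
    have hj0 : (0:ℝ) ≤ j := Nat.cast_nonneg j
    have hjn' : (j:ℝ) ≤ n := by exact_mod_cast hjn
    have hB := kap_L2 (lam := lam) (gB_L2 hjn)
    have hB' := kap_L2 (lam := lam) (gB_L2' hjn)
    have ha1 := kap_L2 (lam := lam) (ga1_L2 hj)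
    have ha := kap_L2 (lam := lam) (ga_L2 hj)
    have hi : IndepFun (fun g : Fin n → ℝ => (n - j) / gA j g) (fun g => gB j g - j) (Gm n) :=
      (gAB_indep (n := n) (j := j)).comp (φ := fun x => (n - j : ℝ) / x) (ψ := fun x : ℝ => x - (j:ℝ)) (by fun_prop) (by fun_prop)
    have u1 := kap_L2 (lam := lam) ((ga_L2 hj).indep_mul (gB_L2 hjn) hi)
    have u2 := ((ha1.const_mul (n - j : ℝ)).sub u1).const_mul ((√n)⁻¹)
    have v1 : L2 (kap n lam) (fun s => av j s * (√(Ac 0 s) - √n)) 16 := by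
      refine (u2.mono ?_).of_le (by apply Measurable.aestronglyMeasurable; fun_prop) ?_
      · rw [inv_pow, Real.sq_sqrt hn0.le, inv_mul_le_iff₀ hn0]
        have : (n - j : ℝ) ^ 2 * (8 / (n - j)) = 8 * (n - j) := by
          have : (n - j : ℝ) ≠ 0 := by linarith
          field_simp
        rw [this]; nlinarith
      · filter_upwards [hApos j (by omega), hApos 0 (by omega)] with s hA hN
        have e := gA_add_gB (j := j) s.1
        simp only [av, Ac_eq] at *
        have e2 : (n - j : ℝ) * ((n - j) / gA j s.1 - 1) - (n - j) / gA j s.1 * (gB j s.1 - j) = - ((n - j) / gA j s.1 * (gA 0 s.1 - n)) := by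
          rw [← e]; field_simp; ring
        rw [e2, abs_mul, abs_mul, abs_neg, abs_mul, mul_left_comm]
        apply mul_le_mul_of_nonneg_left _ (abs_nonneg _)
        rw [abs_of_pos (inv_pos.2 (Real.sqrt_pos.2 hn0)), ← div_eq_inv_mul, le_div_iff₀ (Real.sqrt_pos.2 hn0)]
        have e3 : gA 0 s.1 - n = (√(gA 0 s.1) - √n) * (√(gA 0 s.1) + √n) := by
          nlinarith [Real.sq_sqrt hN.le, Real.sq_sqrt hn0.le]
        rw [e3, abs_mul]
        apply mul_le_mul_of_nonneg_left _ (abs_nonneg _)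
        rw [abs_of_nonneg (by positivity)]
        linarith [Real.sqrt_nonneg (gA 0 s.1)]
    have v2 : L2 (kap n lam) (fun s => √n * (av j s - 1)) (8 * β⁻¹) := by
      refine (ha1.const_mul (√n)).mono ?_
      rw [Real.sq_sqrt hn0.le, ← mul_div_assoc, div_le_iff₀ (by linarith)]
      have : (n:ℝ) ≤ β⁻¹ * (n - j) := by rw [← div_eq_inv_mul, le_div_iff₀ hβ]; linarith
      nlinarith
    have hi2 : IndepFun (fun g : Fin n → ℝ => ((n - j) / gA j g) ^ 2) (fun g => gB j g) (Gm n) :=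
      (gAB_indep (n := n) (j := j)).comp (φ := fun x => ((n - j : ℝ) / x) ^ 2) (ψ := fun x => x) (by fun_prop) (by fun_prop)
    have w1 : L2 (Gm n) (fun g => (n - j) / gA j g * √(gA 0 g)) (9 * n) := by
      apply L2.of_sq (by apply Measurable.aestronglyMeasurable; fun_prop)
      have w2 := ((ga_L2 hj).l1.const_mul (n - j)).add ((ga_L2 hj).sq.indep_mul (gB_L2' hjn).l1 hi2)
      refine (w2.mono ?_).congr ?_
      · rw [abs_of_nonneg (by linarith)]
        have q1 : √(6 * (j:ℝ) ^ 2) ≤ 3 * j := by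
          apply Real.sqrt_le_iff.2; constructor; positivity; nlinarith [sq_nonneg (j:ℝ)]
        have q2 : √3 ≤ (2:ℝ) := by apply Real.sqrt_le_iff.2; norm_num
        nlinarith
      · filter_upwards [gA_pos (n := n) (j := j) (by omega), gA_pos (n := n) (j := 0) (by omega)] with g hA hN
        have e := gA_add_gB (j := j) g
        show (n - j : ℝ) * ((n - j) / gA j g) + ((n - j) / gA j g) ^ 2 * gB j g = ((n - j) / gA j g * √(gA 0 g)) ^ 2
        rw [mul_pow, Real.sq_sqrt hN.le, ← e]
        field_simp
    have v3 := (kap_L2 (lam := lam) w1).indep_mul hRL (kap_indep (X := fun g => (n - j) / gA j g * √(gA 0 g)) (Y := fun R => (R ^ 2)⁻¹ - 1) (by fun_prop) (by fun_prop))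
    have v4 : L2 (kap n lam) (fun s => av j s * √(Ac 0 s) * (s.2⁻¹ - 1)) (9 * C) := by
      refine (v3.mono ?_).of_le (by apply Measurable.aestronglyMeasurable; fun_prop) ?_
      · rw [← mul_div_assoc, div_le_iff₀ (by positivity)]
        have : (1:ℝ) ≤ n := by have : (8:ℝ) ≤ n := by exact_mod_cast hn
                               linarith
        nlinarith [mul_nonneg (mul_nonneg hC hn0.le) (sub_nonneg.2 this)]
      · filter_upwards [hRa] with s hs
        rw [abs_mul, abs_mul (_ * _) ((s.2 ^ 2)⁻¹ - 1)]
        apply mul_le_mul_of_nonneg_left _ (abs_nonneg _)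
        have h1 : 1 ≤ s.2⁻¹ := (one_le_inv₀ hs.1).2 hs.2
        rw [← inv_pow, abs_of_nonneg (by linarith), abs_of_nonneg (by nlinarith)]
        nlinarith
    refine (((v1.add v2).add v4).mono ?_).congr ?_
    · rw [hβ80]; linarith
    · filter_upwards with s
      rw [div_eq_mul_inv]; ring
  · have h1 := (kap_L2 (lam := lam) (glog_L2 (n := n) (j := 0) (by omega)))
    have h2 : L2 (kap n lam) (fun s => Real.log (s.2 ^ 2)⁻¹) (C / n ^ 2) := by
      refine hRL.of_le (by apply Measurable.aestronglyMeasurable; fun_prop) ?_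
      filter_upwards [hRa] with s hs
      have h1 : 1 ≤ (s.2 ^ 2)⁻¹ := (one_le_inv₀ (by nlinarith)).2 (by nlinarith)
      rw [abs_of_nonneg (Real.log_nonneg h1), abs_of_nonneg (by linarith)]
      exact Real.log_le_sub_one_of_pos (by linarith)
    refine ((h1.add h2).mono ?_).congr ?_
    · simp only [CharP.cast_eq_zero, sub_zero]
      rw [← add_div, ← mul_div_assoc]
      gcongr
      rw [hβ80]; linarith
    · filter_upwards [hRa, hApos 0 (by omega)] with s hs hN
      simp only [xv, Ac_eq] at *
      simp only [CharP.cast_eq_zero, sub_zero, one_mul]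
      rw [div_pow, Real.sq_sqrt hN.le, Real.log_div hN.ne' hn0.ne', Real.log_div hN.ne' (by have := hs.1; positivity), Real.log_inv]
      ring

end

section
open MeasureTheory ProbabilityTheory Real Filter Finset
set_option linter.all false

/-- all the standing assumptions -/
structure Ctx (n N : ℕ) [NeZero n] (θ β C : ℝ) (μ : Measure (EuclideanSpace ℝ (Fin n))) (lam : Measure ℝ) (W : Smp n → ℝ) : Prop where
  rep : GRep n μ lam W
  good : GoodW n θ β C lam W
  hβ : 0 < β
  hβ1 : β ≤ 1
  hC : 1 ≤ C
  hθ : 0 ≤ θ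
  hθ1 : θ ≤ 1
  hN : 2 ≤ N
  hN8 : N + 8 ≤ n
  hb : β * n ≤ n - N

/-- law of the whole sequence -/
noncomputable abbrev PP (n : ℕ) (lam : Measure ℝ) : Measure (ℕ → Smp n) := Measure.infinitePi fun _ : ℕ => kap n lam

section step
variable {n : ℕ} {lam : Measure ℝ} [IsProbabilityMeasure lam]

lemma PP_map (j : ℕ) : (PP n lam).map (fun ω => ω j) = kap n lam :=
  (measurePreserving_eval_infinitePi (fun _ : ℕ => kap n lam) j).map_eq

lemma PP_L1 (j : ℕ) {X : Smp n → ℝ} {c : ℝ} (h : L1 (kap n lam) X c) : L1 (PP n lam) (fun ω => X (ω j)) c := by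
  apply L1.map (φ := fun ω : ℕ → Smp n => ω j) (measurable_pi_apply j).aemeasurable
  rw [PP_map]; exact h

lemma PP_L2 (j : ℕ) {X : Smp n → ℝ} {c : ℝ} (h : L2 (kap n lam) X c) : L2 (PP n lam) (fun ω => X (ω j)) c := by
  apply L2.map (φ := fun ω : ℕ → Smp n => ω j) (measurable_pi_apply j).aemeasurable
  rw [PP_map]; exact h

lemma PP_ae (j : ℕ) {p : Smp n → Prop} (h : ∀ᵐ s ∂kap n lam, p s) : ∀ᵐ ω ∂PP n lam, p (ω j) := by
  rw [← PP_map (n := n) (lam := lam) j] at h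
  exact ae_of_ae_map (measurable_pi_apply j).aemeasurable h

lemma PP_integral (j : ℕ) {X : Smp n → ℝ} (h : AEStronglyMeasurable X (kap n lam)) : ∫ ω, X (ω j) ∂PP n lam = ∫ s, X s ∂kap n lam := by
  rw [← PP_map (n := n) (lam := lam) j, integral_map (measurable_pi_apply j).aemeasurable]
  rw [PP_map]; exact h

lemma PP_past_mul {j : ℕ} {u : (ℕ → Smp n) → ℝ} (hu : Past j u) {X : Smp n → ℝ} (hX : Measurable X) {a b : ℝ}
    (h1 : L1 (PP n lam) u a) (h2 : L1 (kap n lam) X b) : L1 (PP n lam) (fun ω => u ω * X (ω j)) (a * b) :=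
  h1.indep_mul (PP_L1 j h2) ((hu.indep (kap n lam)).comp (φ := id) (ψ := X) measurable_id hX)

lemma PP_sum_L2 {N : ℕ} {X : ℕ → Smp n → ℝ} {v : ℕ → ℝ} (hX : ∀ j < N, L2 (kap n lam) (X j) (v j)) (hm : ∀ j < N, Measurable (X j))
    (h0 : ∀ j < N, ∫ s, X j s ∂kap n lam = 0) :
    L2 (PP n lam) (fun ω => ∑ j ∈ Finset.range N, X j (ω j)) (∑ j ∈ Finset.range N, v j) := by
  refine L2.indep_sum (P := PP n lam) (s := Finset.range N) (X := fun j (ω : ℕ → Smp n) => X j (ω j)) (v := v) ?_ ?_ ?_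
  · intro j hj; exact PP_L2 j (hX j (Finset.mem_range.1 hj))
  · intro j hj
    rw [PP_integral j (hm j (Finset.mem_range.1 hj)).aestronglyMeasurable]; exact h0 j (Finset.mem_range.1 hj)
  · intro i hi j hj hij
    have hi' := Finset.mem_range.1 hi
    have hj' := Finset.mem_range.1 hj
    have h := iIndepFun_infinitePi (P := fun _ : ℕ => kap n lam) (X := fun _ => (id : Smp n → Smp n)) (fun _ => measurable_id)
    exact (h.indepFun hij).comp (hm i hi') (hm j hj')

lemma kap_g_L2 [NeZero n] : L2 (kap n lam) (fun s => s.1 0) 1 := kap_L2 (Gm_L2 0 g_L2)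
lemma kap_g1_L2 [NeZero n] : L2 (kap n lam) (fun s => s.1 0 ^ 2 - 1) 2 := kap_L2 (Gm_L2 0 gsq_L2)
lemma kap_g2_L2 [NeZero n] : L2 (kap n lam) (fun s => s.1 0 ^ 2) 3 := kap_L2 (Gm_L2 0 gsq_L2')

lemma kap_integral {X : (Fin n → ℝ) → ℝ} (h : Measurable X) : ∫ s, X s.1 ∂kap n lam = ∫ g, X g ∂Gm n := by
  rw [← kap_map_fst n lam, integral_map (by fun_prop) h.aestronglyMeasurable]

lemma kap_g_mean [NeZero n] : ∫ s : Smp n, s.1 0 ∂kap n lam = 0 := by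
  rw [kap_integral (X := fun g => g 0) (by fun_prop), Gm_integral (h := fun x => x) 0 (by fun_prop), integral_id_gaussianReal]

lemma kap_g1_mean [NeZero n] : ∫ s : Smp n, (s.1 0 ^ 2 - 1) ∂kap n lam = 0 := by
  rw [kap_integral (X := fun g => g 0 ^ 2 - 1) (by fun_prop), Gm_integral (h := fun x => x ^ 2 - 1) 0 (by fun_prop), g_sq_mean]

lemma xv_eq_Qf {j : ℕ} (hj : j < n) (s : Smp n) : xv j s = Qf (fun k : Fin n => if j ≤ (k:ℕ) then ((n:ℝ) - j)⁻¹ else 0) s.1 := by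
  have hc : (((Finset.univ.filter fun k : Fin n => j ≤ (k:ℕ)).card : ℕ) : ℝ) = n - j := by
    rw [card_tail]; push_cast [hj.le]; ring
  have hm : (n - j : ℝ) ≠ 0 := by
    have : (j:ℝ) < n := by exact_mod_cast hj
    linarith
  have : Qf (fun k : Fin n => if j ≤ (k:ℕ) then ((n:ℝ) - j)⁻¹ else 0) s.1 = ((n:ℝ) - j)⁻¹ * (Ac j s - (n - j)) := by
    rw [← hc, Finset.card_eq_sum_ones, Finset.sum_filter]
    push_cast
    unfold Qf Ac
    rw [← Finset.sum_sub_distrib, Finset.mul_sum]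
    apply Finset.sum_congr rfl; intro k _
    split_ifs <;> simp_all
  rw [this, xv]
  field_simp

lemma xv_L2 {j : ℕ} (hj : j < n) : L2 (kap n lam) (xv j) (2 / (n - j)) := kap_L2 (gx_L2 hj)

lemma measurable_Qf (c : Fin n → ℝ) : Measurable (Qf c) := by unfold Qf; fun_prop

lemma xv_mean {j : ℕ} (hj : j < n) : ∫ s, xv j s ∂kap n lam = 0 := by
  simp only [xv_eq_Qf hj]
  rw [kap_integral (measurable_Qf _), Qf_mean]

end step

/-- deterministic centering of `q` -/
noncomputable def cc (n j : ℕ) : ℝ := n * j / (n - j + 1)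

lemma dq_nonneg {n : ℕ} [NeZero n] (W : Smp n → ℝ) (j : ℕ) (ω : ℕ → Smp n) : 0 ≤ (dq W j ω).2 := by
  induction j with
  | zero => simp [dq]
  | succ j ih =>
    simp only [dq, stepF]
    have : 0 ≤ Ac j (ω j) := gA_nonneg (j := j) (ω j).1
    positivity

lemma dq_mono {n : ℕ} [NeZero n] (W : Smp n → ℝ) (j : ℕ) (ω : ℕ → Smp n) : (dq W j ω).2 ≤ (dq W (j+1) ω).2 := by
  simp only [dq, stepF]
  have : 0 ≤ Ac j (ω j) := gA_nonneg (j := j) (ω j).1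
  have : 0 ≤ (W (ω j) - √(dq W j ω).2 * (ω j).1 0) ^ 2 / Ac j (ω j) := by positivity
  linarith

/-- leading part of the increment -/
noncomputable def mainS {n : ℕ} [NeZero n] (θ : ℝ) (j : ℕ) (s : Smp n) : ℝ :=
  -(1 - θ) * n * xv j s + cc n j * (s.1 0 ^ 2 - 1) - 2 * √n * √(cc n j) * s.1 0

/-- error part of the increment -/
noncomputable def errS {n : ℕ} [NeZero n] (θ : ℝ) (W : Smp n → ℝ) (j : ℕ) (ω : ℕ → Smp n) : ℝ :=
  (av j (ω j) * W (ω j) ^ 2 - n + (1 - θ) * n * xv j (ω j))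
  + (dq W j ω).2 * ((av j (ω j) - 1) * (ω j).1 0 ^ 2)
  + ((dq W j ω).2 - cc n j) * ((ω j).1 0 ^ 2 - 1)
  - 2 * (√(dq W j ω).2 * ((av j (ω j) * W (ω j) - √n) * (ω j).1 0))
  - 2 * √n * ((√(dq W j ω).2 - √(cc n j)) * (ω j).1 0)

lemma q_step {n : ℕ} [NeZero n] (θ : ℝ) (W : Smp n → ℝ) {j : ℕ} (hj : j < n) (ω : ℕ → Smp n) :
    ((n:ℝ) - (j + 1 : ℕ) + 1) * ((dq W (j+1) ω).2 - cc n (j+1)) =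
     ((n:ℝ) - j + 1) * ((dq W j ω).2 - cc n j) + (mainS θ j (ω j) + errS θ W j ω) := by
  have hjn : (j:ℝ) < n := by exact_mod_cast hj
  have hm : (0:ℝ) < n - j := by linarith
  have e1 : ((n:ℝ) - (j + 1 : ℕ) + 1) * cc n (j+1) = n * (j + 1) := by
    unfold cc; push_cast
    have : ((n:ℝ) - (j + 1) + 1) ≠ 0 := by linarith
    field_simp
  have e2 : ((n:ℝ) - j + 1) * cc n j = n * j := by
    unfold cc
    have : ((n:ℝ) - j + 1) ≠ 0 := by linarith
    field_simp
  have e3 : ((n:ℝ) - (j + 1 : ℕ) + 1) * (dq W (j+1) ω).2 = (n - j) * (dq W j ω).2 + av j (ω j) * (W (ω j) - √(dq W j ω).2 * (ω j).1 0) ^ 2 := by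
    simp only [dq, stepF, av]; push_cast; ring
  have hq := Real.sq_sqrt (dq_nonneg W j ω)
  rw [mul_sub, mul_sub, e1, e2, e3, mainS, errS]
  generalize √(dq W j ω).2 = sq at *
  rw [← hq]
  ring

lemma q_sum {n : ℕ} [NeZero n] (θ : ℝ) (W : Smp n → ℝ) {j : ℕ} (hj : j ≤ n) (ω : ℕ → Smp n) :
    ((n:ℝ) - j + 1) * ((dq W j ω).2 - cc n j) = ∑ i ∈ Finset.range j, mainS θ i (ω i) + ∑ i ∈ Finset.range j, errS θ W i ω := by
  induction j with
  | zero => simp [dq, cc]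
  | succ j ih =>
    rw [q_step θ W (by omega) ω, ih (by omega), Finset.sum_range_succ, Finset.sum_range_succ]; ring

set_option maxHeartbeats 800000 in
/-- numeric estimate for the error bound -/
lemma err_num {n j q D C β : ℝ} (hjn : j ≤ n) (hm : 8 ≤ n - j) (hb1 : 1 ≤ β⁻¹) (hC : 1 ≤ C) (hβ : 0 < β) (hbj : β * n ≤ n - j) (hj1 : 1 ≤ j) (hD0 : 0 ≤ D) (hc0 : 0 ≤ q) (hc2 : q ≤ β⁻¹ * j) :
    C * √(j + 1) + (q + D) * √(8 / (n - j) * 3) + D * √2 + |2| * (√(q + D) * √(C * 1)) + |2 * √n| * ((√j)⁻¹ * D * √1) ≤ 20 * C * β⁻¹ ^ 2 * (√j + √n * D / √j) := by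
  have hn0 : 0 < n := by linarith
  have hnsq : √n ^ 2 = n := Real.sq_sqrt hn0.le
  have hn1 : 1 ≤ √n := by rw [Real.one_le_sqrt]; linarith
  obtain ⟨sj, hsj⟩ : ∃ sj, sj = √j := ⟨_, rfl⟩
  obtain ⟨sn, hsn⟩ : ∃ sn, sn = √n := ⟨_, rfl⟩
  rw [← hsn] at hnsq hn1
  rw [← hsj, ← hsn]
  have hsj1 : 1 ≤ sj := by rw [hsj, Real.one_le_sqrt]; exact hj1
  have hsj2 : sj ^ 2 = j := by rw [hsj]; exact Real.sq_sqrt (by linarith)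
  have hjn' : sj ≤ sn := by rw [hsj, hsn]; exact Real.sqrt_le_sqrt hjn
  obtain ⟨b, hb⟩ : ∃ b, b = β⁻¹ := ⟨_, rfl⟩
  rw [← hb] at hb1 hc2 ⊢
  obtain ⟨E, hE⟩ : ∃ E, E = sn * D / sj := ⟨_, rfl⟩
  rw [← hE]
  have hDE : D ≤ E := by
    rw [hE, le_div_iff₀ (by positivity)]; nlinarith
  have hE0 : 0 ≤ E := hD0.trans hDE
  have f1 : √(j + 1) ≤ 2 * sj := by
    apply Real.sqrt_le_iff.2; constructor; positivity; nlinarith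
  have f2 : √(8 / (n - j) * 3) ≤ 5 * b / sn := by
    apply Real.sqrt_le_iff.2; constructor; positivity
    rw [div_pow, hnsq, div_mul_eq_mul_div, div_le_div_iff₀ (by linarith) hn0]
    have : n ≤ b * (n - j) := by rw [hb, ← div_eq_inv_mul, le_div_iff₀ hβ]; linarith
    nlinarith [mul_nonneg (sub_nonneg.2 hb1) (mul_nonneg (by linarith : 0 ≤ b) (by linarith : (0:ℝ) ≤ n - j))]
  have f2' : (q + D) * √(8 / (n - j) * 3) ≤ 5 * b ^ 2 * sj + 5 * b * E := by
    calc (q + D) * √(8 / (n - j) * 3) ≤ (b * j + D) * (5 * b / sn) := by gcongr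
      _ = 5 * b ^ 2 * (sj * (sj / sn)) + 5 * b * (D * (1 / sn)) := by rw [← hsj2]; field_simp
      _ ≤ 5 * b ^ 2 * (sj * 1) + 5 * b * (E * 1) := by
          gcongr
          · rw [div_le_one (by positivity)]; exact hjn'
          · rw [div_le_one (by positivity)]; exact hn1
      _ = _ := by ring
  have f3 : √2 ≤ (2:ℝ) := by apply Real.sqrt_le_iff.2; norm_num
  have f4 : √(q + D) ≤ b * sj + E + sj := by
    apply Real.sqrt_le_iff.2; constructor; positivity
    have : q + D ≤ b * sj ^ 2 + E := by rw [hsj2]; linarith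
    have hb0 : 0 ≤ b := by linarith
    have hs0 : 0 ≤ sj := by linarith
    have e : (b * sj + E + sj) ^ 2 = b * sj ^ 2 + E + (b * sj ^ 2 + E * (sj - 1)) + (b ^ 2 * sj ^ 2 + E ^ 2 + sj ^ 2 + 2 * b * sj * E + E * sj) := by ring
    have e1 : 0 ≤ b * sj ^ 2 + E * (sj - 1) := by
      have := mul_nonneg hE0 (by linarith : 0 ≤ sj - 1)
      positivity
    have e2 : 0 ≤ b ^ 2 * sj ^ 2 + E ^ 2 + sj ^ 2 + 2 * b * sj * E + E * sj := by positivity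
    linarith
  have f5 : √(C * 1) ≤ C := by apply Real.sqrt_le_iff.2; constructor; linarith; nlinarith
  have g4 : √(q + D) * √(C * 1) ≤ (b * sj + E + sj) * C := by gcongr
  have g5 : |2 * sn| * (sj⁻¹ * D * √1) = 2 * E := by
    rw [abs_of_nonneg (by positivity), Real.sqrt_one, hE]; field_simp
  rw [g5, abs_of_nonneg (by norm_num : (0:ℝ) ≤ 2)]
  have g1 : C * √(j + 1) ≤ C * (2 * sj) := by gcongr
  have g3 : D * √2 ≤ E * 2 := by gcongr
  have hb2 : b ≤ b ^ 2 := by nlinarith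
  have k1 : C * (2 * sj) + 5 * b ^ 2 * sj + 2 * ((b * sj + sj) * C) ≤ 20 * C * b ^ 2 * sj := by
    have : C * 2 + 5 * b ^ 2 + 2 * (b + 1) * C ≤ 20 * C * b ^ 2 := by
      have a1 : b ^ 2 ≤ C * b ^ 2 := le_mul_of_one_le_left (sq_nonneg b) hC
      have a2 : C * b ≤ C * b ^ 2 := by gcongr
      have a3 : C ≤ C * b := le_mul_of_one_le_right (by linarith) hb1
      linarith
    have := mul_le_mul_of_nonneg_right this (by linarith : 0 ≤ sj)
    linarith
  have k2 : 5 * b * E + E * 2 + 2 * (E * C) + 2 * E ≤ 20 * C * b ^ 2 * E := by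
    have : 5 * b + 2 + 2 * C + 2 ≤ 20 * C * b ^ 2 := by
      have a1 : b ^ 2 ≤ C * b ^ 2 := le_mul_of_one_le_left (sq_nonneg b) hC
      have a2 : C * b ≤ C * b ^ 2 := by gcongr
      have a3 : C ≤ C * b := le_mul_of_one_le_right (by linarith) hb1
      linarith
    have := mul_le_mul_of_nonneg_right this hE0
    linarith
  linarith

namespace Ctx
variable {n N : ℕ} [NeZero n] {θ β C : ℝ} {μ : Measure (EuclideanSpace ℝ (Fin n))} {lam : Measure ℝ} {W : Smp n → ℝ}

lemma cc_ge (h : Ctx n N θ β C μ lam W) {j : ℕ} (h1 : 1 ≤ j) (hj : j ≤ N) : (j:ℝ) ≤ cc n j := by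
  have := h.hN8
  have hj1 : (1:ℝ) ≤ j := by exact_mod_cast h1
  have hj2 : (j:ℝ) ≤ N := by exact_mod_cast hj
  have hj3 : (N:ℝ) + 8 ≤ n := by exact_mod_cast h.hN8
  unfold cc
  rw [le_div_iff₀ (by linarith)]
  nlinarith

lemma bj (h : Ctx n N θ β C μ lam W) {j : ℕ} (hj : j ≤ N) : β * n ≤ n - j := by
  have hj2 : (j:ℝ) ≤ N := by exact_mod_cast hj
  linarith [h.hb]

lemma cc_le (h : Ctx n N θ β C μ lam W) {j : ℕ} (hj : j ≤ N) : cc n j ≤ β⁻¹ * j := by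
  have := h.bj hj
  have hn : (0:ℝ) < n := by have := h.hN8; have : 0 < n := by omega
                            exact_mod_cast this
  have hβ := h.hβ
  have hp : 0 < β * n := by positivity
  unfold cc
  rw [div_le_iff₀ (by linarith)]
  calc (n:ℝ) * j = β⁻¹ * j * (β * n) := by field_simp
    _ ≤ β⁻¹ * j * (n - j + 1) := by gcongr; linarith

lemma cc_nonneg (h : Ctx n N θ β C μ lam W) {j : ℕ} (hj : j ≤ N) : 0 ≤ cc n j := by
  rcases Nat.eq_zero_or_pos j with h0 | h0
  · simp [h0, cc]
  · exact (Nat.cast_nonneg j).trans (h.cc_ge h0 hj)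

lemma bounds (h : Ctx n N θ β C μ lam W) : (0:ℝ) < n ∧ (1:ℝ) ≤ √n ∧ √(n:ℝ) ^ 2 = n ∧ 1 ≤ β⁻¹ := by
  have : 1 ≤ n := by have := h.hN8; omega
  have h1 : (1:ℝ) ≤ n := by exact_mod_cast this
  refine ⟨by linarith, ?_, Real.sq_sqrt (by linarith), (one_le_inv₀ h.hβ).2 h.hβ1⟩
  rw [Real.one_le_sqrt]; exact h1

lemma err_zero (h : Ctx n N θ β C μ lam W) : L1 (PP n lam) (errS θ W 0) C := by
  haveI := h.rep.prob
  have h1 := PP_L1 0 (h.good.h1 0 (by have := h.hN8; omega) (h.bj (Nat.zero_le _)))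
  simp only [CharP.cast_eq_zero, zero_add, Real.sqrt_one, mul_one] at h1
  refine h1.congr (ae_of_all _ fun ω => ?_)
  simp [errS, dq, cc]

/-- key error estimate -/
lemma err_bound (h : Ctx n N θ β C μ lam W) {j : ℕ} (h1j : 1 ≤ j) (hj : j < N) {D : ℝ} (hD : L1 (PP n lam) (fun ω => (dq W j ω).2 - cc n j) D) :
    L1 (PP n lam) (errS θ W j) (20 * C * β⁻¹ ^ 2 * (√j + √n * D / √j)) := by
  haveI := h.rep.prob
  obtain ⟨hn0, hn1, hnsq, hb1⟩ := h.bounds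
  have hC := h.hC
  have hβ := h.hβ
  have hj8 : j + 8 ≤ n := by have := h.hN8; omega
  have hm := hm8 hj8
  have hbj := h.bj hj.le
  have hW := h.rep.meas
  have hp := dq_past hW j
  have hc1 := h.cc_ge h1j hj.le
  have hc2 := h.cc_le hj.le
  have hj1 : (1:ℝ) ≤ j := by exact_mod_cast h1j
  have hjn : (j:ℝ) ≤ n := by linarith
  have hD0 := hD.nonneg
  have hc0 : 0 ≤ cc n j := by linarith
  have past : ∀ f : ℝ → ℝ, Measurable f → Past j (fun ω => f (dq W j ω).2) := by
    intro f hf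
    refine ⟨by have := hp.1; fun_prop, fun ω ω' hh => by
      show f (dq W j ω).2 = f (dq W j ω').2
      rw [hp.2 ω ω' hh]⟩
  have hq : L1 (PP n lam) (fun ω => (dq W j ω).2) (cc n j + D) := by
    have := (L1.const (P := PP n lam) (cc n j)).add hD
    rw [abs_of_nonneg hc0] at this
    refine this.congr (ae_of_all _ fun ω => ?_); simp
  have hsq : L1 (PP n lam) (fun ω => √(dq W j ω).2) (√(cc n j + D)) := by
    apply L2.l1
    apply L2.of_sq
    · have := hp.1; apply Measurable.aestronglyMeasurable; fun_prop
    · refine hq.congr (ae_of_all _ fun ω => ?_)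
      exact (Real.sq_sqrt (dq_nonneg W j ω)).symm
  have hds : L1 (PP n lam) (fun ω => √(dq W j ω).2 - √(cc n j)) ((√j)⁻¹ * D) := by
    have := hD.const_mul ((√j)⁻¹)
    rw [abs_of_nonneg (by positivity)] at this
    refine this.of_le (by have := hp.1; apply Measurable.aestronglyMeasurable; fun_prop) (ae_of_all _ fun ω => ?_)
    have hq0 := dq_nonneg W j ω
    rw [abs_mul, abs_of_nonneg (show 0 ≤ (√(j:ℝ))⁻¹ by positivity), ← div_eq_inv_mul, le_div_iff₀ (by positivity)]
    have e3 : (dq W j ω).2 - cc n j = (√(dq W j ω).2 - √(cc n j)) * (√(dq W j ω).2 + √(cc n j)) := by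
      nlinarith [Real.sq_sqrt hq0, Real.sq_sqrt hc0]
    rw [e3, abs_mul]
    apply mul_le_mul_of_nonneg_left _ (abs_nonneg _)
    rw [abs_of_nonneg (by positivity)]
    linarith [Real.sqrt_nonneg (dq W j ω).2, Real.sqrt_le_sqrt hc1]
  have t1 := PP_L1 j (h.good.h1 j hj8 hbj)
  have t2 := PP_past_mul (past (fun x => x) (by fun_prop)) (X := fun s => (av j s - 1) * s.1 0 ^ 2) (by fun_prop) hq ((kap_L2 (lam := lam) (ga1_L2 hj8)).mul kap_g2_L2)
  have t3 := PP_past_mul (past (fun x => x - cc n j) (by fun_prop)) (X := fun s => s.1 0 ^ 2 - 1) (by fun_prop) hD kap_g1_L2.l1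
  have t4 := (PP_past_mul (past (fun x => √x) (by fun_prop)) (X := fun s => (av j s * W s - √n) * s.1 0) (by fun_prop) hsq ((h.good.h2 j hj8 hbj).mul kap_g_L2)).const_mul 2
  have t5 := (PP_past_mul (past (fun x => √x - √(cc n j)) (by fun_prop)) (X := fun s => s.1 0) (by fun_prop) hds kap_g_L2.l1).const_mul (2 * √n)
  refine ((((t1.add t2).add t3).sub t4).sub t5).mono ?_
  exact err_num (by linarith) hm hb1 hC hβ hbj hj1 hD0 hc0 hc2

lemma main_L2 (h : Ctx n N θ β C μ lam W) {j : ℕ} (hj : j < N) : L2 (kap n lam) (mainS θ j) (32 * β⁻¹ ^ 2 * n * (j + 1)) := by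
  haveI := h.rep.prob
  obtain ⟨hn0, hn1, hnsq, hb1⟩ := h.bounds
  have hj8 : j + 8 ≤ n := by have := h.hN8; omega
  have hm := hm8 hj8
  have hj0 : (0:ℝ) ≤ j := Nat.cast_nonneg j
  have hbj := h.bj hj.le
  have hc0 := h.cc_nonneg hj.le
  have hc2 := h.cc_le hj.le
  have hβ := h.hβ
  have t1 := (xv_L2 (lam := lam) (show j < n by omega)).const_mul (-(1 - θ) * n)
  have t2 := (kap_g1_L2 (n := n) (lam := lam)).const_mul (cc n j)
  have t3 := (kap_g_L2 (n := n) (lam := lam)).const_mul (2 * √n * √(cc n j))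
  refine ((t1.add t2).sub t3).mono ?_
  have e1 : (-(1 - θ) * n) ^ 2 * (2 / ((n:ℝ) - j)) ≤ 2 * β⁻¹ * n := by
    have : (1 - θ) ^ 2 ≤ 1 := by nlinarith [h.hθ, h.hθ1]
    calc (-(1 - θ) * n) ^ 2 * (2 / ((n:ℝ) - j)) = (1 - θ) ^ 2 * (n ^ 2 * (2 / ((n:ℝ) - j))) := by ring
      _ ≤ 1 * (n ^ 2 * (2 / (β * n))) := by
        have : 0 < β * (n:ℝ) := by positivity
        gcongr
      _ = _ := by field_simp
  have e2 : cc n j ^ 2 * 2 ≤ 2 * β⁻¹ ^ 2 * (j * n) := by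
    calc cc n j ^ 2 * 2 ≤ (β⁻¹ * j) ^ 2 * 2 := by gcongr
      _ = 2 * β⁻¹ ^ 2 * (j * j) := by ring
      _ ≤ _ := by gcongr; linarith
  have e3 : (2 * √n * √(cc n j)) ^ 2 * 1 ≤ 4 * β⁻¹ * (j * n) := by
    rw [mul_pow, mul_pow, hnsq, Real.sq_sqrt hc0]
    nlinarith
  have hb2 : β⁻¹ ≤ β⁻¹ ^ 2 := by nlinarith
  have hnj : 0 ≤ (j:ℝ) * n := by positivity
  have f1 : 2 * β⁻¹ * n ≤ 2 * β⁻¹ ^ 2 * n := by gcongr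
  have f2 : 4 * β⁻¹ * (j * n) ≤ 4 * β⁻¹ ^ 2 * (j * n) := by gcongr
  have f3 : 0 ≤ β⁻¹ ^ 2 * (j * n) := by positivity
  have f4 : 0 ≤ β⁻¹ ^ 2 * n := by positivity
  nlinarith

lemma main_mean (h : Ctx n N θ β C μ lam W) {j : ℕ} (hj : j < N) : ∫ s, mainS θ j s ∂kap n lam = 0 := by
  haveI := h.rep.prob
  have hj8 : j + 8 ≤ n := by have := h.hN8; omega
  have i1 : Integrable (xv (n := n) j) (kap n lam) := (xv_L2 (lam := lam) (show j < n by omega)).l1.1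
  have i2 := (kap_g1_L2 (n := n) (lam := lam)).l1.1
  have i3 := (kap_g_L2 (n := n) (lam := lam)).l1.1
  unfold mainS
  rw [integral_sub, integral_add, integral_const_mul, integral_const_mul, integral_const_mul, xv_mean (by omega), kap_g1_mean, kap_g_mean]
  · ring
  · exact i1.const_mul _
  · exact i2.const_mul _
  · exact (i1.const_mul _).add (i2.const_mul _)
  · exact i3.const_mul _

lemma main_meas (j : ℕ) : Measurable (mainS (n := n) θ j) := by
  have := measurable_xv (n := n) j
  unfold mainS
  fun_prop

lemma main_sum (h : Ctx n N θ β C μ lam W) {j : ℕ} (hj : j ≤ N) :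
    L1 (PP n lam) (fun ω => ∑ i ∈ Finset.range j, mainS θ i (ω i)) (6 * β⁻¹ * √n * j) := by
  haveI := h.rep.prob
  obtain ⟨hn0, hn1, hnsq, hb1⟩ := h.bounds
  have := (PP_sum_L2 (lam := lam) (N := j) (X := mainS θ) (v := fun i => 32 * β⁻¹ ^ 2 * n * (i + 1)) (fun i hi => h.main_L2 (by omega)) (fun i _ => main_meas i) (fun i hi => h.main_mean (by omega))).l1
  refine this.mono ?_
  apply Real.sqrt_le_iff.2
  refine ⟨by positivity, ?_⟩
  calc ∑ i ∈ Finset.range j, 32 * β⁻¹ ^ 2 * n * ((i:ℝ) + 1) ≤ ∑ i ∈ Finset.range j, 32 * β⁻¹ ^ 2 * n * (j:ℝ) := by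
        apply Finset.sum_le_sum; intro i hi
        have : ((i:ℝ) + 1) ≤ j := by exact_mod_cast Finset.mem_range.1 hi
        gcongr
    _ = 32 * β⁻¹ ^ 2 * n * j ^ 2 := by rw [Finset.sum_const, Finset.card_range, nsmul_eq_mul]; ring
    _ ≤ 36 * β⁻¹ ^ 2 * n * j ^ 2 := by gcongr; norm_num
    _ = _ := by rw [mul_pow, mul_pow, mul_pow, hnsq]; ring
end Ctx

end

section
open MeasureTheory ProbabilityTheory Real Filter Finset
set_option linter.all false

lemma sqrt_succ_sub {x : ℝ} (hx : 1 ≤ x) : 1 / (3 * √x) ≤ √(x + 1) - √x := by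
  have h0 : 0 < √x := Real.sqrt_pos.2 (by linarith)
  have h1 : √x + 1 / (3 * √x) ≤ √(x + 1) := by
    apply Real.le_sqrt_of_sq_le
    have hs := Real.sq_sqrt (show 0 ≤ x by linarith)
    have : (√x + 1 / (3 * √x)) ^ 2 = √x ^ 2 + 2 / 3 + 1 / (9 * √x ^ 2) := by field_simp; ring
    rw [this, hs]
    have : 1 / (9 * x) ≤ 1 / 9 := by apply one_div_le_one_div_of_le <;> linarith
    linarith
  linarith

/-- the comparison function in the Gronwall estimate -/
noncomputable def gf (κ sn : ℝ) (j : ℕ) : ℝ := j * Real.exp (κ * √j / sn)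

lemma gf_sum {κ sn : ℝ} (hκ : 0 < κ) (hsn : 0 < sn) (j : ℕ) :
    ∑ i ∈ Finset.range j, √i * Real.exp (κ * √i / sn) ≤ 3 * sn / κ * gf κ sn j := by
  induction j with
  | zero => simp [gf]
  | succ j ih =>
    rw [Finset.sum_range_succ]
    suffices √j * Real.exp (κ * √j / sn) ≤ 3 * sn / κ * (gf κ sn (j+1) - gf κ sn j) by linarith
    rcases Nat.eq_zero_or_pos j with h0 | h0
    · subst h0; simp [gf]; positivity
    have hj1 : (1:ℝ) ≤ j := by exact_mod_cast h0
    have hs := sqrt_succ_sub hj1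
    have hs0 : 0 < √(j:ℝ) := Real.sqrt_pos.2 (by linarith)
    have e1 : gf κ sn j + j * Real.exp (κ * √j / sn) * (κ / (3 * √j * sn)) ≤ gf κ sn (j+1) := by
      unfold gf
      push_cast
      have : Real.exp (κ * √j / sn) * (1 + κ / (3 * √j * sn)) ≤ Real.exp (κ * √(j+1) / sn) := by
        calc _ ≤ Real.exp (κ * √j / sn) * Real.exp (κ / (3 * √j * sn)) := by
              gcongr; linarith [Real.add_one_le_exp (κ / (3 * √j * sn))]
          _ = Real.exp (κ / sn * (√j + 1 / (3 * √j))) := by rw [← Real.exp_add]; congr 1; field_simp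
          _ ≤ Real.exp (κ / sn * √(j+1)) := by gcongr; linarith
          _ = _ := by congr 1; ring
      have h2 := mul_le_mul_of_nonneg_left this (by linarith : (0:ℝ) ≤ j)
      have h3 := Real.exp_pos (κ * √((j:ℝ)+1) / sn)
      nlinarith
    calc √j * Real.exp (κ * √j / sn) = 3 * sn / κ * (j * Real.exp (κ * √j / sn) * (κ / (3 * √j * sn))) := by
          have := Real.sq_sqrt (show (0:ℝ) ≤ j by linarith)
          field_simp
          rw [this]
      _ ≤ _ := by gcongr; linarith

/-- constants -/
noncomputable def cE (β C : ℝ) : ℝ := 20 * C * β⁻¹ ^ 2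
noncomputable def cA (β C : ℝ) : ℝ := 2 * β⁻¹ * (6 * β⁻¹ + C + cE β C)
noncomputable def cK (β C : ℝ) : ℝ := cA β C * Real.exp (3 * cA β C)
noncomputable def cF (β C : ℝ) : ℝ := C + cE β C * (1 + cK β C)

namespace Ctx
variable {n N : ℕ} [NeZero n] {θ β C : ℝ} {μ : Measure (EuclideanSpace ℝ (Fin n))} {lam : Measure ℝ} {W : Smp n → ℝ}

lemma cE_pos (h : Ctx n N θ β C μ lam W) : 0 < cE β C := by
  have := h.hβ; have := h.hC
  unfold cE; positivity
lemma cA_pos (h : Ctx n N θ β C μ lam W) : 0 < cA β C := by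
  have := h.hβ; have := h.hC; have := h.cE_pos
  unfold cA; positivity
lemma cK_pos (h : Ctx n N θ β C μ lam W) : 0 < cK β C := by
  have := h.cA_pos
  unfold cK; positivity
lemma cF_pos (h : Ctx n N θ β C μ lam W) : 0 < cF β C := by
  have := h.hC; have := h.cE_pos; have := h.cK_pos
  unfold cF; positivity

lemma err_bound' (h : Ctx n N θ β C μ lam W) {i : ℕ} (hi : i < N)
    (hD : L1 (PP n lam) (fun ω => (dq W i ω).2 - cc n i) (cA β C / √n * gf (3 * cA β C) (√n) i)) :
    L1 (PP n lam) (errS θ W i) (C + cE β C * (√i + cA β C * (√i * Real.exp (3 * cA β C * √i / √n)))) := by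
  obtain ⟨hn0, hn1, hnsq, hb1⟩ := h.bounds
  have hE := h.cE_pos
  have hA := h.cA_pos
  have hC := h.hC
  rcases Nat.eq_zero_or_pos i with h0 | h0
  · subst h0
    refine h.err_zero.mono ?_
    simp
  · refine (h.err_bound h0 hi hD).mono ?_
    have hs0 : 0 < √(i:ℝ) := Real.sqrt_pos.2 (by exact_mod_cast h0)
    have : √n * (cA β C / √n * gf (3 * cA β C) (√n) i) / √i = cA β C * (√i * Real.exp (3 * cA β C * √i / √n)) := by
      unfold gf
      have := Real.sq_sqrt (show (0:ℝ) ≤ i by positivity)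
      field_simp
      rw [this]
    rw [this]
    show cE β C * _ ≤ _
    linarith

lemma gron (h : Ctx n N θ β C μ lam W) (j : ℕ) : j ≤ N →
    L1 (PP n lam) (fun ω => (dq W j ω).2 - cc n j) (cA β C / √n * gf (3 * cA β C) (√n) j) := by
  induction j using Nat.strong_induction_on with
  | _ j ih =>
  intro hj
  obtain ⟨hn0, hn1, hnsq, hb1⟩ := h.bounds
  have hE := h.cE_pos
  have hA := h.cA_pos
  have hC := h.hC
  have hβ := h.hβ
  have hbj := h.bj hj
  have hjN : (j:ℝ) ≤ N := by exact_mod_cast hj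
  have hNn : (N:ℝ) + 8 ≤ n := by exact_mod_cast h.hN8
  have herr := L1.sum (s := Finset.range j) (X := errS θ W) (a := fun i => C + cE β C * (√i + cA β C * (√i * Real.exp (3 * cA β C * √i / √n))))
    (fun i hi => by
      have hi := Finset.mem_range.1 hi
      exact h.err_bound' (by omega) (ih i hi (by omega)))
  have hs := ((h.main_sum hj).add herr).const_mul (((n:ℝ) - j + 1)⁻¹)
  have hp : (0:ℝ) < n - j + 1 := by linarith
  have hg : (j:ℝ) ≤ gf (3 * cA β C) (√n) j := by
    unfold gf
    have : 1 ≤ Real.exp (3 * cA β C * √j / √n) := Real.one_le_exp (by positivity)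
    have : (0:ℝ) ≤ j := by positivity
    nlinarith
  refine (hs.congr (ae_of_all _ fun ω => ?_)).mono ?_
  · show _ = (dq W j ω).2 - cc n j
    beta_reduce
    rw [← q_sum θ W (by have := h.hN8; omega) ω]; field_simp
  rw [abs_of_pos (by positivity), Finset.sum_add_distrib, ← Finset.mul_sum, Finset.sum_add_distrib, ← Finset.mul_sum]
  have s1 : ∑ i ∈ Finset.range j, √(i:ℝ) ≤ j * √n := by
    calc _ ≤ ∑ i ∈ Finset.range j, √(n:ℝ) := by
          apply Finset.sum_le_sum; intro i hi
          apply Real.sqrt_le_sqrt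
          have : (i:ℝ) < j := by exact_mod_cast Finset.mem_range.1 hi
          linarith
      _ = _ := by simp
  have s2 := gf_sum (κ := 3 * cA β C) (sn := √n) (by positivity) (by positivity) j
  set G := gf (3 * cA β C) (√n) j with hG
  have hG0 : 0 ≤ G := le_trans (by positivity) hg
  have s3 : ∑ i ∈ Finset.range j, C ≤ C * (j * √n) := by
    simp
    have : (0:ℝ) ≤ j * C := by positivity
    nlinarith
  have hsn0 : 0 < √(n:ℝ) := by linarith
  have s4 : cA β C * ∑ i ∈ Finset.range j, √(i:ℝ) * Real.exp (3 * cA β C * √i / √n) ≤ √n * G := by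
    calc _ ≤ cA β C * (3 * √n / (3 * cA β C) * G) := by gcongr
      _ = _ := by field_simp
  calc ((n:ℝ) - j + 1)⁻¹ * (6 * β⁻¹ * √n * j + (∑ i ∈ Finset.range j, C + cE β C * (∑ i ∈ Finset.range j, √(i:ℝ) + cA β C * ∑ i ∈ Finset.range j, √(i:ℝ) * Real.exp (3 * cA β C * √i / √n))))
      ≤ (β * n)⁻¹ * (6 * β⁻¹ * √n * G + (C * (G * √n) + cE β C * (G * √n + √n * G))) := by
        have q1 : j * √n ≤ G * √n := by gcongr
        have q2 : ∑ i ∈ Finset.range j, C ≤ C * (G * √n) := s3.trans (by gcongr)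
        have q3 := s1.trans q1
        have q5 : 0 ≤ ∑ i ∈ Finset.range j, √(i:ℝ) := Finset.sum_nonneg fun i _ => by positivity
        have q6 : 0 ≤ ∑ i ∈ Finset.range j, √(i:ℝ) * Real.exp (3 * cA β C * √i / √n) := Finset.sum_nonneg fun i _ => by positivity
        have q7 : 0 ≤ ∑ i ∈ Finset.range j, C := Finset.sum_nonneg fun i _ => by positivity
        gcongr
        linarith
    _ ≤ (β * n)⁻¹ * (√n * G * (2 * (6 * β⁻¹ + C + cE β C))) := by
        gcongr
        have : 0 ≤ √n * G := by positivity
        have : 0 ≤ (√n * G) * (6 * β⁻¹ + C) := by positivity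
        nlinarith
    _ = cA β C / √n * G := by
        unfold cA
        rw [mul_inv, ← hnsq]
        rw [Real.sqrt_sq (by positivity)]
        field_simp

lemma delta_bound (h : Ctx n N θ β C μ lam W) {j : ℕ} (hj : j ≤ N) :
    L1 (PP n lam) (fun ω => (dq W j ω).2 - cc n j) (cK β C / √n * j) := by
  refine (h.gron j hj).mono ?_
  obtain ⟨hn0, hn1, hnsq, hb1⟩ := h.bounds
  have hA := h.cA_pos
  have hjn : (j:ℝ) ≤ n := by
    have := h.hN8
    have : j ≤ n := by omega
    exact_mod_cast this
  have hs := Real.sqrt_le_sqrt hjn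
  unfold cK gf
  have : Real.exp (3 * cA β C * √j / √n) ≤ Real.exp (3 * cA β C) := by
    apply Real.exp_le_exp.2
    rw [div_le_iff₀ (by positivity)]; gcongr
  calc _ ≤ cA β C / √n * (j * Real.exp (3 * cA β C)) := by gcongr
    _ = _ := by ring

lemma err_final (h : Ctx n N θ β C μ lam W) {i : ℕ} (hi : i < N) :
    L1 (PP n lam) (errS θ W i) (cF β C * √N) := by
  refine (h.err_bound' hi (h.gron i hi.le)).mono ?_
  obtain ⟨hn0, hn1, hnsq, hb1⟩ := h.bounds
  have hA := h.cA_pos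
  have hE := h.cE_pos
  have hC := h.hC
  have hK := h.cK_pos
  have hjn : (i:ℝ) ≤ n := by
    have := h.hN8
    have : i ≤ n := by omega
    exact_mod_cast this
  have hjN : (i:ℝ) ≤ N := by exact_mod_cast hi.le
  have hN1 : 1 ≤ √(N:ℝ) := by
    rw [Real.one_le_sqrt]
    have := h.hN
    exact_mod_cast (by omega : 1 ≤ N)
  have hs := Real.sqrt_le_sqrt hjn
  have hs' := Real.sqrt_le_sqrt hjN
  have : Real.exp (3 * cA β C * √i / √n) ≤ Real.exp (3 * cA β C) := by
    apply Real.exp_le_exp.2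
    rw [div_le_iff₀ (by positivity)]; gcongr
  calc _ ≤ C * √N + cE β C * (√N + cA β C * (√N * Real.exp (3 * cA β C))) := by
        gcongr
        nlinarith
    _ = _ := by unfold cF cK; ring

end Ctx

end

section
open MeasureTheory ProbabilityTheory Real Filter Finset
set_option linter.all false

/-- full quadratic coefficients -/
noncomputable def cfull (n N : ℕ) (θ : ℝ) (j : ℕ) (k : Fin n) : ℝ :=
  (if j ≤ (k:ℕ) then (1 - (1 - θ) / N) * ((n:ℝ) - j)⁻¹ else 0) - θ * (n:ℝ)⁻¹
/-- quadratic coefficients off the first coordinate -/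
noncomputable def cY (n N : ℕ) [NeZero n] (θ : ℝ) (j : ℕ) (k : Fin n) : ℝ := if k = 0 then 0 else cfull n N θ j k
/-- linear coefficient -/
noncomputable def dY (n N : ℕ) (j : ℕ) : ℝ := - (2 * √(cc n j) / (√n * N))
/-- main random term -/
noncomputable def YY (n N : ℕ) [NeZero n] (θ : ℝ) (j : ℕ) (s : Smp n) : ℝ := Qf (cY n N θ j) s.1 + dY n N j * s.1 0

lemma cfull_Qf {n N : ℕ} [NeZero n] (θ : ℝ) {j : ℕ} (hj : j < n) (s : Smp n) :
    (1 - (1 - θ) / N) * xv j s - θ * xv 0 s = Qf (cY n N θ j) s.1 + cfull n N θ j 0 * (s.1 0 ^ 2 - 1) := by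
  have e : Qf (cfull n N θ j) s.1 = Qf (cY n N θ j) s.1 + cfull n N θ j 0 * (s.1 0 ^ 2 - 1) := by
    unfold Qf
    rw [← Finset.add_sum_erase _ _ (Finset.mem_univ (0 : Fin n)), ← Finset.add_sum_erase _ (fun k => cY n N θ j k * _) (Finset.mem_univ (0 : Fin n))]
    have : ∑ x ∈ univ.erase (0 : Fin n), cfull n N θ j x * (s.1 x ^ 2 - 1) = ∑ x ∈ univ.erase (0 : Fin n), cY n N θ j x * (s.1 x ^ 2 - 1) := by
      apply Finset.sum_congr rfl; intro x hx
      simp [cY, Finset.ne_of_mem_erase hx]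
    rw [this]
    simp [cY]; ring
  rw [← e, xv_eq_Qf hj, xv_eq_Qf (by omega : 0 < n)]
  unfold Qf cfull
  rw [Finset.mul_sum, Finset.mul_sum, ← Finset.sum_sub_distrib]
  apply Finset.sum_congr rfl; intro k _
  by_cases hh : j ≤ (k:ℕ) <;> simp [hh] <;> ring

/-- logarithmic remainder -/
noncomputable def RR {n : ℕ} (θ : ℝ) (W : Smp n → ℝ) (j : ℕ) (s : Smp n) : ℝ :=
  (Real.log (Ac j s / (n - j)) - (Ac j s / (n - j) - 1)) - (Real.log (W s ^ 2) - Real.log n - θ * xv 0 s)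

/-- centred error summand -/
noncomputable def ZZ {n : ℕ} [NeZero n] (N : ℕ) (θ : ℝ) (lam : Measure ℝ) (W : Smp n → ℝ) (j : ℕ) (s : Smp n) : ℝ :=
  (RR θ W j s - ∫ s, RR θ W j s ∂kap n lam) + (cc n j / (n * N) + cfull n N θ j 0) * (s.1 0 ^ 2 - 1)

noncomputable def cR (β C : ℝ) : ℝ := 2 * (2 * (40 * β⁻¹ ^ 2 + C) + (β⁻¹ + 2) ^ 2 * 2)
noncomputable def cZ (β C : ℝ) : ℝ := √(cR β C) + cF β C + cK β C

namespace Ctx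
variable {n N : ℕ} [NeZero n] {θ β C : ℝ} {μ : Measure (EuclideanSpace ℝ (Fin n))} {lam : Measure ℝ} {W : Smp n → ℝ}

lemma RR_meas (h : Ctx n N θ β C μ lam W) (j : ℕ) : Measurable (RR θ W j) := by
  have := h.rep.meas
  have := measurable_xv (n := n) 0
  unfold RR; fun_prop

lemma ZZ_meas (h : Ctx n N θ β C μ lam W) (j : ℕ) : Measurable (ZZ N θ lam W j) := by
  have := h.RR_meas j
  unfold ZZ; fun_prop

lemma RR_L2 (h : Ctx n N θ β C μ lam W) {j : ℕ} (hj : j < N) : L2 (kap n lam) (RR θ W j) (2 * (40 * β⁻¹ ^ 2 + C) / n ^ 2) := by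
  haveI := h.rep.prob
  obtain ⟨hn0, hn1, hnsq, hb1⟩ := h.bounds
  have hβ := h.hβ
  have hj8 : j + 8 ≤ n := by have := h.hN8; omega
  have hbj := h.bj hj.le
  refine ((kap_L2 (lam := lam) (glog_L2 hj8)).sub h.good.h3).mono ?_
  have : 40 / ((n:ℝ) - j) ^ 2 ≤ 40 / (β * n) ^ 2 := by gcongr
  calc 2 * (40 / ((n:ℝ) - j) ^ 2 + C / n ^ 2) ≤ 2 * (40 / (β * n) ^ 2 + C / n ^ 2) := by gcongr
    _ = _ := by field_simp

lemma cf0 (h : Ctx n N θ β C μ lam W) {j : ℕ} (hj : j < N) : |cc n j / (n * N) + cfull n N θ j 0| ≤ (β⁻¹ + 2) / n := by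
  obtain ⟨hn0, hn1, hnsq, hb1⟩ := h.bounds
  have hN : (2:ℝ) ≤ N := by exact_mod_cast h.hN
  have hc0 := h.cc_nonneg hj.le
  have hc2 := h.cc_le hj.le
  have hjN : (j:ℝ) ≤ N := by exact_mod_cast hj.le
  have h1 : |cc n j / (n * N)| ≤ β⁻¹ / n := by
    rw [abs_of_nonneg (by positivity), div_le_div_iff₀ (by positivity) hn0]
    have : cc n j ≤ β⁻¹ * N := hc2.trans (by have := h.hβ; gcongr)
    nlinarith
  have h2 : |cfull n N θ j 0| ≤ 2 / n := by
    have hθ := h.hθ; have hθ1 := h.hθ1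
    have hu : |1 - (1 - θ) / N| ≤ 1 := by
      have : 0 ≤ (1 - θ) / N := div_nonneg (by linarith) (by linarith)
      have : (1 - θ) / N ≤ 1 := by rw [div_le_one (by linarith)]; linarith
      rw [abs_of_nonneg] <;> linarith
    have e1 : |(if j ≤ ((0 : Fin n):ℕ) then (1 - (1 - θ) / N) * ((n:ℝ) - j)⁻¹ else 0)| ≤ (n:ℝ)⁻¹ := by
      split_ifs with hh
      · have : j = 0 := by simpa using hh
        subst this
        simp only [CharP.cast_eq_zero, sub_zero, abs_mul]
        rw [abs_of_pos (inv_pos.2 hn0)]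
        have : 0 < (n:ℝ)⁻¹ := inv_pos.2 hn0
        nlinarith
      · simp
    have e2 : |θ * (n:ℝ)⁻¹| ≤ (n:ℝ)⁻¹ := by
      rw [abs_mul, abs_of_nonneg hθ, abs_of_pos (inv_pos.2 hn0)]
      have : 0 < (n:ℝ)⁻¹ := inv_pos.2 hn0
      nlinarith
    unfold cfull
    refine (abs_sub _ _).trans ?_
    rw [div_eq_mul_inv 2]; linarith
  refine (abs_add_le _ _).trans ?_
  rw [add_div]; linarith

lemma ZZ_L2 (h : Ctx n N θ β C μ lam W) {j : ℕ} (hj : j < N) : L2 (kap n lam) (ZZ N θ lam W j) (cR β C / n ^ 2) := by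
  haveI := h.rep.prob
  refine ((h.RR_L2 hj).center.add (kap_g1_L2.const_mul (cc n j / (n * N) + cfull n N θ j 0))).mono ?_
  have := h.cf0 hj
  have h2 : (cc n j / (n * N) + cfull n N θ j 0) ^ 2 ≤ ((β⁻¹ + 2) / n) ^ 2 := by
    rw [← sq_abs]; gcongr
  unfold cR
  calc _ ≤ 2 * (2 * (40 * β⁻¹ ^ 2 + C) / n ^ 2 + ((β⁻¹ + 2) / n) ^ 2 * 2) := by gcongr
    _ = _ := by ring

lemma ZZ_mean (h : Ctx n N θ β C μ lam W) {j : ℕ} (hj : j < N) : ∫ s, ZZ N θ lam W j s ∂kap n lam = 0 := by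
  haveI := h.rep.prob
  unfold ZZ
  have i1 := (h.RR_L2 hj).l1.1
  have i2 := (kap_g1_L2 (n := n) (lam := lam)).l1.1
  rw [integral_add (f := fun s => RR θ W j s - ∫ s, RR θ W j s ∂kap n lam) (i1.sub (integrable_const _)) (i2.const_mul _), integral_sub i1 (integrable_const _), integral_const_mul, kap_g1_mean]
  simp

/-- relative fluctuation of `q` -/
noncomputable def Del (n N : ℕ) [NeZero n] (W : Smp n → ℝ) (ω : ℕ → Smp n) : ℝ := ((dq W N ω).2 - cc n N) / cc n N

/-- total error -/
noncomputable def Err (n N : ℕ) [NeZero n] (θ : ℝ) (lam : Measure ℝ) (W : Smp n → ℝ) (ω : ℕ → Smp n) : ℝ :=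
  ∑ j ∈ Finset.range N, ZZ N θ lam W j (ω j) + ((n:ℝ) * N)⁻¹ * ∑ j ∈ Finset.range N, errS θ W j ω

/-- deterministic centering -/
noncomputable def Kc (n N : ℕ) [NeZero n] (θ : ℝ) (lam : Measure ℝ) (W : Smp n → ℝ) : ℝ :=
  ∑ j ∈ Finset.range N, (Real.log ((n:ℝ) - j) - Real.log n + ∫ s, RR θ W j s ∂kap n lam) + Real.log (cc n N)

lemma cZ_bounds (h : Ctx n N θ β C μ lam W) : √(cR β C) + cF β C ≤ cZ β C ∧ cK β C ≤ cZ β C ∧ 0 < cZ β C := by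
  have := h.cF_pos; have := h.cK_pos
  have := Real.sqrt_nonneg (cR β C)
  unfold cZ
  refine ⟨?_, ?_, ?_⟩ <;> linarith

lemma Err_L1 (h : Ctx n N θ β C μ lam W) : L1 (PP n lam) (Err n N θ lam W) (cZ β C * √N / n) := by
  haveI := h.rep.prob
  obtain ⟨hn0, hn1, hnsq, hb1⟩ := h.bounds
  have hN : (2:ℝ) ≤ N := by exact_mod_cast h.hN
  have a1 := (PP_sum_L2 (lam := lam) (N := N) (X := ZZ N θ lam W) (v := fun i => cR β C / n ^ 2) (fun i hi => h.ZZ_L2 hi) (fun i _ => h.ZZ_meas i) (fun i hi => h.ZZ_mean hi)).l1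
  have a2 := (L1.sum (s := Finset.range N) (X := errS θ W) (fun i hi => h.err_final (Finset.mem_range.1 hi))).const_mul (((n:ℝ) * N)⁻¹)
  refine (a1.add a2).mono ?_
  rw [abs_of_nonneg (by positivity)]
  simp only [Finset.sum_const, Finset.card_range, nsmul_eq_mul]
  have e1 : √(N * (cR β C / n ^ 2)) = √(cR β C) * √N / n := by
    rw [show (N:ℝ) * (cR β C / n ^ 2) = N * cR β C / n ^ 2 by ring, Real.sqrt_div' _ (by positivity), Real.sqrt_mul (by positivity), Real.sqrt_sq hn0.le]; ring
  rw [e1]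
  calc _ = (√(cR β C) + cF β C) * √N / n := by field_simp
    _ ≤ _ := by have := h.cZ_bounds.1; gcongr

lemma Del_L1 (h : Ctx n N θ β C μ lam W) : L1 (PP n lam) (Del n N W) (cZ β C / √n) := by
  obtain ⟨hn0, hn1, hnsq, hb1⟩ := h.bounds
  have hN : (2:ℝ) ≤ N := by exact_mod_cast h.hN
  have hc1 := h.cc_ge (by have := h.hN; omega) le_rfl
  have hK := h.cK_pos
  have a := (h.delta_bound le_rfl).const_mul ((cc n N)⁻¹)
  refine (a.congr (ae_of_all _ fun ω => ?_)).mono ?_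
  · show _ = ((dq W N ω).2 - cc n N) / cc n N
    rw [div_eq_inv_mul]
  rw [abs_of_nonneg (inv_nonneg.2 (by linarith)), ← div_eq_inv_mul, div_le_iff₀ (by linarith)]
  have := h.cZ_bounds.2.1
  have := h.cZ_bounds.2.2
  gcongr

lemma dq_log (h : Ctx n N θ β C μ lam W) : ∀ᵐ ω ∂PP n lam, (∀ j, j ≤ n → 0 < (dq W j ω).1) ∧ (∀ j, 1 ≤ j → 0 < (dq W j ω).2) ∧ (∀ j < n, 0 < Ac j (ω j)) ∧ (∀ j, 0 < W (ω j)) := by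
  haveI := h.rep.prob
  have h1 : ∀ᵐ ω ∂PP n lam, ∀ j, j ≤ n → 0 < (dq W j ω).1 := by
    rw [ae_all_iff]; intro j
    rw [ae_all_iff]; intro hj
    exact dq_pos h.rep hj
  have h2 : ∀ᵐ ω ∂PP n lam, ∀ j, 0 < W (ω j) := by
    rw [ae_all_iff]; intro j
    exact PP_ae j h.rep.pos
  have h3 : ∀ᵐ ω ∂PP n lam, ∀ j, j < n → 0 < Ac j (ω j) := by
    rw [ae_all_iff]; intro j
    rw [ae_all_iff]; intro hj
    exact PP_ae j (Ac_pos lam hj)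
  filter_upwards [h1, h2, h3] with ω h1 h2 h3
  refine ⟨h1, fun j hj => ?_, h3, h2⟩
  induction j, hj using Nat.le_induction with
  | base =>
    simp only [dq, stepF]
    have a := h3 0 (by have := h.hN8; omega)
    have b := h2 0
    simp only [Real.sqrt_zero, zero_mul, sub_zero, zero_add]
    positivity
  | succ j hj ih => exact ih.trans_le (dq_mono W j ω)

/-- the expansion of the logarithm of the squared volume -/
theorem expansion (h : Ctx n N θ β C μ lam W) : ∀ᵐ ω ∂PP n lam, 0 < 1 + Del n N W ω ∧ 0 < (dq W N ω).1 * (dq W N ω).2 ∧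
    Real.log ((dq W N ω).1 * (dq W N ω).2) = Kc n N θ lam W + ∑ j ∈ Finset.range N, YY n N θ j (ω j) + Err n N θ lam W ω + (Real.log (1 + Del n N W ω) - Del n N W ω) := by
  obtain ⟨hn0, hn1, hnsq, hb1⟩ := h.bounds
  have hN : (2:ℝ) ≤ N := by exact_mod_cast h.hN
  have hN8 := h.hN8
  have hNn : (N:ℝ) + 8 ≤ n := by exact_mod_cast h.hN8
  have hc1 := h.cc_ge (by have := h.hN; omega) le_rfl
  have hc0 : 0 < cc n N := by linarith
  filter_upwards [h.dq_log] with ω ⟨p1, p2, p3, p4⟩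
  have hd := p1 N (by omega)
  have hq := p2 N (by have := h.hN; omega)
  have hD : 1 + Del n N W ω = (dq W N ω).2 / cc n N := by unfold Del; field_simp; ring
  refine ⟨by rw [hD]; positivity, by positivity, ?_⟩
  have ld : ∀ j, j ≤ N → Real.log (dq W j ω).1 = ∑ i ∈ Finset.range j, (Real.log ((n:ℝ) - i) - Real.log n + xv i (ω i) - θ * xv 0 (ω i) + RR θ W i (ω i)) := by
    intro j
    induction j with
    | zero => intro _; simp [dq]
    | succ j ih =>
      intro hj
      rw [Finset.sum_range_succ, ← ih (by omega)]
      have hA := p3 j (by omega)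
      have hW := p4 j
      have hjn : (j:ℝ) < n := by exact_mod_cast (by omega : j < n)
      have hW2 : W (ω j) ^ 2 ≠ 0 := by positivity
      simp only [dq, stepF]
      rw [Real.log_mul (p1 j (by omega)).ne' (by positivity), Real.log_div hA.ne' hW2]
      unfold RR
      rw [Real.log_div hA.ne' (by linarith)]
      unfold xv
      ring
  rw [Real.log_mul hd.ne' hq.ne', ld N le_rfl]
  have lq : Real.log (dq W N ω).2 = Real.log (cc n N) + Real.log (1 + Del n N W ω) := by
    rw [hD, ← Real.log_mul hc0.ne' (by positivity)]; congr 1; field_simp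
  have hDel : Del n N W ω = ((n:ℝ) * N)⁻¹ * (∑ i ∈ Finset.range N, mainS θ i (ω i) + ∑ i ∈ Finset.range N, errS θ W i ω) := by
    rw [← q_sum θ W (by omega) ω]
    unfold Del
    have : cc n N * (n - N + 1) = n * N := by
      unfold cc; field_simp
      rw [div_self]; linarith
    rw [← this]
    have : (n:ℝ) - N + 1 ≠ 0 := by linarith
    field_simp
  rw [lq]
  suffices ∑ i ∈ Finset.range N, (Real.log ((n:ℝ) - i) - Real.log n + xv i (ω i) - θ * xv 0 (ω i) + RR θ W i (ω i)) + Real.log (cc n N) + Del n N W ω = Kc n N θ lam W + ∑ j ∈ Finset.range N, YY n N θ j (ω j) + Err n N θ lam W ω by linarith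
  rw [hDel]
  unfold Kc Err
  suffices ∑ i ∈ Finset.range N, (Real.log ((n:ℝ) - i) - Real.log n + xv i (ω i) - θ * xv 0 (ω i) + RR θ W i (ω i)) + ((n:ℝ) * N)⁻¹ * ∑ i ∈ Finset.range N, mainS θ i (ω i) = ∑ j ∈ Finset.range N, (Real.log ((n:ℝ) - j) - Real.log n + ∫ s, RR θ W j s ∂kap n lam) + ∑ j ∈ Finset.range N, YY n N θ j (ω j) + ∑ j ∈ Finset.range N, ZZ N θ lam W j (ω j) by linarith
  rw [Finset.mul_sum, ← Finset.sum_add_distrib, ← Finset.sum_add_distrib, ← Finset.sum_add_distrib]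
  apply Finset.sum_congr rfl
  intro j hj
  have hj := Finset.mem_range.1 hj
  have e := cfull_Qf (n := n) (N := N) θ (show j < n by omega) (ω j)
  unfold YY ZZ mainS dY
  have e2 : ((n:ℝ) * N)⁻¹ * (-(1 - θ) * n * xv j (ω j) + cc n j * ((ω j).1 0 ^ 2 - 1) - 2 * √n * √(cc n j) * (ω j).1 0) =
     -((1 - θ) / N * xv j (ω j)) + cc n j / (n * N) * ((ω j).1 0 ^ 2 - 1) - (2 * √(cc n j) / (√n * N)) * (ω j).1 0 := by
    have : (√(n:ℝ)) / n = 1 / √n := by rw [div_eq_div_iff (by positivity) (by positivity)]; nlinarith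
    have e3 : ((n:ℝ) * N)⁻¹ * (2 * √n * √(cc n j) * (ω j).1 0) = (√(n:ℝ)) / n * (2 * √(cc n j) / N * (ω j).1 0) := by field_simp
    rw [mul_sub, e3, this]
    field_simp
  rw [e2]
  linarith

end Ctx

end

section
open MeasureTheory ProbabilityTheory Real Filter Finset
set_option linter.all false

/-- characteristic function of the centred chi-square -/
noncomputable def psiF (u : ℝ) : ℂ := ∫ x, Complex.exp ((u * (x ^ 2 - 1) : ℝ) * Complex.I) ∂gaussianReal 0 1

lemma norm_exp_I (a : ℝ) : ‖Complex.exp ((a : ℂ) * Complex.I)‖ = 1 := Complex.norm_exp_ofReal_mul_I a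

lemma psiF_norm (u : ℝ) : ‖psiF u‖ ≤ 1 := by
  unfold psiF
  refine (norm_integral_le_integral_norm _).trans ?_
  simp only [norm_exp_I]; simp

lemma psiF_taylor : (fun t : ℝ => psiF (t / √2) - (1 - t ^ 2 / 2)) =o[nhds 0] fun t => t ^ 2 := by
  have h2 : (√2:ℝ) ≠ 0 := by positivity
  have h := taylor_charFun_two (P := gaussianReal 0 1) (X := fun x => (x ^ 2 - 1) / √2) (by fun_prop) (by
    rw [integral_div, g_sq_mean]; simp) (by
    simp only [Pi.pow_apply, div_pow]
    rw [integral_div]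
    have := g_sq_var
    rw [this]; norm_num)
  refine h.congr_left fun t => ?_
  congr 1
  rw [charFun_apply_real, integral_map (by fun_prop) (by fun_prop)]
  unfold psiF
  congr 1; ext x; congr 1
  push_cast; ring

lemma exp_taylor : (fun t : ℝ => Real.exp (-t ^ 2 / 2) - (1 - t ^ 2 / 2)) =o[nhds 0] fun t => t ^ 2 := by
  have h1 : (fun x : ℝ => Real.exp x - 1 - x) =o[nhds 0] fun x => x := by
    have := (Real.hasDerivAt_exp 0).isLittleO
    simpa using this
  have h2 : Tendsto (fun t : ℝ => -t ^ 2 / 2) (nhds 0) (nhds 0) := by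
    have : Continuous fun t : ℝ => -t ^ 2 / 2 := by fun_prop
    simpa using this.tendsto 0
  have h3 := h1.comp_tendsto h2
  have h4 : (fun t : ℝ => Real.exp (-t ^ 2 / 2) - (1 - t ^ 2 / 2)) =o[nhds 0] (fun t : ℝ => -t ^ 2 / 2) := by
    refine h3.congr_left fun t => ?_
    simp only [Function.comp]; ring
  refine h4.trans_isBigO ?_
  refine Asymptotics.IsBigO.of_bound 1 (Eventually.of_forall fun t => ?_)
  rw [Real.norm_eq_abs, Real.norm_eq_abs, neg_div, abs_neg, abs_of_nonneg (by positivity), abs_of_nonneg (by positivity)]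
  nlinarith [sq_nonneg t]

lemma psi_close {ε : ℝ} (hε : 0 < ε) : ∃ δ > 0, ∀ u : ℝ, |u| ≤ δ → ‖psiF u - Complex.exp ((-u ^ 2 : ℝ))‖ ≤ ε * u ^ 2 := by
  have h1 := psiF_taylor.def (c := ε / 4) (by positivity)
  have h2 := exp_taylor.def (c := ε / 4) (by positivity)
  obtain ⟨δ, hδ, h⟩ := Metric.eventually_nhds_iff.1 (h1.and h2)
  refine ⟨δ / 4, by positivity, fun u hu => ?_⟩
  have h22 : √2 < (2:ℝ) := by rw [Real.sqrt_lt' (by norm_num)]; norm_num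
  have hs : (√2:ℝ) ^ 2 = 2 := Real.sq_sqrt (by norm_num)
  obtain ⟨a, b⟩ := h (y := √2 * u) (by
    rw [Real.dist_eq, sub_zero, abs_mul, abs_of_nonneg (by positivity)]
    have := abs_nonneg u
    nlinarith)
  have e0 : √2 * u / √2 = u := by field_simp
  rw [e0] at a
  have e1 : (√2 * u) ^ 2 = 2 * u ^ 2 := by rw [mul_pow, hs]
  have e2 : ((√2 * u : ℝ) : ℂ) ^ 2 = 2 * (u:ℂ) ^ 2 := by exact_mod_cast congrArg (Complex.ofReal) e1
  rw [neg_div, e1, Real.norm_eq_abs, Real.norm_eq_abs, abs_of_nonneg (show 0 ≤ 2 * u ^ 2 by positivity)] at b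
  rw [e2, e1, Real.norm_eq_abs, abs_of_nonneg (show 0 ≤ 2 * u ^ 2 by positivity)] at a
  have b' : ‖Complex.exp ((-u ^ 2 : ℝ)) - (1 - 2 * (u:ℂ) ^ 2 / 2)‖ ≤ ε / 4 * (2 * u ^ 2) := by
    have : Complex.exp ((-u ^ 2 : ℝ)) - (1 - 2 * (u:ℂ) ^ 2 / 2) = ((Real.exp (-(2 * u ^ 2 / 2)) - (1 - 2 * u ^ 2 / 2) : ℝ) : ℂ) := by
      push_cast; congr 2; ring_nf
    rw [this, Complex.norm_real]; exact b
  calc _ = ‖(psiF u - (1 - 2 * (u:ℂ) ^ 2 / 2)) - (Complex.exp ((-u ^ 2 : ℝ)) - (1 - 2 * (u:ℂ) ^ 2 / 2))‖ := by congr 1; ring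
    _ ≤ _ := norm_sub_le _ _
    _ ≤ ε / 4 * (2 * u ^ 2) + ε / 4 * (2 * u ^ 2) := add_le_add a b'
    _ = _ := by ring

lemma prod_diff {ι : Type*} (s : Finset ι) (a b : ι → ℂ) (ha : ∀ i ∈ s, ‖a i‖ ≤ 1) (hb : ∀ i ∈ s, ‖b i‖ ≤ 1) :
    ‖∏ i ∈ s, a i‖ ≤ 1 ∧ ‖∏ i ∈ s, b i‖ ≤ 1 ∧ ‖∏ i ∈ s, a i - ∏ i ∈ s, b i‖ ≤ ∑ i ∈ s, ‖a i - b i‖ := by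
  classical
  induction s using Finset.induction_on with
  | empty => simp
  | insert i s hi ih =>
    obtain ⟨h1, h2, h3⟩ := ih (fun j hj => ha j (by simp [hj])) (fun j hj => hb j (by simp [hj]))
    have hai := ha i (by simp)
    have hbi := hb i (by simp)
    simp only [Finset.prod_insert hi, Finset.sum_insert hi, norm_mul]
    refine ⟨mul_le_one₀ hai (norm_nonneg _) h1, mul_le_one₀ hbi (norm_nonneg _) h2, ?_⟩
    have : a i * ∏ i ∈ s, a i - b i * ∏ i ∈ s, b i = (a i - b i) * ∏ i ∈ s, a i + b i * (∏ i ∈ s, a i - ∏ i ∈ s, b i) := by ring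
    rw [this]
    refine (norm_add_le _ _).trans ?_
    rw [norm_mul, norm_mul]
    have := norm_nonneg (a i - b i)
    have := norm_nonneg (∏ i ∈ s, a i - ∏ i ∈ s, b i)
    nlinarith [norm_nonneg (b i)]

section char
variable {n : ℕ} [NeZero n] {lam : Measure ℝ} [IsProbabilityMeasure lam]

/-- one-point characteristic function -/
lemma char_one (c : Fin n → ℝ) (hc : c 0 = 0) (d t : ℝ) :
    ∫ s : Smp n, Complex.exp ((t * (Qf c s.1 + d * s.1 0) : ℝ) * Complex.I) ∂kap n lam =
      Complex.exp ((-(t * d) ^ 2 / 2 : ℝ)) * ∏ k, psiF (t * c k) := by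
  have e0 : ∫ s : Smp n, Complex.exp ((t * (Qf c s.1 + d * s.1 0) : ℝ) * Complex.I) ∂kap n lam = ∫ g, Complex.exp ((t * (Qf c g + d * g 0) : ℝ) * Complex.I) ∂Gm n := by
    rw [← kap_map_fst n lam, integral_map (by fun_prop)]
    apply Measurable.aestronglyMeasurable
    have := measurable_Qf c
    fun_prop
  rw [e0]
  have e1 : ∀ g : Fin n → ℝ, Complex.exp ((t * (Qf c g + d * g 0) : ℝ) * Complex.I) = ∏ k, Complex.exp ((t * (c k * (g k ^ 2 - 1) + (if k = 0 then d else 0) * g k) : ℝ) * Complex.I) := by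
    intro g
    rw [← Complex.exp_sum]
    congr 1
    rw [← Finset.sum_mul]
    congr 1
    rw [← Complex.ofReal_sum]
    congr 1
    rw [← Finset.mul_sum, Finset.sum_add_distrib]
    congr 2
    simp
  simp_rw [e1]
  rw [integral_fintype_prod_eq_prod (𝕜 := ℂ) (f := fun k x => Complex.exp ((t * (c k * (x ^ 2 - 1) + (if k = 0 then d else 0) * x) : ℝ) * Complex.I))]
  rw [← Finset.mul_prod_erase _ _ (Finset.mem_univ (0 : Fin n)), ← Finset.mul_prod_erase _ (fun k => psiF (t * c k)) (Finset.mem_univ (0 : Fin n))]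
  have p0 : psiF (t * c 0) = 1 := by simp [psiF, hc]
  rw [p0, one_mul]
  congr 1
  · have := charFun_gaussianReal (μ := 0) (v := 1) (t * d)
    rw [charFun_apply_real] at this
    simp only [hc, if_true]
    convert this using 1
    · congr 1; ext x; congr 1; push_cast; ring
    · congr 1; push_cast; ring
  · apply Finset.prod_congr rfl
    intro k hk
    unfold psiF
    simp only [Finset.ne_of_mem_erase hk, if_false]
    congr 1; ext x; congr 3; ring

lemma char_all {N : ℕ} (Y : ℕ → Smp n → ℝ) (hY : ∀ j, Measurable (Y j)) (t : ℝ) :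
    ∫ ω, Complex.exp ((t * ∑ j ∈ Finset.range N, Y j (ω j) : ℝ) * Complex.I) ∂PP n lam = ∏ j ∈ Finset.range N, ∫ s, Complex.exp ((t * Y j s : ℝ) * Complex.I) ∂kap n lam := by
  have hi := iIndepFun_infinitePi (P := fun _ : ℕ => kap n lam) (X := fun j => Y j) hY
  have h := (hi.restrict (Finset.range N)).charFun_map_fun_finsetSum_eq_prod (fun j _ => (by
    have := hY j
    apply Measurable.aemeasurable; fun_prop))
  have h' := congrFun h t
  rw [charFun_apply_real, integral_map (by apply Measurable.aemeasurable; fun_prop) (by fun_prop)] at h'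
  rw [Finset.prod_apply] at h'
  simp only [charFun_apply_real] at h'
  convert h' using 1
  · congr 1; ext ω; congr 1; push_cast; ring
  · apply Finset.prod_congr rfl; intro j _
    rw [integral_map (by have := hY j; apply Measurable.aemeasurable; fun_prop) (by fun_prop)]
    have e := integral_map (μ := PP n lam) (φ := fun ω => ω j) (measurable_pi_apply j).aemeasurable (f := fun s => Complex.exp ((t * Y j s : ℝ) * Complex.I)) (by
      have := hY j; apply Measurable.aestronglyMeasurable; fun_prop)
    rw [PP_map] at e
    rw [e]
    congr 1; funext ω; push_cast; rfl

end char

end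

section
open MeasureTheory ProbabilityTheory Real Filter Finset
set_option linter.all false

/-- variance of the main term -/
noncomputable def VV (n N : ℕ) [NeZero n] (θ : ℝ) : ℝ := ∑ j ∈ Finset.range N, (dY n N j ^ 2 + 2 * ∑ k, cY n N θ j k ^ 2)

lemma YY_meas (n N : ℕ) [NeZero n] (θ : ℝ) (j : ℕ) : Measurable (YY n N θ j) := by
  have := measurable_Qf (cY n N θ j)
  unfold YY; fun_prop

lemma clt_Y {ε : ℝ} (hε : 0 < ε) : ∃ δ > 0, ∀ (n N : ℕ) [NeZero n] (θ : ℝ) (lam : Measure ℝ) [IsProbabilityMeasure lam] (s t : ℝ), 0 < s → s ^ 2 = VV n N θ →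
    (∀ j < N, ∀ k, |t / s * cY n N θ j k| ≤ δ) →
    ‖∫ ω, Complex.exp ((t / s * ∑ j ∈ Finset.range N, YY n N θ j (ω j) : ℝ) * Complex.I) ∂PP n lam - Complex.exp ((-t ^ 2 / 2 : ℝ))‖ ≤ ε * t ^ 2 := by
  obtain ⟨δ, hδ, h⟩ := psi_close hε
  refine ⟨δ, hδ, fun n N _ θ lam _ s t hs hV hc => ?_⟩
  rw [char_all (YY n N θ) (YY_meas n N θ)]
  have e1 : ∀ j, ∫ s', Complex.exp ((t / s * YY n N θ j s' : ℝ) * Complex.I) ∂kap n lam = Complex.exp ((-(t / s * dY n N j) ^ 2 / 2 : ℝ)) * ∏ k, psiF (t / s * cY n N θ j k) :=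
    fun j => char_one (cY n N θ j) (by simp [cY]) (dY n N j) (t / s)
  simp only [e1]
  have e2 : Complex.exp ((-t ^ 2 / 2 : ℝ)) = ∏ j ∈ Finset.range N, (Complex.exp ((-(t / s * dY n N j) ^ 2 / 2 : ℝ)) * ∏ k, Complex.exp ((-(t / s * cY n N θ j k) ^ 2 : ℝ))) := by
    simp only [← Complex.exp_sum, ← Complex.exp_add, ← Complex.ofReal_sum, ← Complex.ofReal_add]
    congr 2
    have : -t ^ 2 / 2 = -(t / s) ^ 2 / 2 * VV n N θ := by rw [← hV]; field_simp
    rw [this, VV, Finset.mul_sum]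
    apply Finset.sum_congr rfl; intro j _
    rw [mul_add, Finset.mul_sum, Finset.mul_sum]
    congr 1
    · ring
    · apply Finset.sum_congr rfl; intro k _; ring
  rw [e2]
  have nE : ∀ x : ℝ, 0 ≤ x → ‖Complex.exp ((-x : ℝ))‖ ≤ 1 := by
    intro x hx
    rw [Complex.norm_exp_ofReal]
    exact Real.exp_le_one_iff.2 (by linarith)
  have nE1 : ∀ x : ℝ, ‖Complex.exp ((-x ^ 2 / 2 : ℝ))‖ ≤ 1 := by
    intro x; have := nE (x ^ 2 / 2) (by positivity); rwa [← neg_div] at this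
  have nE2 : ∀ x : ℝ, ‖Complex.exp ((-x ^ 2 : ℝ))‖ ≤ 1 := fun x => nE _ (by positivity)
  have inner : ∀ j, _ := fun j => prod_diff Finset.univ (fun k => psiF (t / s * cY n N θ j k)) (fun k => Complex.exp ((-(t / s * cY n N θ j k) ^ 2 : ℝ))) (fun k _ => psiF_norm _) (fun k _ => nE2 _)
  refine (prod_diff (Finset.range N) _ _ (fun j _ => ?_) (fun j _ => ?_)).2.2.trans ?_
  · rw [norm_mul]; exact mul_le_one₀ (nE1 _) (norm_nonneg _) (inner j).1
  · rw [norm_mul]; exact mul_le_one₀ (nE1 _) (norm_nonneg _) (inner j).2.1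
  · calc _ ≤ ∑ j ∈ Finset.range N, (ε * (t / s) ^ 2) * (dY n N j ^ 2 + 2 * ∑ k, cY n N θ j k ^ 2) := by
          apply Finset.sum_le_sum; intro j hj
          rw [← mul_sub, norm_mul]
          calc _ ≤ 1 * ∑ k, ‖psiF (t / s * cY n N θ j k) - Complex.exp ((-(t / s * cY n N θ j k) ^ 2 : ℝ))‖ :=
                mul_le_mul (nE1 _) (inner j).2.2 (norm_nonneg _) zero_le_one
            _ ≤ ∑ k, ε * (t / s * cY n N θ j k) ^ 2 := by
                rw [one_mul]
                apply Finset.sum_le_sum; intro k _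
                exact h _ (hc j (Finset.mem_range.1 hj) k)
            _ = (ε * (t / s) ^ 2) * ∑ k, cY n N θ j k ^ 2 := by
                rw [Finset.mul_sum]; apply Finset.sum_congr rfl; intro k _; ring
            _ ≤ _ := by
                have : 0 ≤ ∑ k, cY n N θ j k ^ 2 := Finset.sum_nonneg fun k _ => sq_nonneg _
                gcongr
                nlinarith [sq_nonneg (dY n N j)]
      _ = ε * t ^ 2 := by
          rw [← Finset.mul_sum]
          change _ * VV n N θ = _
          rw [← hV]; field_simp

lemma log_lin {x : ℝ} (hx : |x| ≤ 1 / 2) : |Real.log (1 + x) - x| ≤ 2 * x ^ 2 := by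
  have h := Real.abs_log_sub_add_sum_range_le (x := -x) (by rw [abs_neg]; linarith) 1
  simp at h
  have h2 : |x| ^ 2 / (1 - |x|) ≤ 2 * x ^ 2 := by
    rw [div_le_iff₀ (by linarith), sq_abs]
    nlinarith [sq_nonneg x]
  have h3 : |Real.log (1 + x) - x| = |-x + Real.log (1 + x)| := by congr 1; ring
  rw [h3]
  refine h.trans ?_
  simpa using h2

lemma exp_sub_one_le (a : ℝ) : ‖Complex.exp ((a:ℂ) * Complex.I) - 1‖ ≤ |a| := by
  have := Real.norm_exp_I_mul_ofReal_sub_one_le (x := a)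
  rw [mul_comm] at this
  simpa using this

lemma exp_sub_one_le2 (a : ℝ) : ‖Complex.exp ((a:ℂ) * Complex.I) - 1‖ ≤ 2 := by
  refine (norm_sub_le _ _).trans ?_
  rw [norm_exp_I]; norm_num

lemma exp_log_bound {x a : ℝ} (hx : 0 < 1 + x) : ‖Complex.exp ((a * (Real.log (1 + x) - x) : ℝ) * Complex.I) - 1‖ ≤ (4 + √(4 * |a|)) * |x| := by
  have hs := Real.sqrt_nonneg (4 * |a|)
  have hx0 := abs_nonneg x
  by_cases h : |x| ≤ 1 / 2
  · set z := ‖Complex.exp ((a * (Real.log (1 + x) - x) : ℝ) * Complex.I) - 1‖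
    have h0 : 0 ≤ z := norm_nonneg _
    have h1 : z ≤ |a| * (2 * x ^ 2) := by
      refine (exp_sub_one_le _).trans ?_
      rw [abs_mul]; gcongr; exact log_lin h
    have h2 : z ≤ 2 := exp_sub_one_le2 _
    have h3 : z ≤ √(4 * |a|) * |x| := by
      rw [← Real.sqrt_sq_eq_abs x, ← Real.sqrt_mul (by positivity)]
      apply Real.le_sqrt_of_sq_le
      nlinarith
    nlinarith
  · refine (exp_sub_one_le2 _).trans ?_
    push Not at h
    nlinarith

namespace Ctx
variable {n N : ℕ} [NeZero n] {θ β C : ℝ} {μ : Measure (EuclideanSpace ℝ (Fin n))} {lam : Measure ℝ} {W : Smp n → ℝ}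

lemma VV_ge (h : Ctx n N θ β C μ lam W) : 1 / (n:ℝ) ≤ VV n N θ := by
  obtain ⟨hn0, hn1, hnsq, hb1⟩ := h.bounds
  have hN : (2:ℝ) ≤ N := by exact_mod_cast h.hN
  unfold VV
  have e1 : ∀ j ∈ Finset.range N, 4 / (n * (N:ℝ) ^ 2) * (j:ℝ) ≤ dY n N j ^ 2 + 2 * ∑ k, cY n N θ j k ^ 2 := by
    intro j hj
    have hj := Finset.mem_range.1 hj
    have : 0 ≤ ∑ k, cY n N θ j k ^ 2 := Finset.sum_nonneg fun k _ => sq_nonneg _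
    have hc0 := h.cc_nonneg hj.le
    have hc : (j:ℝ) ≤ cc n j := by
      rcases Nat.eq_zero_or_pos j with h0 | h0
      · rw [h0]; simp [cc]
      · exact h.cc_ge h0 hj.le
    have : dY n N j ^ 2 = 4 / (n * (N:ℝ) ^ 2) * cc n j := by
      unfold dY
      rw [neg_sq, div_pow, mul_pow, mul_pow, hnsq, Real.sq_sqrt hc0]; ring
    have : 4 / (n * (N:ℝ) ^ 2) * (j:ℝ) ≤ 4 / (n * (N:ℝ) ^ 2) * cc n j := by gcongr
    linarith
  refine le_trans ?_ (Finset.sum_le_sum e1)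
  rw [← Finset.mul_sum]
  have e2 : ∑ i ∈ Finset.range N, (i:ℝ) = N * (N - 1) / 2 := by
    have := Finset.sum_range_id_mul_two N
    have h2 : (((∑ i ∈ Finset.range N, i) * 2 : ℕ) : ℝ) = ((N * (N - 1) : ℕ) : ℝ) := by rw [this]
    rw [Nat.cast_mul, Nat.cast_mul, Nat.cast_sum, Nat.cast_sub (by have := h.hN; omega)] at h2
    push_cast at h2
    linarith
  rw [e2]
  have : 4 / ((n:ℝ) * (N:ℝ) ^ 2) * (N * (N - 1) / 2) = 1 / n * (2 * (N - 1) / N) := by field_simp; ring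
  rw [this]
  have : 1 ≤ 2 * ((N:ℝ) - 1) / N := by rw [le_div_iff₀ (by linarith)]; linarith
  have : 0 < 1 / (n:ℝ) := by positivity
  nlinarith

lemma cY_le (h : Ctx n N θ β C μ lam W) {j : ℕ} (hj : j < N) (k : Fin n) : |cY n N θ j k| ≤ 2 * β⁻¹ / n := by
  obtain ⟨hn0, hn1, hnsq, hb1⟩ := h.bounds
  have hN : (2:ℝ) ≤ N := by exact_mod_cast h.hN
  have hθ := h.hθ; have hθ1 := h.hθ1; have hβ := h.hβ
  have hbj := h.bj hj.le
  have hi : 0 < (n:ℝ)⁻¹ := inv_pos.2 hn0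
  have hu : |1 - (1 - θ) / N| ≤ 1 := by
    have : 0 ≤ (1 - θ) / N := div_nonneg (by linarith) (by linarith)
    have : (1 - θ) / N ≤ 1 := by rw [div_le_one (by linarith)]; linarith
    rw [abs_of_nonneg] <;> linarith
  unfold cY
  split_ifs with h0
  · simp; positivity
  unfold cfull
  refine (abs_sub _ _).trans ?_
  have e2 : |θ * (n:ℝ)⁻¹| ≤ β⁻¹ / n := by
    rw [abs_mul, abs_of_nonneg hθ, abs_of_pos hi, div_eq_mul_inv]
    gcongr; linarith
  have hp : 0 < β * (n:ℝ) := by positivity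
  have e1 : |(if j ≤ (k:ℕ) then (1 - (1 - θ) / N) * ((n:ℝ) - j)⁻¹ else 0)| ≤ β⁻¹ / n := by
    split_ifs with hh
    · rw [abs_mul, abs_of_pos (show 0 < ((n:ℝ) - j)⁻¹ from inv_pos.2 (by linarith))]
      have hp2 : 0 ≤ ((n:ℝ) - j)⁻¹ := inv_nonneg.2 (by linarith)
      calc _ ≤ 1 * (β * n)⁻¹ := by gcongr
        _ = _ := by rw [mul_inv]; ring
    · simp; positivity
  calc _ ≤ β⁻¹ / n + β⁻¹ / n := add_le_add e1 e2
    _ = _ := by ring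

/-- the normalised logarithm of the squared volume -/
noncomputable def TT (n N : ℕ) [NeZero n] (θ : ℝ) (lam : Measure ℝ) (W : Smp n → ℝ) (s : ℝ) (ω : ℕ → Smp n) : ℝ :=
  (Real.log ((dq W N ω).1 * (dq W N ω).2) - Kc n N θ lam W) / s

lemma TT_meas (h : Ctx n N θ β C μ lam W) (s : ℝ) : Measurable (TT n N θ lam W s) := by
  have := (dq_past h.rep.meas N).1
  unfold TT; fun_prop

lemma TT_char (h : Ctx n N θ β C μ lam W) {s : ℝ} (hs : 0 < s) (t : ℝ) :
    ‖∫ ω, Complex.exp ((t * TT n N θ lam W s ω : ℝ) * Complex.I) ∂PP n lam - ∫ ω, Complex.exp ((t / s * ∑ j ∈ Finset.range N, YY n N θ j (ω j) : ℝ) * Complex.I) ∂PP n lam‖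
     ≤ |t| / s * (cZ β C * √N / n) + (4 + √(4 * (|t| / s))) * (cZ β C / √n) := by
  haveI := h.rep.prob
  have hb : ∀ f : (ℕ → Smp n) → ℝ, Measurable f → Integrable (fun ω => Complex.exp ((f ω : ℂ) * Complex.I)) (PP n lam) := by
    intro f hf
    apply Integrable.of_bound (C := 1)
    · apply Measurable.aestronglyMeasurable; fun_prop
    · exact ae_of_all _ fun ω => (norm_exp_I _).le
  have m1 := h.TT_meas s
  have m2 : Measurable fun ω : ℕ → Smp n => ∑ j ∈ Finset.range N, YY n N θ j (ω j) := by
    apply Finset.measurable_sum; intro j _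
    exact (YY_meas n N θ j).comp (measurable_pi_apply j)
  have i1 := hb (fun ω => t * TT n N θ lam W s ω) (by fun_prop)
  have i2 := hb (fun ω => t / s * ∑ j ∈ Finset.range N, YY n N θ j (ω j)) (by fun_prop)
  rw [← integral_sub i1 i2]
  have hE := h.Err_L1
  have hD := h.Del_L1
  have hE' := (hE.const_mul (|t| / s)).abs
  have hD' := (hD.const_mul (4 + √(4 * (|t| / s)))).abs
  refine (norm_integral_le_integral_norm _).trans ?_
  have hpos1 : |t| / s = |(|t| / s)| := (abs_of_nonneg (by positivity)).symm
  have hpos2 : 4 + √(4 * (|t| / s)) = |4 + √(4 * (|t| / s))| := (abs_of_nonneg (by positivity)).symm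
  calc _ ≤ ∫ ω, (|(|t| / s) * Err n N θ lam W ω| + |(4 + √(4 * (|t| / s))) * Del n N W ω|) ∂PP n lam := by
        apply integral_mono_ae (i1.sub i2).norm (hE'.1.add hD'.1)
        filter_upwards [h.expansion] with ω ⟨p1, p2, p3⟩
        have e : t * TT n N θ lam W s ω = t / s * ∑ j ∈ Finset.range N, YY n N θ j (ω j) + (t / s * Err n N θ lam W ω + t / s * (Real.log (1 + Del n N W ω) - Del n N W ω)) := by
          unfold TT; rw [p3]; field_simp; ring
        have habs : |t / s| = |t| / s := by rw [abs_div, abs_of_pos hs]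
        show ‖Complex.exp (((t * TT n N θ lam W s ω : ℝ) : ℂ) * Complex.I) - Complex.exp (((t / s * ∑ j ∈ Finset.range N, YY n N θ j (ω j) : ℝ) : ℂ) * Complex.I)‖ ≤ |(|t| / s) * Err n N θ lam W ω| + |(4 + √(4 * (|t| / s))) * Del n N W ω|
        rw [e]
        generalize hA : t / s * ∑ j ∈ Finset.range N, YY n N θ j (ω j) = A
        generalize hB : t / s * Err n N θ lam W ω = B
        generalize hD : t / s * (Real.log (1 + Del n N W ω) - Del n N W ω) = D
        have e3 : Complex.exp (((A + (B + D) : ℝ) : ℂ) * Complex.I) - Complex.exp ((A:ℂ) * Complex.I) = Complex.exp ((A:ℂ) * Complex.I) * (Complex.exp ((B:ℂ) * Complex.I) * (Complex.exp ((D:ℂ) * Complex.I) - 1) + (Complex.exp ((B:ℂ) * Complex.I) - 1)) := by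
          push_cast
          rw [add_mul, add_mul, Complex.exp_add, Complex.exp_add]; ring
        rw [e3, norm_mul, norm_exp_I, one_mul]
        refine (norm_add_le _ _).trans ?_
        rw [norm_mul, norm_exp_I, one_mul, add_comm]
        apply add_le_add
        · refine (exp_sub_one_le _).trans ?_
          rw [← hB, abs_mul, abs_mul, habs, ← hpos1]
        · rw [← hD]
          refine (exp_log_bound p1).trans ?_
          rw [habs, abs_mul, ← hpos2]
    _ = _ := integral_add hE'.1 hD'.1
    _ ≤ _ := by
        have a := hE'.2
        have b := hD'.2
        simp only [abs_abs] at a b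
        rw [← hpos1] at a
        rw [← hpos2] at b
        exact add_le_add a b

end Ctx

/-- the central limit theorem in quantitative form -/
theorem clt_T {β C t ε : ℝ} (hε : 0 < ε) : ∃ η > 0, ∀ (n N : ℕ) [NeZero n] (θ : ℝ) (μ : Measure (EuclideanSpace ℝ (Fin n))) (lam : Measure ℝ) (W : Smp n → ℝ),
    Ctx n N θ β C μ lam W → 1 / √(n:ℝ) ≤ η → √N / (n * √(VV n N θ)) ≤ η →
    ‖charFun ((PP n lam).map (Ctx.TT n N θ lam W (√(VV n N θ)))) t - Complex.exp ((-t ^ 2 / 2 : ℝ))‖ ≤ ε := by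
  obtain ⟨δ, hδ, hY⟩ := clt_Y (ε := ε / (2 * (t ^ 2 + 1))) (by positivity)
  have hc1 : Continuous fun η : ℝ => |t| * cZ β C * η + 4 * cZ β C * η + cZ β C * √(4 * |t| * η) := by fun_prop
  have hc2 : Continuous fun η : ℝ => |t| * (2 * β⁻¹) * η := by fun_prop
  have t1 := hc1.tendsto 0
  have t2 := hc2.tendsto 0
  simp only [mul_zero, Real.sqrt_zero, add_zero] at t1 t2
  have ev := ((t1.eventually (gt_mem_nhds (show (0:ℝ) < ε / 2 by positivity))).and (t2.eventually (gt_mem_nhds hδ)))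
  obtain ⟨η, ⟨hη1, hη2⟩, hη⟩ := ((ev.filter_mono nhdsWithin_le_nhds).and self_mem_nhdsWithin : ∀ᶠ η in nhdsWithin (0:ℝ) (Set.Ioi 0), _).exists
  replace hη : 0 < η := hη
  refine ⟨η, hη, fun n N _ θ μ lam W h ha hb => ?_⟩
  obtain ⟨hn0, hn1, hnsq, hb1⟩ := h.bounds
  haveI := h.rep.prob
  have hVge := h.VV_ge
  have hV0 : 0 < VV n N θ := lt_of_lt_of_le (by positivity) hVge
  set s := √(VV n N θ) with hs
  have hs0 : 0 < s := Real.sqrt_pos.2 hV0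
  have hs2 : s ^ 2 = VV n N θ := Real.sq_sqrt hV0.le
  have hsn : 1 / s ≤ √n := by
    rw [div_le_iff₀ hs0, hs, ← Real.sqrt_mul hn0.le, Real.one_le_sqrt]
    rw [div_le_iff₀ hn0] at hVge; linarith
  have hn' : 0 < √(n:ℝ) := by linarith
  have hinv : √(n:ℝ) / n = 1 / √n := by rw [div_eq_div_iff hn0.ne' hn'.ne']; nlinarith
  have hcz := h.cZ_bounds.2.2
  have hβ := h.hβ
  have k1 := hY n N θ lam s t hs0 hs2 (by
    intro j hj k
    rw [abs_mul, abs_div, abs_of_pos hs0]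
    refine le_trans ?_ hη2.le
    calc |t| / s * |cY n N θ j k| ≤ |t| * √n * (2 * β⁻¹ / n) := by
          rw [div_eq_mul_one_div]
          gcongr
          exact h.cY_le hj k
      _ = |t| * (2 * β⁻¹) * (√n / n) := by ring
      _ ≤ _ := by rw [hinv]; gcongr)
  have k2 := h.TT_char hs0 t
  have e0 : charFun ((PP n lam).map (Ctx.TT n N θ lam W s)) t = ∫ ω, Complex.exp ((t * Ctx.TT n N θ lam W s ω : ℝ) * Complex.I) ∂PP n lam := by
    rw [charFun_apply_real, integral_map (h.TT_meas s).aemeasurable]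
    · simp only [Complex.ofReal_mul]
    · apply Measurable.aestronglyMeasurable; fun_prop
  rw [e0]
  refine (norm_sub_le_norm_sub_add_norm_sub _ _ _).trans ((add_le_add k2 k1).trans ?_)
  have b1 : |t| / s * (cZ β C * √N / n) ≤ |t| * cZ β C * η := by
    have : |t| / s * (cZ β C * √N / n) = |t| * cZ β C * (√N / (n * s)) := by field_simp
    rw [this]; gcongr
  have b2 : √(4 * (|t| / s)) * (1 / √n) ≤ √(4 * |t| * η) := by
    have : 1 / √(n:ℝ) = √(1 / n) := by rw [Real.sqrt_div zero_le_one, Real.sqrt_one]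
    rw [this, ← Real.sqrt_mul (by positivity)]
    apply Real.sqrt_le_sqrt
    calc 4 * (|t| / s) * (1 / n) = 4 * |t| * ((1 / s) / n) := by field_simp
      _ ≤ 4 * |t| * (√n / n) := by gcongr
      _ ≤ _ := by rw [hinv]; gcongr
  have b3 : (4 + √(4 * (|t| / s))) * (cZ β C / √n) ≤ 4 * cZ β C * η + cZ β C * √(4 * |t| * η) := by
    calc _ = 4 * cZ β C * (1 / √n) + cZ β C * (√(4 * (|t| / s)) * (1 / √n)) := by ring
      _ ≤ _ := by gcongr
  have b4 : ε / (2 * (t ^ 2 + 1)) * t ^ 2 ≤ ε / 2 := by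
    rw [div_mul_eq_mul_div, div_le_div_iff₀ (by positivity) (by positivity)]; nlinarith [sq_nonneg t]
  linarith

end

section
open MeasureTheory ProbabilityTheory Real Filter Finset
set_option linter.all false

lemma sum_cfull_sq {n N : ℕ} {θ : ℝ} {j : ℕ} (hj : j < n) :
    ∑ k, cfull n N θ j k ^ 2 = (1 - (1 - θ) / N) ^ 2 * ((n:ℝ) - j)⁻¹ - 2 * (1 - (1 - θ) / N) * θ * (n:ℝ)⁻¹ + θ ^ 2 * (n:ℝ)⁻¹ := by
  have hc : (((Finset.univ.filter fun k : Fin n => j ≤ (k:ℕ)).card : ℕ) : ℝ) = n - j := by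
    rw [card_tail]; push_cast [hj.le]; ring
  have hj' : (j:ℝ) < n := by exact_mod_cast hj
  have hj0 : (0:ℝ) ≤ j := Nat.cast_nonneg j
  have e : ∀ k : Fin n, cfull n N θ j k ^ 2 = (θ * (n:ℝ)⁻¹) ^ 2 + if j ≤ (k:ℕ) then ((1 - (1 - θ) / N) * ((n:ℝ) - j)⁻¹) ^ 2 - 2 * ((1 - (1 - θ) / N) * ((n:ℝ) - j)⁻¹) * (θ * (n:ℝ)⁻¹) else 0 := by
    intro k
    unfold cfull
    split_ifs <;> ring
  simp only [e]
  generalize 1 - (1 - θ) / (N:ℝ) = u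
  rw [Finset.sum_add_distrib, ← Finset.sum_filter, Finset.sum_const, Finset.sum_const, nsmul_eq_mul, nsmul_eq_mul, hc]
  simp only [Finset.card_univ, Fintype.card_fin]
  have h1 : (n:ℝ) - j ≠ 0 := by linarith
  have h2 : (n:ℝ) ≠ 0 := by linarith
  field_simp
  ring

lemma sum_cY_sq {n N : ℕ} [NeZero n] {θ : ℝ} {j : ℕ} :
    ∑ k, cY n N θ j k ^ 2 = ∑ k, cfull n N θ j k ^ 2 - cfull n N θ j 0 ^ 2 := by
  rw [eq_sub_iff_add_eq, ← Finset.add_sum_erase _ _ (Finset.mem_univ (0 : Fin n)), ← Finset.add_sum_erase (Finset.univ) (fun k => cfull n N θ j k ^ 2) (Finset.mem_univ (0 : Fin n))]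
  have : ∑ x ∈ Finset.univ.erase (0 : Fin n), cY n N θ j x ^ 2 = ∑ x ∈ Finset.univ.erase (0 : Fin n), cfull n N θ j x ^ 2 := by
    apply Finset.sum_congr rfl
    intro x hx
    rw [cY, if_neg (Finset.ne_of_mem_erase hx)]
  rw [this]
  simp [cY]

/-- comparison of the harmonic sum with the logarithm -/
lemma harm_bounds {n N : ℕ} (h : N < n) :
    ∑ j ∈ Finset.range N, ((n:ℝ) - j)⁻¹ ≤ Real.log (n / (n - N)) ∧ Real.log (n / (n - N)) ≤ ∑ j ∈ Finset.range N, ((n:ℝ) - j)⁻¹ + ((n - N : ℝ)⁻¹ - (n:ℝ)⁻¹) := by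
  induction N with
  | zero => 
    have : (n:ℝ) ≠ 0 := by exact_mod_cast h.ne'
    simp [div_self this]
  | succ m ih =>
    obtain ⟨h1, h2⟩ := ih (by omega)
    have hm : (m:ℝ) + 1 < n := by exact_mod_cast h
    have hm0 : (0:ℝ) ≤ m := Nat.cast_nonneg m
    rw [Finset.sum_range_succ]
    push_cast
    have p1 : (0:ℝ) < n - m := by linarith
    have p2 : (0:ℝ) < n - (m + 1) := by linarith
    have e : Real.log (n / (n - (m + 1))) = Real.log (n / (n - m)) + Real.log ((n - m) / (n - (m + 1))) := by
      rw [← Real.log_mul (by apply ne_of_gt; apply div_pos <;> linarith) (by positivity)]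
      congr 1; field_simp
    have a1 := Real.one_sub_inv_le_log_of_pos (div_pos p1 p2)
    have a2 := Real.log_le_sub_one_of_pos (div_pos p1 p2)
    have b1 : 1 - (((n:ℝ) - m) / (n - (m + 1)))⁻¹ = ((n:ℝ) - m)⁻¹ := by field_simp; ring
    have b2 : (((n:ℝ) - m) / (n - (m + 1))) - 1 = ((n:ℝ) - (m + 1))⁻¹ := by field_simp; ring
    rw [b1] at a1; rw [b2] at a2
    rw [e]
    constructor <;> linarith

namespace Ctx
variable {n N : ℕ} [NeZero n] {θ β C : ℝ} {μ : Measure (EuclideanSpace ℝ (Fin n))} {lam : Measure ℝ} {W : Smp n → ℝ}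

lemma VV_approx (h : Ctx n N θ β C μ lam W) :
    |VV n N θ - 2 * (∑ j ∈ Finset.range N, ((n:ℝ) - j)⁻¹ - N * (θ * (2 - θ) * (n:ℝ)⁻¹))| ≤ 24 * β⁻¹ ^ 2 / n := by
  obtain ⟨hn0, hn1, hnsq, hb1⟩ := h.bounds
  have hN : (2:ℝ) ≤ N := by exact_mod_cast h.hN
  have hθ := h.hθ; have hθ1 := h.hθ1; have hβ := h.hβ
  have hN8 := h.hN8
  have hNn : (N:ℝ) ≤ n := by have : N ≤ n := by omega
                             exact_mod_cast this
  have hi : 0 < (n:ℝ)⁻¹ := inv_pos.2 hn0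
  have hv0 : 0 ≤ (1 - θ) / N := div_nonneg (by linarith) (by linarith)
  have hv1 : (1 - θ) / N ≤ (N:ℝ)⁻¹ := by rw [div_eq_mul_inv]; nlinarith [inv_pos.2 (show (0:ℝ) < N by linarith)]
  have hNi : (N:ℝ)⁻¹ ≤ 1 := inv_le_one_of_one_le₀ (by linarith)
  have e0 : VV n N θ - 2 * (∑ j ∈ Finset.range N, ((n:ℝ) - j)⁻¹ - N * (θ * (2 - θ) * (n:ℝ)⁻¹)) =
      ∑ j ∈ Finset.range N, ((dY n N j ^ 2 + 2 * ∑ k, cY n N θ j k ^ 2) - 2 * (((n:ℝ) - j)⁻¹ - θ * (2 - θ) * (n:ℝ)⁻¹)) := by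
    rw [Finset.sum_sub_distrib, ← Finset.mul_sum, Finset.sum_sub_distrib, VV]
    simp
  rw [e0]
  have key : ∀ j ∈ Finset.range N, |(dY n N j ^ 2 + 2 * ∑ k, cY n N θ j k ^ 2) - 2 * (((n:ℝ) - j)⁻¹ - θ * (2 - θ) * (n:ℝ)⁻¹)| ≤ 24 * β⁻¹ ^ 2 / n * (N:ℝ)⁻¹ := by
    intro j hj
    have hj := Finset.mem_range.1 hj
    have hjN : (j:ℝ) ≤ N := by exact_mod_cast hj.le
    have hc0 := h.cc_nonneg hj.le
    have hc1 := h.cc_le hj.le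
    have hbj := h.bj hj.le
    have hp : 0 < β * (n:ℝ) := by positivity
    rw [sum_cY_sq, sum_cfull_sq (by omega)]
    have d1 : dY n N j ^ 2 = 4 / (n * (N:ℝ) ^ 2) * cc n j := by
      unfold dY
      rw [neg_sq, div_pow, mul_pow, mul_pow, hnsq, Real.sq_sqrt hc0]; ring
    have d2 : dY n N j ^ 2 ≤ 4 * β⁻¹ ^ 2 / n * (N:ℝ)⁻¹ := by
      rw [d1]
      calc 4 / (n * (N:ℝ) ^ 2) * cc n j ≤ 4 / (n * (N:ℝ) ^ 2) * (β⁻¹ ^ 2 * N) := by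
            gcongr; refine hc1.trans ?_
            have : β⁻¹ ≤ β⁻¹ ^ 2 := by nlinarith
            have : (0:ℝ) ≤ j := Nat.cast_nonneg j
            gcongr
        _ = _ := by field_simp
    have d0 : 0 ≤ dY n N j ^ 2 := sq_nonneg _
    have hinv : ((n:ℝ) - j)⁻¹ ≤ β⁻¹ / n := by
      calc _ ≤ (β * n)⁻¹ := by gcongr
        _ = _ := by rw [mul_inv]; ring
    have hinv0 : 0 ≤ ((n:ℝ) - j)⁻¹ := inv_nonneg.2 (by linarith)
    set v := (1 - θ) / N with hv
    have c1 : |cfull n N θ j 0| ≤ 2 * β⁻¹ / n := by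
      unfold cfull
      refine (abs_sub _ _).trans ?_
      have e2 : |θ * (n:ℝ)⁻¹| ≤ β⁻¹ / n := by
        rw [abs_mul, abs_of_nonneg hθ, abs_of_pos hi, div_eq_mul_inv]
        gcongr; linarith
      have e1 : |(if j ≤ ((0 : Fin n):ℕ) then (1 - (1 - θ) / N) * ((n:ℝ) - j)⁻¹ else 0)| ≤ β⁻¹ / n := by
        split_ifs with hh
        · rw [← hv, abs_mul, abs_of_nonneg hinv0, abs_of_nonneg (by linarith)]
          nlinarith
        · simp; positivity
      calc _ ≤ β⁻¹ / n + β⁻¹ / n := add_le_add e1 e2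
        _ = _ := by ring
    have c2 : cfull n N θ j 0 ^ 2 ≤ 4 * β⁻¹ ^ 2 / n * (N:ℝ)⁻¹ := by
      rw [← sq_abs]
      calc _ ≤ (2 * β⁻¹ / n) ^ 2 := by gcongr
        _ = 4 * β⁻¹ ^ 2 / n * (n:ℝ)⁻¹ := by ring
        _ ≤ _ := by gcongr
    have c0 : 0 ≤ cfull n N θ j 0 ^ 2 := sq_nonneg _
    have f1 : v * ((n:ℝ) - j)⁻¹ ≤ β⁻¹ ^ 2 / n * (N:ℝ)⁻¹ := by
      calc _ ≤ (N:ℝ)⁻¹ * (β⁻¹ / n) := by gcongr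
        _ ≤ (N:ℝ)⁻¹ * (β⁻¹ ^ 2 / n) := by
          have : β⁻¹ ≤ β⁻¹ ^ 2 := by nlinarith
          gcongr
        _ = _ := by ring
    have f2 : v * (n:ℝ)⁻¹ ≤ β⁻¹ ^ 2 / n * (N:ℝ)⁻¹ := by
      calc _ ≤ (N:ℝ)⁻¹ * (1 / n) := by rw [one_div]; exact mul_le_mul_of_nonneg_right hv1 hi.le
        _ ≤ (N:ℝ)⁻¹ * (β⁻¹ ^ 2 / n) := by
          have : 1 ≤ β⁻¹ ^ 2 := by nlinarith
          gcongr
        _ = _ := by ring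
    have e : dY n N j ^ 2 + 2 * ((1 - v) ^ 2 * ((n:ℝ) - j)⁻¹ - 2 * (1 - v) * θ * (n:ℝ)⁻¹ + θ ^ 2 * (n:ℝ)⁻¹ - cfull n N θ j 0 ^ 2) - 2 * (((n:ℝ) - j)⁻¹ - θ * (2 - θ) * (n:ℝ)⁻¹)
       = dY n N j ^ 2 - 2 * cfull n N θ j 0 ^ 2 + - 4 * (v * ((n:ℝ) - j)⁻¹) + 2 * (v * (v * ((n:ℝ) - j)⁻¹)) + 4 * (θ * (v * (n:ℝ)⁻¹)) := by ring
    rw [e]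
    have f10 : 0 ≤ v * ((n:ℝ) - j)⁻¹ := by positivity
    have f20 : 0 ≤ v * (n:ℝ)⁻¹ := by positivity
    set T := β⁻¹ ^ 2 / n * (N:ℝ)⁻¹ with hT
    have hT4 : 4 * β⁻¹ ^ 2 / n * (N:ℝ)⁻¹ = 4 * T := by rw [hT]; ring
    have hT24 : 24 * β⁻¹ ^ 2 / n * (N:ℝ)⁻¹ = 24 * T := by rw [hT]; ring
    rw [hT4] at d2 c2
    rw [hT24, abs_le]
    have : v ≤ 1 := by linarith
    have g1 := mul_nonneg hv0 f10
    have g2 := mul_nonneg hθ f20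
    have g3 := mul_le_of_le_one_left f10 this
    have g4 := mul_le_of_le_one_left f20 hθ1
    constructor <;> linarith
  refine (Finset.abs_sum_le_sum_abs _ _).trans ((Finset.sum_le_sum key).trans ?_)
  rw [Finset.sum_const, Finset.card_range, nsmul_eq_mul]
  apply le_of_eq
  field_simp

/-- transfer of the law of the volume to the normalised logarithm -/
lemma law {r : ℕ} (h : Ctx n (r + 1) θ β C μ lam W) {s : ℝ} (hs : 0 < s) (F : ℝ → ℝ) (hF : Continuous F) :
    ∫ X, F (simplexVol n r X) ∂(Measure.pi fun _ : Fin (r + 1) => μ) =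
      ∫ y, F (refVol r * Real.exp (Kc n (r + 1) θ lam W / 2) * Real.exp (s * y / 2)) ∂((PP n lam).map (TT n (r + 1) θ lam W s)) := by
  have := h.hN8
  rw [law_simplexVol h.rep (by omega) F hF, integral_map (h.TT_meas s).aemeasurable]
  · apply integral_congr_ae
    filter_upwards [h.expansion] with ω ⟨_, hp, _⟩
    congr 1
    rw [mul_assoc, ← Real.exp_add]
    congr 1
    rw [Real.sqrt_eq_rpow, Real.rpow_def_of_pos hp]
    congr 1
    unfold TT
    field_simp
    ring
  · apply Continuous.aestronglyMeasurable; fun_prop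

end Ctx

end

section
open MeasureTheory ProbabilityTheory Real Filter Finset
set_option linter.all false

/-- A model that can be treated by the general theory. -/
def Mdl (θ : ℝ) (μ : (n : ℕ) → Measure (EuclideanSpace ℝ (Fin n))) : Prop :=
  ∀ β : ℝ, 0 < β → β ≤ 1 → ∃ C : ℝ, 1 ≤ C ∧ ∃ n0 : ℕ, ∀ n ≥ n0, ∃ lm : ℝ, 0 < lm ∧
    ∃ (μ' : Measure (EuclideanSpace ℝ (Fin n))) (lam : Measure ℝ) (W : Smp n → ℝ),
      GRep n μ' lam W ∧ GoodW n θ β C lam W ∧ ∀ (r : ℕ) (F : ℝ → ℝ), Continuous F →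
        ∫ X, F (simplexVol n r X) ∂(Measure.pi fun _ : Fin (r + 1) => μ n) =
        ∫ X, F (lm ^ r * simplexVol n r X) ∂(Measure.pi fun _ : Fin (r + 1) => μ')

/-- data attached to one dimension -/
def Dat (n N : ℕ) (θ β C s : ℝ) (ρ : ProbabilityMeasure ℝ) : Prop :=
  ∃ (_ : NeZero n) (μ : Measure (EuclideanSpace ℝ (Fin n))) (lam : Measure ℝ) (W : Smp n → ℝ),
    Ctx n N θ β C μ lam W ∧ s = √(VV n N θ) ∧ (ρ : Measure ℝ) = (PP n lam).map (Ctx.TT n N θ lam W s)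

lemma Dat.ge {n N : ℕ} {θ β C s : ℝ} {ρ : ProbabilityMeasure ℝ} (h : Dat n N θ β C s ρ) : 1 / (n:ℝ) ≤ s ^ 2 := by
  obtain ⟨_, μ, lam, W, h, hs, _⟩ := h
  rw [hs, Real.sq_sqrt]
  · exact h.VV_ge
  · exact le_trans (by positivity) h.VV_ge

lemma Dat.approx {n N : ℕ} {θ β C s : ℝ} {ρ : ProbabilityMeasure ℝ} (h : Dat n N θ β C s ρ) :
    |s ^ 2 - 2 * (Real.log (n / (n - N)) - N * (θ * (2 - θ) * (n:ℝ)⁻¹))| ≤ 26 * β⁻¹ ^ 2 / n := by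
  obtain ⟨_, μ, lam, W, h, hs, _⟩ := h
  obtain ⟨hn0, hn1, hnsq, hb1⟩ := h.bounds
  rw [hs, Real.sq_sqrt (le_trans (by positivity) h.VV_ge)]
  have hb := h.hb
  have hβ := h.hβ
  obtain ⟨h1, h2⟩ := harm_bounds (show N < n by have := h.hN8; omega)
  have h3 := h.VV_approx
  have hinv : ((n:ℝ) - N)⁻¹ ≤ β⁻¹ ^ 2 / n := by
    calc _ ≤ (β * n)⁻¹ := by gcongr
      _ = β⁻¹ / n := by rw [mul_inv]; ring
      _ ≤ _ := by gcongr; nlinarith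
  have : 0 < (n:ℝ)⁻¹ := by positivity
  have e1 : 24 * β⁻¹ ^ 2 / (n:ℝ) = 24 * (β⁻¹ ^ 2 / n) := by ring
  have e2 : 26 * β⁻¹ ^ 2 / (n:ℝ) = 26 * (β⁻¹ ^ 2 / n) := by ring
  rw [e1, abs_le] at h3
  rw [e2, abs_le]
  constructor <;> linarith [h3.1, h3.2]

lemma Dat.clt {β C t ε : ℝ} (hε : 0 < ε) : ∃ η > 0, ∀ (n N : ℕ) (θ s : ℝ) (ρ : ProbabilityMeasure ℝ), Dat n N θ β C s ρ →
    1 / √(n:ℝ) ≤ η → √N / (n * s) ≤ η → ‖charFun (ρ : Measure ℝ) t - Complex.exp ((-t ^ 2 / 2 : ℝ))‖ ≤ ε := by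
  obtain ⟨η, hη, h⟩ := clt_T (β := β) (C := C) (t := t) hε
  refine ⟨η, hη, ?_⟩
  rintro n N θ s ρ ⟨_, μ, lam, W, hc, hs, hρ⟩ h1 h2
  rw [hρ, hs]
  subst hs
  exact h n N θ μ lam W hc h1 h2

lemma exists_dat {θ : ℝ} (hθ : 0 ≤ θ) (hθ1 : θ ≤ 1) {μ : (n : ℕ) → Measure (EuclideanSpace ℝ (Fin n))} (hM : Mdl θ μ) {β : ℝ} (hβ : 0 < β) (hβ1 : β ≤ 1) :
    ∃ C n0, ∀ n ≥ n0, ∀ r : ℕ, 1 ≤ r → r + 9 ≤ n → β * n ≤ n - (r + 1) → ∃ K s : ℝ, ∃ ρ : ProbabilityMeasure ℝ, 0 < K ∧ 0 < s ∧ Dat n (r + 1) θ β C s ρ ∧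
      ∀ F : ℝ → ℝ, Continuous F → ∫ X, F (simplexVol n r X) ∂(Measure.pi fun _ : Fin (r + 1) => μ n) = ∫ y, F (K * Real.exp (s * y / 2)) ∂(ρ : Measure ℝ) := by
  obtain ⟨C, hC, n0, h⟩ := hM β hβ hβ1
  refine ⟨C, n0, fun n hn r hr hr9 hb => ?_⟩
  obtain ⟨lm, hlm, μ', lam, W, hG, hW, hF⟩ := h n hn
  haveI : NeZero n := ⟨by omega⟩
  have hc : Ctx n (r + 1) θ β C μ' lam W := ⟨hG, hW, hβ, hβ1, hC, hθ, hθ1, by omega, by omega, by push_cast; exact hb⟩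
  have hV : 0 < VV n (r + 1) θ := lt_of_lt_of_le (by have := hc.bounds.1; positivity) hc.VV_ge
  have hs := Real.sqrt_pos.2 hV
  haveI := hG.prob
  haveI : IsProbabilityMeasure ((PP n lam).map (Ctx.TT n (r + 1) θ lam W (√(VV n (r + 1) θ)))) := Measure.isProbabilityMeasure_map (hc.TT_meas _).aemeasurable
  refine ⟨lm ^ r * (refVol r * Real.exp (Ctx.Kc n (r + 1) θ lam W / 2)), √(VV n (r + 1) θ), ⟨_, this⟩, ?_, hs, ⟨inferInstance, μ', lam, W, hc, rfl, rfl⟩, ?_⟩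
  · have := refVol_pos r
    positivity
  · intro F hFc
    rw [hF r F hFc]
    have := hc.law hs (fun x => F (lm ^ r * x)) (by fun_prop)
    rw [this]
    simp only [mul_assoc]
    rfl

/-- the standard Gaussian law on the line -/
noncomputable def gPM : ProbabilityMeasure ℝ := ⟨gaussianReal 0 1, inferInstance⟩

theorem limit_thm {θ : ℝ} (hθ : 0 ≤ θ) (hθ1 : θ ≤ 1) {μ : (n : ℕ) → Measure (EuclideanSpace ℝ (Fin n))} (hM : Mdl θ μ)
    (r : ℕ → ℕ) (hr : ∀ n, 1 ≤ n → 1 ≤ r n) {α : ℝ} (hα0 : 0 ≤ α) (hα1 : α < 1) (hlim : Tendsto (fun n : ℕ => (r n : ℝ) / n) atTop (nhds α))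
    (hα : α = 0 ∨ 0 < Real.log (1 / (1 - α)) - θ * (2 - θ) * α) :
    ∃ (K s : ℕ → ℝ) (ρ : ℕ → ProbabilityMeasure ℝ), (∀ n, 0 < K n) ∧ (∀ n, 0 < s n) ∧
      Tendsto s atTop (nhds (√(2 * (Real.log (1 / (1 - α)) - θ * (2 - θ) * α)))) ∧
      Tendsto ρ atTop (nhds gPM) ∧
      ∀ᶠ n in atTop, ∀ F : ℝ → ℝ, Continuous F → ∫ X, F (simplexVol n (r n) X) ∂(Measure.pi fun _ : Fin (r n + 1) => μ n) = ∫ y, F (K n * Real.exp (s n * y / 2)) ∂(ρ n : Measure ℝ) := by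
  set β := (1 - α) / 2 with hβ
  have hβ0 : 0 < β := by rw [hβ]; linarith
  have hβ1 : β ≤ 1 := by rw [hβ]; linarith
  obtain ⟨C, n0, hex⟩ := exists_dat hθ hθ1 hM hβ0 hβ1
  have hinv : Tendsto (fun n : ℕ => (n:ℝ)⁻¹) atTop (nhds 0) := tendsto_inv_atTop_nhds_zero_nat
  have hN : Tendsto (fun n : ℕ => ((r n + 1 : ℕ) : ℝ) / n) atTop (nhds α) := by
    have := hlim.add hinv
    rw [add_zero] at this
    refine this.congr fun n => ?_
    push_cast; ring
  have hev1 : ∀ᶠ n : ℕ in atTop, ((r n + 1 : ℕ) : ℝ) / n < 1 - β := hN.eventually (gt_mem_nhds (by rw [hβ]; linarith))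
  have hgood : ∀ᶠ n : ℕ in atTop, n0 ≤ n ∧ 1 ≤ n ∧ r n + 9 ≤ n ∧ β * n ≤ n - (r n + 1) := by
    filter_upwards [hev1, eventually_ge_atTop n0, eventually_ge_atTop 1, eventually_ge_atTop (Nat.ceil (8 / β))] with n h1 h2 h3 h4
    have hn : (1:ℝ) ≤ n := by exact_mod_cast h3
    have h5 : 8 / β ≤ n := Nat.ceil_le.1 h4
    rw [div_lt_iff₀ (by linarith)] at h1
    rw [div_le_iff₀ hβ0] at h5
    push_cast at h1
    refine ⟨h2, h3, ?_, by linarith⟩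
    have : ((r n + 9 : ℕ) : ℝ) ≤ n := by push_cast; linarith
    exact_mod_cast this
  have hall : ∀ n, ∃ K s : ℝ, ∃ ρ : ProbabilityMeasure ℝ, 0 < K ∧ 0 < s ∧ ((n0 ≤ n ∧ 1 ≤ n ∧ r n + 9 ≤ n ∧ β * n ≤ n - (r n + 1)) → Dat n (r n + 1) θ β C s ρ ∧
      ∀ F : ℝ → ℝ, Continuous F → ∫ X, F (simplexVol n (r n) X) ∂(Measure.pi fun _ : Fin (r n + 1) => μ n) = ∫ y, F (K * Real.exp (s * y / 2)) ∂(ρ : Measure ℝ)) := by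
    intro n
    by_cases hc : (n0 ≤ n ∧ 1 ≤ n ∧ r n + 9 ≤ n ∧ β * n ≤ n - (r n + 1))
    · obtain ⟨K, s, ρ, h1, h2, h3⟩ := hex n hc.1 (r n) (hr n hc.2.1) hc.2.2.1 hc.2.2.2
      exact ⟨K, s, ρ, h1, h2, fun _ => h3⟩
    · exact ⟨1, 1, ⟨gaussianReal 0 1, inferInstance⟩, one_pos, one_pos, fun h => absurd h hc⟩
  choose K s ρ hK hs hD using hall
  have hDat : ∀ᶠ n in atTop, Dat n (r n + 1) θ β C (s n) (ρ n) := hgood.mono fun n h => (hD n h).1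
  set L := 2 * (Real.log (1 / (1 - α)) - θ * (2 - θ) * α) with hL
  have hs2 : Tendsto (fun n => s n ^ 2) atTop (nhds L) := by
    have t1 : Tendsto (fun n : ℕ => 2 * (Real.log (n / (n - (r n + 1 : ℕ))) - (r n + 1 : ℕ) * (θ * (2 - θ) * (n:ℝ)⁻¹))) atTop (nhds L) := by
      have t2 : Tendsto (fun n : ℕ => 2 * (Real.log (1 / (1 - ((r n + 1 : ℕ) : ℝ) / n)) - θ * (2 - θ) * (((r n + 1 : ℕ) : ℝ) / n))) atTop (nhds L) := by
        refine ((Tendsto.log ((tendsto_const_nhds (x := (1:ℝ))).div (tendsto_const_nhds.sub hN) (by linarith)) ?_).sub (hN.const_mul _)).const_mul 2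
        have : 0 < 1 - α := by linarith
        positivity
      refine t2.congr' ?_
      filter_upwards [eventually_ge_atTop 1] with n hn
      have : (n:ℝ) ≠ 0 := by positivity
      have e : (1:ℝ) / (1 - ((r n + 1 : ℕ) : ℝ) / n) = n / (n - (r n + 1 : ℕ)) := by
        rw [one_sub_div this, one_div_div]
      rw [e]; ring
    have t3 : Tendsto (fun n => s n ^ 2 - 2 * (Real.log (n / (n - (r n + 1 : ℕ))) - (r n + 1 : ℕ) * (θ * (2 - θ) * (n:ℝ)⁻¹))) atTop (nhds 0) := by
      apply squeeze_zero_norm' (a := fun n : ℕ => 26 * β⁻¹ ^ 2 / (n:ℝ))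
      · filter_upwards [hDat] with n h
        exact h.approx
      · exact tendsto_const_div_atTop_nhds_zero_nat _
    have := t3.add t1
    simp only [sub_add_cancel, zero_add] at this
    exact this
  have hsl : Tendsto s atTop (nhds (√L)) := by
    have := (Real.continuous_sqrt.tendsto L).comp hs2
    refine this.congr fun n => ?_
    simp [Real.sqrt_sq (hs n).le]
  have hq : Tendsto (fun n : ℕ => 1 / √(n:ℝ)) atTop (nhds 0) := by
    have := (Real.continuous_sqrt.tendsto 0).comp hinv
    rw [Real.sqrt_zero] at this
    refine this.congr fun n => ?_
    simp [Real.sqrt_inv]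
  have hq2 : Tendsto (fun n : ℕ => √((r n + 1 : ℕ) : ℝ) / (n * s n)) atTop (nhds 0) := by
    rcases hα with h0 | h0
    · have t1 : Tendsto (fun n : ℕ => √(((r n + 1 : ℕ) : ℝ) / n)) atTop (nhds 0) := by
        have := (Real.continuous_sqrt.tendsto α).comp hN
        rw [h0, Real.sqrt_zero] at this
        exact this
      refine squeeze_zero' (Eventually.of_forall fun n => by have := hs n; positivity) ?_ t1
      filter_upwards [hDat, eventually_ge_atTop 1] with n h hn
      have hn0 : (0:ℝ) < n := by positivity
      have h1 := h.ge
      have h2 := hs n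
      rw [div_le_iff₀ (by positivity)]
      have : 1 ≤ √(n:ℝ) * s n := by
        rw [div_le_iff₀ hn0] at h1
        have hsq := Real.sq_sqrt hn0.le
        have : 1 ≤ (√(n:ℝ) * s n) ^ 2 := by rw [mul_pow, hsq]; linarith
        have h4 : 0 ≤ √(n:ℝ) * s n := by positivity
        nlinarith
      rw [Real.sqrt_div (by positivity)]
      have hsn : 0 < √(n:ℝ) := Real.sqrt_pos.2 hn0
      have e : √((r n + 1 : ℕ) : ℝ) / √n * (n * s n) = √((r n + 1 : ℕ) : ℝ) * (√n * s n) := by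
        nth_rewrite 2 [← Real.sq_sqrt hn0.le]
        field_simp
      rw [e]
      exact le_mul_of_one_le_right (Real.sqrt_nonneg _) this
    · have t1 : Tendsto (fun n : ℕ => √(((r n + 1 : ℕ) : ℝ) / n) * (1 / √(n:ℝ)) * (s n)⁻¹) atTop (nhds (√α * 0 * (√L)⁻¹)) := by
        have hL0 : 0 < √L := Real.sqrt_pos.2 (by rw [hL]; linarith)
        exact (((Real.continuous_sqrt.tendsto α).comp hN).mul hq).mul (hsl.inv₀ hL0.ne')
      rw [mul_zero, zero_mul] at t1
      refine t1.congr' ?_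
      filter_upwards [eventually_ge_atTop 1] with n hn
      have hn0 : (0:ℝ) < n := by positivity
      have hsn : 0 < √(n:ℝ) := Real.sqrt_pos.2 hn0
      have h2 := hs n
      rw [Real.sqrt_div (by positivity)]
      rw [show (n:ℝ) * s n = √(n:ℝ) * √(n:ℝ) * s n by rw [Real.mul_self_sqrt hn0.le]]
      field_simp
  refine ⟨K, s, ρ, hK, hs, hsl, ?_, hgood.mono fun n h => (hD n h).2⟩
  rw [ProbabilityMeasure.tendsto_iff_tendsto_charFun]
  intro t
  rw [Metric.tendsto_nhds]
  intro ε hε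
  obtain ⟨η, hη, hclt⟩ := Dat.clt (β := β) (C := C) (t := t) (half_pos hε)
  filter_upwards [hDat, hq.eventually (gt_mem_nhds hη), hq2.eventually (gt_mem_nhds hη)] with n h1 h2 h3
  have := hclt n (r n + 1) θ (s n) (ρ n) h1 h2.le h3.le
  have e : charFun (gPM : Measure ℝ) t = Complex.exp ((-t ^ 2 / 2 : ℝ)) := by
    show charFun (gaussianReal 0 1) t = _
    rw [charFun_gaussianReal]; congr 1; push_cast; ring
  rw [e, dist_eq_norm]
  linarith

end

section
open MeasureTheory ProbabilityTheory Real Filter Finset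
set_option linter.all false

lemma joint_limit {ρ : ℕ → ProbabilityMeasure ℝ} {ρ0 : ProbabilityMeasure ℝ} {s : ℕ → ℝ} {s0 : ℝ} (hρ : Tendsto ρ atTop (nhds ρ0)) (hs : Tendsto s atTop (nhds s0))
    (f : BoundedContinuousFunction ℝ ℝ) (g : ℝ × ℝ → ℝ) (hg : Continuous g) :
    Tendsto (fun n => ∫ y, f (g (s n, y)) ∂(ρ n : Measure ℝ)) atTop (nhds (∫ y, f (g (s0, y)) ∂(ρ0 : Measure ℝ))) := by
  have h1 : Tendsto (fun n => (diracProba (s n)).prod (ρ n)) atTop (nhds ((diracProba s0).prod ρ0)) :=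
    (ProbabilityMeasure.continuous_prod.tendsto (diracProba s0, ρ0)).comp (((continuous_diracProba.tendsto s0).comp hs).prodMk_nhds hρ)
  rw [ProbabilityMeasure.tendsto_iff_forall_integral_tendsto] at h1
  have h2 := h1 (f.compContinuous ⟨g, hg⟩)
  have e : ∀ (a : ℝ) (ν : ProbabilityMeasure ℝ), ∫ x, (f.compContinuous ⟨g, hg⟩) x ∂(((diracProba a).prod ν : ProbabilityMeasure (ℝ × ℝ)) : Measure (ℝ × ℝ)) = ∫ y, f (g (a, y)) ∂(ν : Measure ℝ) := by
    intro a ν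
    rw [ProbabilityMeasure.toMeasure_prod]
    show ∫ x, f (g x) ∂(Measure.dirac a).prod (ν : Measure ℝ) = _
    rw [Measure.dirac_prod, integral_map (by fun_prop)]
    apply Continuous.aestronglyMeasurable
    exact f.continuous.comp hg
  simp only [e] at h2
  exact h2

lemma cont_phi : Continuous (dslope Real.exp 0) := by
  rw [← continuousOn_univ, continuousOn_dslope univ_mem]
  exact ⟨Real.continuous_exp.continuousOn, Real.differentiableAt_exp⟩

variable {θ : ℝ} {μ : (n : ℕ) → Measure (EuclideanSpace ℝ (Fin n))}

theorem concl_one (hθ : 0 ≤ θ) (hθ1 : θ ≤ 1) (hM : Mdl θ μ)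
    (r : ℕ → ℕ) (hr : ∀ n, 1 ≤ n → 1 ≤ r n) (hlim : Tendsto (fun n : ℕ => (r n : ℝ) / n) atTop (nhds 0)) :
    ∃ a b : ℕ → ℝ, (∀ n, 0 < b n) ∧ ∀ f : BoundedContinuousFunction ℝ ℝ,
          Tendsto (fun n : ℕ => ∫ X, f ((simplexVol n (r n) X - a n) / b n) ∂(Measure.pi fun _ : Fin (r n + 1) => μ n))
            atTop (nhds (∫ z, f z ∂gaussianReal 0 1)) := by
  obtain ⟨K, s, ρ, hK, hs, hsl, hρ, hlaw⟩ := limit_thm hθ hθ1 hM r hr le_rfl one_pos hlim (Or.inl rfl)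
  refine ⟨K, fun n => K n * (s n / 2), fun n => mul_pos (hK n) (half_pos (hs n)), fun f => ?_⟩
  have hs0 : Tendsto s atTop (nhds 0) := by simpa using hsl
  have h := joint_limit hρ hs0 f (fun p => p.2 * dslope Real.exp 0 (p.1 * p.2 / 2)) (by have := cont_phi; fun_prop)
  have e0 : ∫ y, f (y * dslope Real.exp 0 (0 * y / 2)) ∂(gPM : Measure ℝ) = ∫ z, f z ∂gaussianReal 0 1 := by
    show ∫ y, f (y * dslope Real.exp 0 (0 * y / 2)) ∂gaussianReal 0 1 = _
    simp
  beta_reduce at h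
  rw [e0] at h
  refine h.congr' ?_
  filter_upwards [hlaw] with n hn
  rw [hn (fun x => f ((x - K n) / (K n * (s n / 2)))) (by fun_prop)]
  congr 1
  funext y
  congr 1
  have h1 := sub_smul_dslope Real.exp 0 (s n * y / 2)
  rw [sub_zero, Real.exp_zero, smul_eq_mul] at h1
  have := hK n; have := hs n
  rw [eq_div_iff (by positivity)]
  linear_combination K n * h1

theorem concl_two (hθ : 0 ≤ θ) (hθ1 : θ ≤ 1) (hM : Mdl θ μ)
    (r : ℕ → ℕ) (hr : ∀ n, 1 ≤ n → 1 ≤ r n) {α : ℝ} (hα : α ∈ Set.Ioo (0:ℝ) 1) (hlim : Tendsto (fun n : ℕ => (r n : ℝ) / n) atTop (nhds α)) :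
    ∃ b : ℕ → ℝ, (∀ n, 0 < b n) ∧ ∀ f : BoundedContinuousFunction ℝ ℝ,
          Tendsto (fun n : ℕ => ∫ X, f (simplexVol n (r n) X / b n) ∂(Measure.pi fun _ : Fin (r n + 1) => μ n))
            atTop (nhds (∫ z, f (Real.exp (√(1 / 2 * Real.log (1 / (1 - α)) - θ * (2 - θ) * α / 2) * z)) ∂gaussianReal 0 1)) := by
  have hpos : 0 < Real.log (1 / (1 - α)) - θ * (2 - θ) * α := by
    have h1 := Real.log_lt_sub_one_of_pos (show 0 < 1 - α by linarith [hα.2]) (by linarith [hα.1])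
    rw [one_div, Real.log_inv]
    have : θ * (2 - θ) ≤ 1 := by nlinarith [sq_nonneg (θ - 1)]
    nlinarith [hα.1]
  obtain ⟨K, s, ρ, hK, hs, hsl, hρ, hlaw⟩ := limit_thm hθ hθ1 hM r hr hα.1.le hα.2 hlim (Or.inr hpos)
  refine ⟨K, hK, fun f => ?_⟩
  have h := joint_limit hρ hsl f (fun p => Real.exp (p.1 * p.2 / 2)) (by fun_prop)
  beta_reduce at h
  have e0 : ∀ y : ℝ, √(2 * (Real.log (1 / (1 - α)) - θ * (2 - θ) * α)) * y / 2 = √(1 / 2 * Real.log (1 / (1 - α)) - θ * (2 - θ) * α / 2) * y := by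
    intro y
    have : 2 * (Real.log (1 / (1 - α)) - θ * (2 - θ) * α) = 2 ^ 2 * (1 / 2 * Real.log (1 / (1 - α)) - θ * (2 - θ) * α / 2) := by ring
    rw [this, Real.sqrt_mul (by positivity), Real.sqrt_sq (by norm_num)]; ring
  simp only [e0] at h
  refine h.congr' ?_
  filter_upwards [hlaw] with n hn
  rw [hn (fun x => f (x / K n)) (by fun_prop)]
  congr 1
  funext y
  congr 1
  have := hK n
  field_simp

end

section
open MeasureTheory ProbabilityTheory Real Filter Finset
set_option linter.all false

lemma simplexVol_smul {n r : ℕ} {c : ℝ} (hc : 0 ≤ c) (X : Fin (r + 1) → EuclideanSpace ℝ (Fin n)) :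
    simplexVol n r (fun i => c • X i) = c ^ r * simplexVol n r X := by
  rw [simplexVol_eq, simplexVol_eq]
  have : (Matrix.gram ℝ fun i : Fin r => c • X i.succ - c • X 0) = (c ^ 2) • (Matrix.gram ℝ fun i : Fin r => X i.succ - X 0) := by
    ext i j
    simp only [Matrix.gram_apply, Matrix.smul_apply, ← smul_sub, inner_smul_left, inner_smul_right, smul_eq_mul]
    simp; ring
  rw [this, Matrix.det_smul, Fintype.card_fin, Real.sqrt_mul (by positivity), ← pow_mul, mul_comm 2 r, pow_mul, Real.sqrt_sq (by positivity)]
  ring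

lemma simplexVol_cont (n r : ℕ) : Continuous (simplexVol n r) := by
  have : simplexVol n r = fun X => refVol r * √((Matrix.gram ℝ fun i : Fin r => X i.succ - X 0).det) := funext (simplexVol_eq n r)
  rw [this]
  refine continuous_const.mul (Real.continuous_sqrt.comp (Continuous.matrix_det ?_))
  refine continuous_matrix fun i j => ?_
  simp only [Matrix.gram_apply]
  fun_prop

lemma scale_law {n : ℕ} {μ' : Measure (EuclideanSpace ℝ (Fin n))} [IsProbabilityMeasure μ'] {c : ℝ} (hc : 0 ≤ c) (r : ℕ) (F : ℝ → ℝ) (hF : Continuous F) :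
    ∫ X, F (simplexVol n r X) ∂(Measure.pi fun _ : Fin (r + 1) => μ'.map fun x => c • x) = ∫ X, F (c ^ r * simplexVol n r X) ∂(Measure.pi fun _ : Fin (r + 1) => μ') := by
  have hm : Measurable fun x : EuclideanSpace ℝ (Fin n) => c • x := by fun_prop
  haveI : IsProbabilityMeasure (μ'.map fun x => c • x) := Measure.isProbabilityMeasure_map hm.aemeasurable
  rw [← Measure.pi_map_pi (fun _ => hm.aemeasurable), integral_map]
  · simp only [simplexVol_smul hc]
  · exact (by fun_prop : Measurable fun x : Fin (r + 1) → EuclideanSpace ℝ (Fin n) => fun i => c • x i).aemeasurable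
  · exact (hF.comp (simplexVol_cont n r)).aestronglyMeasurable

lemma lintegral_gauss (n : ℕ) : IsFiniteMeasure (_root_.stdGaussian n) := by
  unfold _root_.stdGaussian
  have h := (GaussianFourier.integrable_cexp_neg_mul_sq_norm_add (V := EuclideanSpace ℝ (Fin n)) (b := 1 / 2) (by norm_num) 0 0).norm.const_mul ((2 * π) ^ (-(n : ℝ) / 2))
  apply isFiniteMeasure_withDensity_ofReal
  refine Integrable.hasFiniteIntegral ?_
  refine h.congr (ae_of_all _ fun x => ?_)
  beta_reduce
  rw [Complex.norm_exp]
  congr 2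
  simp [← Complex.ofReal_pow]; ring

lemma gauss_eq (n : ℕ) : _root_.stdGaussian n = ProbabilityTheory.stdGaussian (EuclideanSpace ℝ (Fin n)) := by
  haveI := lintegral_gauss n
  apply Measure.ext_of_charFun
  ext t
  rw [charFun_stdGaussian, charFun_apply, _root_.stdGaussian, integral_withDensity_eq_integral_toReal_smul (by fun_prop) (ae_of_all _ fun x => ENNReal.ofReal_lt_top)]
  have e : ∀ x : EuclideanSpace ℝ (Fin n), (ENNReal.ofReal ((2 * π) ^ (-(n : ℝ) / 2) * Real.exp (-‖x‖ ^ 2 / 2))).toReal • Complex.exp (inner ℝ x t * Complex.I) = (((2 * π) ^ (-(n : ℝ) / 2) : ℝ) : ℂ) * Complex.exp (-(1 / 2 : ℂ) * ‖x‖ ^ 2 + Complex.I * inner ℝ t x) := by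
    intro x
    rw [ENNReal.toReal_ofReal (by positivity), Complex.exp_add, real_inner_comm, Complex.real_smul]
    push_cast
    rw [mul_assoc]
    congr 3
    · ring
    · ring
  simp only [e]
  rw [integral_const_mul, GaussianFourier.integral_cexp_neg_mul_sq_norm_add (by norm_num)]
  rw [← mul_assoc]
  have e1 : (((2 * π) ^ (-(n : ℝ) / 2) : ℝ) : ℂ) * (π / (1 / 2 : ℂ)) ^ ((Module.finrank ℝ (EuclideanSpace ℝ (Fin n)) : ℂ) / 2) = 1 := by
    have : (π / (1 / 2 : ℂ)) ^ ((Module.finrank ℝ (EuclideanSpace ℝ (Fin n)) : ℂ) / 2) = (((2 * π) ^ ((n : ℝ) / 2) : ℝ) : ℂ) := by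
      rw [Complex.ofReal_cpow (by positivity)]
      congr 1
      · push_cast; ring
      · simp
    rw [this, ← Complex.ofReal_mul, ← Real.rpow_add (by positivity)]
    simp [neg_div]
  rw [e1, one_mul]
  congr 1
  rw [Complex.I_sq]; ring

lemma gauss_map (n : ℕ) : _root_.stdGaussian n = (Measure.pi fun _ : Fin n => gaussianReal 0 1).map (WithLp.toLp 2) := by
  rw [gauss_eq, map_pi_eq_stdGaussian]

theorem mdl_gauss {μ : (n : ℕ) → Measure (EuclideanSpace ℝ (Fin n))} (h : ∀ n, μ n = _root_.stdGaussian n) : Mdl 0 μ := by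
  intro β hβ hβ1
  refine ⟨8 / β, ?_, 8, fun n hn => ?_⟩
  · rw [one_le_div hβ]; linarith
  have hn0 : (0:ℝ) < n := by positivity
  have hsn : 0 < √(n:ℝ) := Real.sqrt_pos.2 hn0
  have hG : GRep n ((kap n (Measure.dirac 0)).map fun s => (√(n:ℝ))⁻¹ • WithLp.toLp 2 s.1) (Measure.dirac 0) (fun _ => √n) :=
    ⟨inferInstance, ⟨fun _ => √n, measurable_const, fun _ => rfl⟩, ae_of_all _ fun _ => hsn, rfl⟩
  refine ⟨√n, hsn, _, _, _, hG, goodW_gauss hn hβ hβ1, fun r F hF => ?_⟩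
  have hm : Measurable fun s : Smp n => (√(n:ℝ))⁻¹ • WithLp.toLp 2 s.1 := by fun_prop
  haveI : IsProbabilityMeasure (kap n (Measure.dirac 0)) := by unfold kap; infer_instance
  haveI := Measure.isProbabilityMeasure_map (μ := kap n (Measure.dirac 0)) hm.aemeasurable
  rw [← scale_law hsn.le r F hF, Measure.map_map (by fun_prop) hm]
  have : ((kap n (Measure.dirac 0)).map ((fun x => √(n:ℝ) • x) ∘ fun s => (√(n:ℝ))⁻¹ • WithLp.toLp 2 s.1)) = μ n := by
    rw [h, gauss_map]
    have e : ((fun x : EuclideanSpace ℝ (Fin n) => √(n:ℝ) • x) ∘ fun s : Smp n => (√(n:ℝ))⁻¹ • WithLp.toLp 2 s.1) = (WithLp.toLp 2) ∘ Prod.fst := by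
      funext s
      simp [smul_smul, hsn.ne']
    rw [e, ← Measure.map_map (by fun_prop) measurable_fst, kap_map_fst]
  rw [this]

end

section
open MeasureTheory ProbabilityTheory Real Filter Finset
set_option linter.all false

/-- rotation invariance -/
def RotInv {n : ℕ} (μ : Measure (EuclideanSpace ℝ (Fin n))) : Prop :=
  ∀ e : EuclideanSpace ℝ (Fin n) ≃ₗᵢ[ℝ] EuclideanSpace ℝ (Fin n), μ.map e = μ

lemma RotInv.charFun_eq {n : ℕ} {μ : Measure (EuclideanSpace ℝ (Fin n))} (h : RotInv μ) {u t : EuclideanSpace ℝ (Fin n)} (hut : ‖u‖ = ‖t‖) :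
    charFun μ u = charFun μ t := by
  set e := (Submodule.span ℝ {u - t})ᗮ.reflection with he
  have h1 : e u = t := Submodule.reflection_sub hut
  conv_rhs => rw [← h e]
  rw [charFun_apply, charFun_apply, integral_map (by fun_prop) (by apply Continuous.aestronglyMeasurable; fun_prop)]
  simp only [← h1, LinearIsometryEquiv.inner_map_map]

lemma RotInv.rep {n : ℕ} [NeZero n] {μ : Measure (EuclideanSpace ℝ (Fin n))} [IsProbabilityMeasure μ] (h : RotInv μ) (g : Measure (EuclideanSpace ℝ (Fin n))) [IsProbabilityMeasure g]
    (hg : RotInv g) (hg0 : ∀ᵐ x ∂g, x ≠ 0) :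
    μ = (g.prod μ).map fun p => (‖p.2‖ / ‖p.1‖) • p.1 := by
  have hm : Measurable fun p : EuclideanSpace ℝ (Fin n) × EuclideanSpace ℝ (Fin n) => (‖p.2‖ / ‖p.1‖) • p.1 := by fun_prop
  haveI : IsProbabilityMeasure ((g.prod μ).map fun p => (‖p.2‖ / ‖p.1‖) • p.1) := Measure.isProbabilityMeasure_map hm.aemeasurable
  -- the law of the direction
  set g1 := g.map (fun x : EuclideanSpace ℝ (Fin n) => ‖x‖⁻¹ • x) with hg1
  have hm1 : Measurable (fun x : EuclideanSpace ℝ (Fin n) => ‖x‖⁻¹ • x) := by fun_prop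
  haveI : IsProbabilityMeasure g1 := Measure.isProbabilityMeasure_map hm1.aemeasurable
  have hg1inv : RotInv g1 := by
    intro e
    rw [hg1, Measure.map_map (by fun_prop) hm1]
    conv_rhs => rw [← hg e]
    rw [Measure.map_map hm1 (by fun_prop)]
    congr 1
    funext x
    simp
  apply Measure.ext_of_charFun
  ext t
  have hIntg : ∀ f : EuclideanSpace ℝ (Fin n) × EuclideanSpace ℝ (Fin n) → ℝ, Measurable f → Integrable (fun p => Complex.exp ((f p : ℂ) * Complex.I)) (g.prod μ) := by
    intro f hf
    apply Integrable.of_bound (C := 1)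
    · apply Measurable.aestronglyMeasurable; fun_prop
    · exact ae_of_all _ fun ω => (norm_exp_I _).le
  have s1 : charFun μ t = ∫ x, charFun μ ((‖t‖ / ‖x‖) • x) ∂g := by
    have : ∀ᵐ x ∂g, charFun μ ((‖t‖ / ‖x‖) • x) = charFun μ t := by
      filter_upwards [hg0] with x hx
      apply h.charFun_eq
      have : ‖x‖ ≠ 0 := norm_ne_zero_iff.2 hx
      rw [norm_smul, norm_div, norm_norm, norm_norm]; field_simp
    rw [integral_congr_ae this]; simp
  rw [s1]
  simp only [charFun_apply]
  rw [integral_map hm.aemeasurable (by apply Continuous.aestronglyMeasurable; fun_prop)]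
  rw [← integral_prod (f := fun p : EuclideanSpace ℝ (Fin n) × EuclideanSpace ℝ (Fin n) => Complex.exp ((inner ℝ p.2 ((‖t‖ / ‖p.1‖) • p.1) : ℝ) * Complex.I)) (hIntg _ (by fun_prop))]
  rw [integral_prod_symm _ (hIntg _ (by fun_prop)), integral_prod_symm _ (hIntg _ (by fun_prop))]
  congr 1
  funext x
  have a1 : charFun g1 (‖t‖ • x) = ∫ y, Complex.exp ((inner ℝ x ((‖t‖ / ‖y‖) • y) : ℝ) * Complex.I) ∂g := by
    rw [charFun_apply, hg1, integral_map hm1.aemeasurable (by apply Continuous.aestronglyMeasurable; fun_prop)]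
    congr 1; funext y
    congr 3
    rw [real_inner_comm]
    simp only [inner_smul_left, inner_smul_right]; simp; ring
  have a2 : charFun g1 (‖x‖ • t) = ∫ y, Complex.exp ((inner ℝ ((‖x‖ / ‖y‖) • y) t : ℝ) * Complex.I) ∂g := by
    rw [charFun_apply, hg1, integral_map hm1.aemeasurable (by apply Continuous.aestronglyMeasurable; fun_prop)]
    congr 1; funext y
    congr 3
    simp only [inner_smul_left, inner_smul_right]; simp; ring
  rw [← a1, ← a2]
  apply hg1inv.charFun_eq
  simp [norm_smul, mul_comm]

lemma gauss_rot (n : ℕ) : RotInv (ProbabilityTheory.stdGaussian (EuclideanSpace ℝ (Fin n))) := fun e => stdGaussian_map e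

lemma gauss_ne (n : ℕ) [NeZero n] : ∀ᵐ x ∂(ProbabilityTheory.stdGaussian (EuclideanSpace ℝ (Fin n))), x ≠ 0 := by
  rw [← gauss_eq]
  have : _root_.stdGaussian n ≪ volume := withDensity_absolutelyContinuous _ _
  apply this.ae_le
  haveI : Nonempty (Fin n) := ⟨0⟩
  exact Measure.ae_ne volume 0

lemma Ac_zero {n : ℕ} (s : Smp n) : √(Ac 0 s) = ‖(WithLp.toLp 2 s.1 : EuclideanSpace ℝ (Fin n))‖ := by
  rw [EuclideanSpace.norm_eq]; simp [Ac]

/-- every rotation invariant law without atom at the origin has a Gaussian representation -/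
theorem RotInv.grep {n : ℕ} [NeZero n] {μ : Measure (EuclideanSpace ℝ (Fin n))} [IsProbabilityMeasure μ] (h : RotInv μ) (h0 : ∀ᵐ x ∂μ, x ≠ 0) :
    GRep n μ (μ.map norm) (fun s => √(Ac 0 s) / s.2) := by
  haveI : IsProbabilityMeasure (μ.map norm) := Measure.isProbabilityMeasure_map (by fun_prop)
  have hk : kap n (μ.map norm) = ((Measure.pi fun _ : Fin n => gaussianReal 0 1).prod μ).map (Prod.map id norm) := by
    rw [kap, ← Measure.map_prod_map _ _ measurable_id measurable_norm, Measure.map_id]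
  have hgm : (ProbabilityTheory.stdGaussian (EuclideanSpace ℝ (Fin n))).prod μ = ((Measure.pi fun _ : Fin n => gaussianReal 0 1).prod μ).map (Prod.map (WithLp.toLp 2) id) := by
    rw [← map_pi_eq_stdGaussian, ← Measure.map_prod_map _ _ (by fun_prop) measurable_id, Measure.map_id]
  refine ⟨inferInstance, ⟨fun p => √p.1 / p.2, by fun_prop, fun s => by simp [Ac]⟩, ?_, ?_⟩
  · have ha : ∀ᵐ s ∂kap n (μ.map norm), 0 < s.2 := by
      have : ∀ᵐ R ∂(μ.map norm), 0 < R := by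
        rw [ae_map_iff (by fun_prop) measurableSet_Ioi]
        filter_upwards [h0] with x hx using norm_pos_iff.2 hx
      rw [← kap_map_snd n (μ.map norm)] at this
      exact ae_of_ae_map (by fun_prop) this
    have hb : ∀ᵐ s ∂kap n (μ.map norm), 0 < √(Ac 0 s) := by
      have h1 := gauss_ne n
      rw [← map_pi_eq_stdGaussian] at h1
      have h2 : ∀ᵐ g ∂(Gm n), (WithLp.toLp 2 g : EuclideanSpace ℝ (Fin n)) ≠ 0 := ae_of_ae_map (f := WithLp.toLp 2) (p := fun x : EuclideanSpace ℝ (Fin n) => x ≠ 0) (by fun_prop) h1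
      rw [← kap_map_fst n (μ.map norm)] at h2
      have h3 := ae_of_ae_map (by fun_prop) h2
      filter_upwards [h3] with s hs
      rw [Ac_zero]; exact norm_pos_iff.2 hs
    filter_upwards [ha, hb] with s h1 h2
    exact div_pos h2 h1
  · conv_lhs => rw [h.rep (ProbabilityTheory.stdGaussian (EuclideanSpace ℝ (Fin n))) (gauss_rot n) (gauss_ne n)]
    rw [hgm, hk, Measure.map_map (by fun_prop) (by fun_prop), Measure.map_map (by have := Ac_zero (n := n); simp only [this]; fun_prop) (by fun_prop)]
    congr 1
    funext p
    simp [Ac_zero]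

/-- models with concentrated radius -/
theorem mdl_radial {μ : (n : ℕ) → Measure (EuclideanSpace ℝ (Fin n))} {C : ℝ} (hC : 0 ≤ C) (n0 : ℕ)
    (h : ∀ n ≥ n0, IsProbabilityMeasure (μ n) ∧ RotInv (μ n) ∧ GoodR n C ((μ n).map norm)) : Mdl 1 μ := by
  intro β hβ hβ1
  refine ⟨100 * (1 + C) / β, ?_, max n0 8, fun n hn => ?_⟩
  · rw [one_le_div hβ]; linarith
  have hn1 : n0 ≤ n := (le_max_left _ _).trans hn
  have hn8 : 8 ≤ n := (le_max_right _ _).trans hn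
  obtain ⟨hp, hr, hg⟩ := h n hn1
  haveI : NeZero n := ⟨by omega⟩
  have h0 : ∀ᵐ x ∂μ n, x ≠ 0 := by
    filter_upwards [ae_of_ae_map (by fun_prop) hg.mem] with x hx
    exact norm_pos_iff.1 hx.1
  refine ⟨1, one_pos, μ n, _, _, hr.grep h0, goodW_sphere hn8 hβ hβ1 hC hg, fun r F hF => ?_⟩
  simp

end

section
open MeasureTheory ProbabilityTheory Real Filter Finset
set_option linter.all false

lemma sphere_pos (m : ℕ) : 0 < μH[(m:ℝ)] (Metric.sphere (0 : EuclideanSpace ℝ (Fin (m + 1))) 1) := by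
  set f : EuclideanSpace ℝ (Fin (m + 1)) → (Fin m → ℝ) := fun x i => x i.succ with hf
  have hL : LipschitzWith 1 f := by
    apply LipschitzWith.of_dist_le_mul
    intro x y
    rw [dist_pi_le_iff (by positivity)]
    intro i
    rw [NNReal.coe_one, one_mul, dist_eq_norm, dist_eq_norm]
    exact PiLp.norm_apply_le (x - y) i.succ
  have h1 := (hL.lipschitzOnWith (s := Metric.sphere 0 1)).hausdorffMeasure_image_le (Nat.cast_nonneg m)
  have hsub : {y : Fin m → ℝ | ∑ i, y i ^ 2 < 1} ⊆ f '' Metric.sphere 0 1 := by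
    intro y hy
    have hy : ∑ i, y i ^ 2 < 1 := hy
    refine ⟨WithLp.toLp 2 (Fin.cons (√(1 - ∑ i, y i ^ 2)) y), ?_, ?_⟩
    · rw [mem_sphere_zero_iff_norm, EuclideanSpace.norm_eq, Fin.sum_univ_succ]
      simp only [Fin.cons_zero, Fin.cons_succ, Real.norm_eq_abs, sq_abs]
      rw [Real.sq_sqrt (by linarith)]; simp
    · funext i; simp [hf]
  have hpos : 0 < volume {y : Fin m → ℝ | ∑ i, y i ^ 2 < 1} := by
    apply IsOpen.measure_pos
    · exact isOpen_lt (by fun_prop) continuous_const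
    · exact ⟨0, by simp⟩
  have e : (μH[(m:ℝ)] : Measure (Fin m → ℝ)) = volume := by
    have := hausdorffMeasure_pi_real (ι := Fin m)
    rwa [Fintype.card_fin] at this
  rw [e] at h1
  simp only [NNReal.coe_one, ENNReal.coe_one, ENNReal.one_rpow, one_mul] at h1
  exact hpos.trans_le ((measure_mono hsub).trans h1)

lemma normalize_lip {E : Type*} [NormedAddCommGroup E] [NormedSpace ℝ E] {x y : E} (hx : 1 ≤ ‖x‖) (hy : 1 ≤ ‖y‖) : dist (‖x‖⁻¹ • x) (‖y‖⁻¹ • y) ≤ 2 * dist x y := by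
  rw [dist_eq_norm, dist_eq_norm]
  have h1 : ‖x‖⁻¹ • x - ‖y‖⁻¹ • y = ‖x‖⁻¹ • (x - y) + (‖x‖⁻¹ - ‖y‖⁻¹) • y := by
    rw [smul_sub, sub_smul]; abel
  have hx0 : 0 < ‖x‖ := by linarith
  have hy0 : 0 < ‖y‖ := by linarith
  have hi : ‖x‖⁻¹ ≤ 1 := inv_le_one_of_one_le₀ hx
  rw [h1]
  refine (norm_add_le _ _).trans ?_
  rw [norm_smul, norm_smul, norm_inv, norm_norm, Real.norm_eq_abs]
  have h2 : |‖x‖⁻¹ - ‖y‖⁻¹| * ‖y‖ = ‖x‖⁻¹ * |‖y‖ - ‖x‖| := by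
    rw [← abs_of_pos hy0, ← abs_mul, abs_of_pos hy0, ← abs_of_pos (inv_pos.2 hx0), ← abs_mul, abs_of_pos (inv_pos.2 hx0)]
    congr 1; field_simp
  rw [h2]
  have h3 : |‖y‖ - ‖x‖| ≤ ‖x - y‖ := by rw [norm_sub_rev]; exact abs_norm_sub_norm_le y x
  have h4 := norm_nonneg (x - y)
  nlinarith [abs_nonneg (‖y‖ - ‖x‖), inv_pos.2 hx0]

lemma sphere_fin (m : ℕ) : μH[(m:ℝ)] (Metric.sphere (0 : EuclideanSpace ℝ (Fin (m + 1))) 1) < ⊤ := by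
  have e : (μH[(m:ℝ)] : Measure (Fin m → ℝ)) = volume := by
    have := hausdorffMeasure_pi_real (ι := Fin m)
    rwa [Fintype.card_fin] at this
  set A : Fin (m + 1) → ℝ → (Fin m → ℝ) → EuclideanSpace ℝ (Fin (m + 1)) := fun i c y => WithLp.toLp 2 (i.insertNth c y) with hA
  set B : Fin (m + 1) → ℝ → (Fin m → ℝ) → EuclideanSpace ℝ (Fin (m + 1)) := fun i c y => ‖A i c y‖⁻¹ • A i c y with hB
  have hBl : ∀ i c, |c| = 1 → ∃ K, LipschitzWith K (B i c) := by
    intro i c hc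
    obtain ⟨K, hK⟩ : ∃ K, LipschitzWith K (A i c) := by
      have h1 : LipschitzWith 1 (fun y : Fin m → ℝ => (i.insertNth c y : Fin (m + 1) → ℝ)) := by
        apply LipschitzWith.of_dist_le_mul
        intro x y
        rw [dist_pi_le_iff (by positivity)]
        intro j
        rw [NNReal.coe_one, one_mul]
        refine Fin.succAboveCases i ?_ (fun k => ?_) j
        · simp
        · simp [dist_le_pi_dist]
      exact ⟨_, (PiLp.lipschitzWith_toLp 2 _).comp h1⟩
    have hn : ∀ y, 1 ≤ ‖A i c y‖ := by
      intro y
      have := PiLp.norm_apply_le (A i c y) i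
      simpa [hA, hc] using this
    refine ⟨2 * K, LipschitzWith.of_dist_le_mul fun x y => ?_⟩
    refine (normalize_lip (hn x) (hn y)).trans ?_
    have := hK.dist_le_mul x y
    push_cast
    linarith
  have hfin : ∀ i c, |c| = 1 → μH[(m:ℝ)] (B i c '' (Metric.closedBall 0 1)) < ⊤ := by
    intro i c hc
    obtain ⟨K, hK⟩ := hBl i c hc
    refine ((hK.lipschitzOnWith (s := Metric.closedBall 0 1)).hausdorffMeasure_image_le (Nat.cast_nonneg m)).trans_lt ?_
    rw [e]
    apply ENNReal.mul_lt_top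
    · exact ENNReal.rpow_lt_top_of_nonneg (Nat.cast_nonneg m) ENNReal.coe_ne_top
    · exact measure_closedBall_lt_top
  have hsub : Metric.sphere (0 : EuclideanSpace ℝ (Fin (m + 1))) 1 ⊆ ⋃ i : Fin (m + 1), (B i 1 '' Metric.closedBall 0 1 ∪ B i (-1) '' Metric.closedBall 0 1) := by
    intro x hx
    rw [mem_sphere_zero_iff_norm] at hx
    obtain ⟨i, -, hi⟩ := Finset.exists_max_image (Finset.univ : Finset (Fin (m + 1))) (fun i => |x i|) ⟨0, Finset.mem_univ _⟩
    have hi0 : 0 < |x i| := by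
      rw [abs_pos]; intro h0
      have : x = 0 := by
        ext j
        have := hi j (Finset.mem_univ _)
        rw [h0, abs_zero] at this
        simpa using this
      rw [this] at hx; simp at hx
    set y : Fin m → ℝ := fun j => x (i.succAbove j) / |x i| with hy
    have hyb : y ∈ Metric.closedBall (0 : Fin m → ℝ) 1 := by
      rw [mem_closedBall_zero_iff, pi_norm_le_iff_of_nonneg zero_le_one]
      intro j
      rw [hy, Real.norm_eq_abs, abs_div, abs_abs]
      exact div_le_one_of_le₀ (hi _ (Finset.mem_univ _)) hi0.le
    have key : ∀ c, c = x i / |x i| → B i c y = x := by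
      intro c hc
      have hAx : A i c y = |x i|⁻¹ • x := by
        ext j
        refine Fin.succAboveCases i ?_ (fun k => ?_) j
        · simp [hA, hc]; ring
        · simp [hA, hy]; ring
      rw [hB]; beta_reduce
      rw [hAx, norm_smul, hx, smul_smul]
      simp [hi0.ne']
    rw [Set.mem_iUnion]
    refine ⟨i, ?_⟩
    rcases abs_cases (x i) with ⟨h1, h2⟩ | ⟨h1, h2⟩
    · left
      exact ⟨y, hyb, key 1 (by rw [h1] at hi0 ⊢; rw [div_self hi0.ne'])⟩
    · right
      exact ⟨y, hyb, key (-1) (by rw [h1, div_neg, div_self h2.ne])⟩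
  refine (measure_mono hsub).trans_lt ?_
  refine (measure_iUnion_le _).trans_lt ?_
  rw [tsum_fintype]
  apply ENNReal.sum_lt_top.2
  intro i _
  exact (measure_union_le _ _).trans_lt (ENNReal.add_lt_top.2 ⟨hfin i 1 (by simp), hfin i (-1) (by simp)⟩)

theorem mdl_sphere {μ : (n : ℕ) → Measure (EuclideanSpace ℝ (Fin n))} (h : ∀ n, μ n = sphereUniform n) : Mdl 1 μ := by
  refine mdl_radial (C := 0) le_rfl 1 fun n hn => ?_
  rw [h]
  obtain ⟨m, rfl⟩ : ∃ m, n = m + 1 := ⟨n - 1, by omega⟩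
  have hm : ((m + 1 : ℕ) : ℝ) - 1 = m := by push_cast; ring
  have hp : IsProbabilityMeasure (sphereUniform (m + 1)) := by
    constructor
    rw [sphereUniform, hm, Measure.smul_apply, Measure.restrict_apply_univ, smul_eq_mul]
    exact ENNReal.inv_mul_cancel (sphere_pos m).ne' (sphere_fin m).ne
  have hae : ∀ᵐ R ∂((sphereUniform (m + 1)).map norm), R = 1 := by
    refine (ae_map_iff (μ := sphereUniform (m+1)) (f := norm) (p := fun R => R = 1) (by fun_prop) (measurableSet_singleton (1:ℝ))).2 ?_
    rw [sphereUniform]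
    apply Measure.ae_smul_measure
    filter_upwards [ae_restrict_mem Metric.isClosed_sphere.measurableSet] with x hx
    exact mem_sphere_zero_iff_norm.1 hx
  refine ⟨hp, ?_, ?_⟩
  · intro e
    rw [sphereUniform, Measure.map_smul]
    congr 1
    have h1 := (e.toIsometryEquiv.measurePreserving_hausdorffMeasure (((m + 1 : ℕ) : ℝ) - 1)).restrict_preimage (s := Metric.sphere (0 : EuclideanSpace ℝ (Fin (m + 1))) 1) Metric.isClosed_sphere.measurableSet
    have h2 : e.toIsometryEquiv ⁻¹' Metric.sphere (0 : EuclideanSpace ℝ (Fin (m + 1))) 1 = Metric.sphere (0 : EuclideanSpace ℝ (Fin (m + 1))) 1 := by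
      ext x; simp
    rw [h2] at h1
    exact h1.map_eq
  · haveI : IsProbabilityMeasure ((sphereUniform (m + 1)).map norm) := Measure.isProbabilityMeasure_map (by fun_prop)
    refine ⟨this, ?_, ?_, ?_⟩
    · filter_upwards [hae] with R hR
      rw [hR]; norm_num
    · refine (MemLp.zero (ε := ℝ)).ae_eq ?_
      filter_upwards [hae] with R hR
      rw [hR]; norm_num
    · have : (fun R : ℝ => ((R ^ 2)⁻¹ - 1) ^ 2) =ᵐ[(sphereUniform (m + 1)).map norm] fun _ => 0 := by
        filter_upwards [hae] with R hR
        rw [hR]; norm_num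
      rw [integral_congr_ae this]; simp

end

section
open MeasureTheory ProbabilityTheory Real Filter Finset
set_option linter.all false

lemma betaPDFReal_int {a b : ℝ} (ha : 0 < a) (hb : 0 < b) :
    IntegrableOn (betaPDFReal a b) (Set.Ioi 0) ∧ ∫ z in Set.Ioi (0:ℝ), betaPDFReal a b z = 1 := by
  have hnn : ∀ z, 0 ≤ betaPDFReal a b z := by
    intro z
    by_cases h : 0 < z ∧ z < 1
    · exact (betaPDFReal_pos h.1 h.2 ha hb).le
    · simp [betaPDFReal, h]
  have h1 := lintegral_betaPDF_eq_one ha hb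
  have hi : Integrable (betaPDFReal a b) := by
    refine ⟨(measurable_betaPDFReal a b).aestronglyMeasurable, ?_⟩
    rw [hasFiniteIntegral_iff_ofReal (Eventually.of_forall hnn)]
    change ∫⁻ x, betaPDF a b x < _
    rw [h1]; simp
  refine ⟨hi.integrableOn, ?_⟩
  rw [setIntegral_eq_integral_of_forall_compl_eq_zero]
  · rw [integral_eq_lintegral_of_nonneg_ae (Eventually.of_forall hnn) hi.1]
    change (∫⁻ x, betaPDF a b x).toReal = _
    rw [h1]; simp
  · intro x hx
    have : ¬ (0 < x ∧ x < 1) := fun h => hx h.1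
    simp [betaPDFReal, this]

/-- radial beta-type function -/
noncomputable def radF (k b : ℝ) (y : ℝ) : ℝ := if y < 1 then y ^ (2 * k) * (1 - y ^ 2) ^ (b - 1) else 0

lemma radF_int (m : ℕ) {k b : ℝ} (hk : 0 < ((m + 1 : ℕ) : ℝ) / 2 + k) (hb : 0 < b) :
    Integrable (fun x : EuclideanSpace ℝ (Fin (m + 1)) => radF k b ‖x‖) ∧
    ∫ x : EuclideanSpace ℝ (Fin (m + 1)), radF k b ‖x‖ =
      ((m + 1 : ℕ) : ℝ) * (√π ^ (m + 1) / Real.Gamma (((m + 1 : ℕ) : ℝ) / 2 + 1)) * (1 / 2) * beta (((m + 1 : ℕ) : ℝ) / 2 + k) b := by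
  set a := ((m + 1 : ℕ) : ℝ) / 2 + k with ha
  obtain ⟨h1, h2⟩ := betaPDFReal_int hk hb
  have key : ∀ y ∈ Set.Ioi (0:ℝ), (|(2:ℝ)| * y ^ ((2:ℝ) - 1)) • betaPDFReal a b (y ^ (2:ℝ)) * (1 / 2 * beta a b) = y ^ m • radF k b y := by
    intro y (hy : 0 < y)
    have hb0 := (beta_pos hk hb).ne'
    have hy2 : y ^ (2:ℝ) = y ^ 2 := by norm_cast
    by_cases h : y < 1
    · have h3 : 0 < y ^ (2:ℝ) ∧ y ^ (2:ℝ) < 1 := by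
        rw [hy2]; exact ⟨by positivity, by nlinarith⟩
      rw [betaPDFReal, if_pos h3, radF, if_pos h]
      have h4 : y * (y ^ (2:ℝ)) ^ (a - 1) = y ^ m * y ^ (2 * k) := by
        rw [← Real.rpow_mul hy.le, ← Real.rpow_natCast, ← Real.rpow_add hy]
        nth_rw 1 [← Real.rpow_one y]
        rw [← Real.rpow_add hy]
        congr 1
        rw [ha]; push_cast; ring
      have h5 : y ^ ((2:ℝ) - 1) = y := by norm_num
      rw [h5, smul_eq_mul, smul_eq_mul, ← mul_assoc (y ^ m), ← h4, hy2]
      rw [abs_of_pos (by norm_num : (0:ℝ) < 2)]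
      field_simp
    · have h3 : ¬ (0 < y ^ (2:ℝ) ∧ y ^ (2:ℝ) < 1) := by
        rw [hy2]; push Not at h; intro h; nlinarith [h.2]
      rw [betaPDFReal, if_neg h3, radF, if_neg h]; simp
  have hfr : Module.finrank ℝ (EuclideanSpace ℝ (Fin (m + 1))) = m + 1 := by simp
  constructor
  · rw [integrable_fun_norm_addHaar volume (f := radF k b), hfr, Nat.add_sub_cancel]
    have := ((integrableOn_Ioi_comp_rpow_iff (betaPDFReal a b) (p := 2) (by norm_num)).2 h1)
    refine (integrableOn_congr_fun key measurableSet_Ioi).1 ?_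
    exact Integrable.mul_const this _
  · rw [integral_fun_norm_addHaar volume (radF k b), hfr, Nat.add_sub_cancel, ← setIntegral_congr_fun measurableSet_Ioi key,
      integral_mul_const, integral_comp_rpow_Ioi (betaPDFReal a b) (by norm_num), h2, measureReal_def, EuclideanSpace.volume_ball]
    simp only [Fintype.card_fin]
    rw [ENNReal.ofReal_one, one_pow, one_mul, ENNReal.toReal_ofReal (by positivity)]
    simp only [nsmul_eq_mul, smul_eq_mul]; ring

lemma beta_const (m : ℕ) {ν : ℝ} (hν : 0 < ν) :
    π ^ (-((m + 1 : ℕ) : ℝ) / 2) * Real.Gamma ((((m + 1 : ℕ) : ℝ) + ν) / 2) / Real.Gamma (ν / 2) *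
    (((m + 1 : ℕ) : ℝ) * (√π ^ (m + 1) / Real.Gamma (((m + 1 : ℕ) : ℝ) / 2 + 1)) * (1 / 2)) = (beta (((m + 1 : ℕ) : ℝ) / 2) (ν / 2))⁻¹ := by
  set N := ((m + 1 : ℕ) : ℝ) with hN
  have hN0 : 0 < N := by rw [hN]; positivity
  have h1 : √π ^ (m + 1) = π ^ (N / 2) := by
    rw [Real.sqrt_eq_rpow, ← Real.rpow_natCast, ← Real.rpow_mul pi_pos.le, hN]; congr 1; ring
  have h2 : π ^ (-N / 2) * π ^ (N / 2) = 1 := by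
    rw [← Real.rpow_add pi_pos]; ring_nf; simp
  have g1 := Real.Gamma_pos_of_pos (by positivity : 0 < N / 2)
  have g2 := Real.Gamma_pos_of_pos (by positivity : 0 < ν / 2)
  have g3 := Real.Gamma_pos_of_pos (by positivity : 0 < (N + ν) / 2)
  rw [h1, Real.Gamma_add_one (by positivity), beta, ← add_div]
  rw [neg_div] at *
  field_simp
  linear_combination h2

lemma beta_ratio {s b : ℝ} (hs : 2 < s) (hb : 0 < b) :
    (beta s b)⁻¹ * beta (s - 2) (b + 2) = b * (b + 1) / ((s - 1) * (s - 2)) := by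
  have g1 := Real.Gamma_pos_of_pos (by linarith : 0 < s - 2)
  have g2 := Real.Gamma_pos_of_pos hb
  have g3 := Real.Gamma_pos_of_pos (by linarith : 0 < s + b)
  have e1 : Real.Gamma s = (s - 1) * ((s - 2) * Real.Gamma (s - 2)) := by
    rw [← Real.Gamma_add_one (by linarith), show s - 2 + 1 = s - 1 by ring, ← Real.Gamma_add_one (by linarith)]; congr 1; ring
  have e2 : Real.Gamma (b + 2) = (b + 1) * (b * Real.Gamma b) := by
    rw [← Real.Gamma_add_one (by linarith), ← Real.Gamma_add_one (by linarith)]; congr 1; ring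
  have h1 : s - 1 ≠ 0 := by linarith
  have h2 : s - 2 ≠ 0 := by linarith
  rw [beta, beta, show s - 2 + (b + 2) = s + b by ring, e1, e2]
  field_simp

theorem mdl_beta {ν : ℝ} (hν : 0 < ν) {μ : (n : ℕ) → Measure (EuclideanSpace ℝ (Fin n))} (h : ∀ n, μ n = betaModel n ν) : Mdl 1 μ := by
  refine mdl_radial (C := 4 * ν * (ν + 2)) (by positivity) 8 fun n hn => ?_
  rw [h]
  obtain ⟨m, rfl⟩ : ∃ m, n = m + 1 := ⟨n - 1, by omega⟩
  set N := ((m + 1 : ℕ) : ℝ) with hN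
  have hN8 : (8:ℝ) ≤ N := by rw [hN]; exact_mod_cast hn
  set c := π ^ (-N / 2) * Real.Gamma ((N + ν) / 2) / Real.Gamma (ν / 2) with hc
  have hc0 : 0 < c := by
    have g2 := Real.Gamma_pos_of_pos (by positivity : 0 < ν / 2)
    have g3 := Real.Gamma_pos_of_pos (by positivity : 0 < (N + ν) / 2)
    rw [hc]; positivity
  have hcK := beta_const m hν
  rw [← hN, ← hc] at hcK
  have hdm : Measurable fun x : EuclideanSpace ℝ (Fin (m + 1)) => c * radF 0 (ν / 2) ‖x‖ := by
    unfold radF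
    refine Measurable.const_mul (Measurable.ite (measurableSet_lt (by fun_prop) (by fun_prop)) (by fun_prop) (by fun_prop)) _
  have hF0 : ∀ k b (x : EuclideanSpace ℝ (Fin (m + 1))), 0 ≤ radF k b ‖x‖ := by
    intro k b x
    unfold radF
    split_ifs with h1
    · have : 0 ≤ 1 - ‖x‖ ^ 2 := by nlinarith [norm_nonneg x]
      positivity
    · exact le_rfl
  have hbm : betaModel (m + 1) ν = volume.withDensity fun x => ENNReal.ofReal (c * radF 0 (ν / 2) ‖x‖) := by
    unfold betaModel
    congr 1; funext x
    unfold radF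
    split_ifs with h1
    · rw [hc]; congr 2; simp; congr 1; ring
    · simp
  have hp : IsProbabilityMeasure (betaModel (m + 1) ν) := by
    constructor
    obtain ⟨i1, i2⟩ := radF_int m (k := 0) (b := ν / 2) (by positivity) (by positivity)
    rw [hbm, withDensity_apply _ MeasurableSet.univ, Measure.restrict_univ, ← ofReal_integral_eq_lintegral_ofReal (i1.const_mul c) (Eventually.of_forall fun x => mul_nonneg hc0.le (hF0 _ _ x))]
    rw [integral_const_mul, i2, ← hN, ← mul_assoc, hcK, add_zero, inv_mul_cancel₀ (beta_pos (by positivity) (by positivity)).ne']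
    simp
  have hacn : ∀ᵐ x ∂(betaModel (m + 1) ν), x ≠ 0 := by
    rw [hbm]
    refine (withDensity_absolutelyContinuous _ _).ae_le ?_
    exact Measure.ae_ne volume 0
  have hlt : ∀ᵐ x ∂(betaModel (m + 1) ν), ‖x‖ < 1 := by
    rw [hbm, ae_withDensity_iff hdm.ennreal_ofReal]
    refine Eventually.of_forall fun x hx => ?_
    by_contra h1
    exact hx (by simp [radF, h1])
  refine ⟨hp, ?_, ?_⟩
  · intro e
    rw [hbm]
    ext s hs
    rw [Measure.map_apply e.continuous.measurable hs, withDensity_apply _ hs, withDensity_apply _ (e.continuous.measurable hs)]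
    rw [← e.measurePreserving.setLIntegral_comp_preimage hs hdm.ennreal_ofReal]
    simp
  · haveI : IsProbabilityMeasure ((betaModel (m + 1) ν).map norm) := Measure.isProbabilityMeasure_map (by fun_prop)
    have hXm : Measurable fun R : ℝ => (R ^ 2)⁻¹ - 1 := by fun_prop
    have hkey : ∀ x : EuclideanSpace ℝ (Fin (m + 1)), x ≠ 0 → (c * radF 0 (ν / 2) ‖x‖) * ((‖x‖ ^ 2)⁻¹ - 1) ^ 2 = c * radF (-2) (ν / 2 + 2) ‖x‖ := by
      intro x hx
      have hx0 : 0 < ‖x‖ := norm_pos_iff.2 hx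
      unfold radF
      split_ifs with h1
      · have h2 : 0 < 1 - ‖x‖ ^ 2 := by nlinarith
        have h3 : (1 - ‖x‖ ^ 2) ^ (ν / 2 + 2 - 1) = (1 - ‖x‖ ^ 2) ^ (ν / 2 - 1) * (1 - ‖x‖ ^ 2) ^ 2 := by
          rw [show ν / 2 + 2 - 1 = (ν / 2 - 1) + ((2 : ℕ) : ℝ) by push_cast; ring, Real.rpow_add h2, Real.rpow_natCast]
        have h4 : ‖x‖ ^ (2 * (-2) : ℝ) = (‖x‖ ^ 4)⁻¹ := by
          rw [show (2 * (-2) : ℝ) = -((4:ℕ) : ℝ) by norm_num, Real.rpow_neg hx0.le, Real.rpow_natCast]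
        rw [h3, h4, mul_zero, Real.rpow_zero]
        field_simp
      · simp
    obtain ⟨i1, i2⟩ := radF_int m (k := -2) (b := ν / 2 + 2) (by rw [← hN]; linarith) (by positivity)
    have hkae : (fun x : EuclideanSpace ℝ (Fin (m + 1)) => (c * radF 0 (ν / 2) ‖x‖) * ((‖x‖ ^ 2)⁻¹ - 1) ^ 2) =ᵐ[volume] fun x => c * radF (-2) (ν / 2 + 2) ‖x‖ := by
      filter_upwards [Measure.ae_ne volume (0 : EuclideanSpace ℝ (Fin (m + 1)))] with x hx using hkey x hx
    have hI : Integrable (fun R : ℝ => ((R ^ 2)⁻¹ - 1) ^ 2) ((betaModel (m + 1) ν).map norm) := by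
      rw [integrable_map_measure (by fun_prop) (by fun_prop), hbm]
      rw [integrable_withDensity_iff_integrable_smul' hdm.ennreal_ofReal (Eventually.of_forall fun x => ENNReal.ofReal_lt_top)]
      refine ((i1.const_mul c).congr hkae.symm).congr (Eventually.of_forall fun x => ?_)
      simp only [Function.comp, smul_eq_mul]
      rw [ENNReal.toReal_ofReal (mul_nonneg hc0.le (hF0 _ _ x))]
    refine ⟨this, ?_, ?_, ?_⟩
    · refine (ae_map_iff (μ := betaModel (m+1) ν) (f := norm) (p := fun R => 0 < R ∧ R ≤ 1) (by fun_prop) measurableSet_Ioc).2 ?_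
      filter_upwards [hacn, hlt] with x h1 h2 using ⟨norm_pos_iff.2 h1, h2.le⟩
    · exact (memLp_two_iff_integrable_sq hXm.aestronglyMeasurable).2 hI
    · rw [integral_map (by fun_prop) (by fun_prop), hbm, integral_withDensity_eq_integral_toReal_smul hdm.ennreal_ofReal (Eventually.of_forall fun x => ENNReal.ofReal_lt_top)]
      have : ∀ x : EuclideanSpace ℝ (Fin (m + 1)), (ENNReal.ofReal (c * radF 0 (ν / 2) ‖x‖)).toReal • ((‖x‖ ^ 2)⁻¹ - 1) ^ 2 = (c * radF 0 (ν / 2) ‖x‖) * ((‖x‖ ^ 2)⁻¹ - 1) ^ 2 := by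
        intro x
        rw [ENNReal.toReal_ofReal (mul_nonneg hc0.le (hF0 _ _ x)), smul_eq_mul]
      simp only [this]
      rw [integral_congr_ae hkae, integral_const_mul, i2, ← hN, ← mul_assoc, hcK, ← sub_eq_add_neg, beta_ratio (by linarith) (by positivity)]
      rw [div_le_div_iff₀ (by apply mul_pos <;> linarith) (by positivity)]
      have h1 : N ^ 2 ≤ 16 * ((N / 2 - 1) * (N / 2 - 2)) := by nlinarith
      have h2 : 0 < ν * (ν + 2) := by positivity
      nlinarith [mul_le_mul_of_nonneg_left h1 h2.le]

end

theorem stmt16 (r : ℕ → ℕ) (hr : ∀ n, 1 ≤ n → 1 ≤ r n ∧ r n ≤ n)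
    (μ : (n : ℕ) → Measure (EuclideanSpace ℝ (Fin n)))
    (hμ : (∀ n, μ n = stdGaussian n)
      ∨ (∃ ν : ℝ, 0 < ν ∧ ∀ n, μ n = betaModel n ν)
      ∨ (∀ n, μ n = sphereUniform n)) :
    -- (1) central limit theorem for the volume when r = o(n)
    (Tendsto (fun n : ℕ => (r n : ℝ) / n) atTop (nhds 0) →
      ∃ a b : ℕ → ℝ, (∀ n, 0 < b n) ∧
        ∀ f : BoundedContinuousFunction ℝ ℝ,
          Tendsto
            (fun n : ℕ =>
              ∫ X, f ((simplexVol n (r n) X - a n) / b n)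
                ∂(Measure.pi fun _ : Fin (r n + 1) => μ n))
            atTop (nhds (∫ z, f z ∂gaussianReal 0 1)))
    -- (2) log-normal limit when r ∼ α n, Gaussian model
    ∧ ((∀ n, μ n = stdGaussian n) →
      ∀ α ∈ Set.Ioo (0 : ℝ) 1,
        Tendsto (fun n : ℕ => (r n : ℝ) / n) atTop (nhds α) →
        ∃ b : ℕ → ℝ, (∀ n, 0 < b n) ∧
          ∀ f : BoundedContinuousFunction ℝ ℝ,
            Tendsto
              (fun n : ℕ =>
                ∫ X, f (simplexVol n (r n) X / b n)
                  ∂(Measure.pi fun _ : Fin (r n + 1) => μ n))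
              atTop
              (nhds (∫ z, f (Real.exp
                (Real.sqrt ((1 / 2 : ℝ) * Real.log (1 / (1 - α))) * z))
                ∂gaussianReal 0 1)))
    -- (2') log-normal limit when r ∼ α n, Beta or spherical model
    ∧ (((∃ ν : ℝ, 0 < ν ∧ ∀ n, μ n = betaModel n ν) ∨ (∀ n, μ n = sphereUniform n)) →
      ∀ α ∈ Set.Ioo (0 : ℝ) 1,
        Tendsto (fun n : ℕ => (r n : ℝ) / n) atTop (nhds α) →
        ∃ b : ℕ → ℝ, (∀ n, 0 < b n) ∧
          ∀ f : BoundedContinuousFunction ℝ ℝ,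
            Tendsto
              (fun n : ℕ =>
                ∫ X, f (simplexVol n (r n) X / b n)
                  ∂(Measure.pi fun _ : Fin (r n + 1) => μ n))
              atTop
              (nhds (∫ z, f (Real.exp
                (Real.sqrt ((1 / 2 : ℝ) * Real.log (1 / (1 - α)) - α / 2) * z))
                ∂gaussianReal 0 1))) := by
  have hr' : ∀ n, 1 ≤ n → 1 ≤ r n := fun n hn => (hr n hn).1
  refine ⟨?_, ?_, ?_⟩
  · intro hlim
    rcases hμ with h | ⟨ν, hν, h⟩ | h
    · exact concl_one le_rfl zero_le_one (mdl_gauss h) r hr' hlim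
    · exact concl_one zero_le_one le_rfl (mdl_beta hν h) r hr' hlim
    · exact concl_one zero_le_one le_rfl (mdl_sphere h) r hr' hlim
  · intro h α hα hlim
    obtain ⟨b, hb, hf⟩ := concl_two le_rfl zero_le_one (mdl_gauss h) r hr' hα hlim
    refine ⟨b, hb, fun f => ?_⟩
    have e := hf f
    rw [show (1 / 2 : ℝ) * Real.log (1 / (1 - α)) - 0 * (2 - 0) * α / 2 = (1 / 2 : ℝ) * Real.log (1 / (1 - α)) by ring] at e
    exact e
  · intro h α hα hlim
    have hM : Mdl 1 μ := by
      rcases h with ⟨ν, hν, h⟩ | h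
      · exact mdl_beta hν h
      · exact mdl_sphere h
    obtain ⟨b, hb, hf⟩ := concl_two zero_le_one le_rfl hM r hr' hα hlim
    refine ⟨b, hb, fun f => ?_⟩
    have e := hf f
    rw [show (1 / 2 : ℝ) * Real.log (1 / (1 - α)) - 1 * (2 - 1) * α / 2 = (1 / 2 : ℝ) * Real.log (1 / (1 - α)) - α / 2 by ring] at e
    exact e
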